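/- arXiv:math/0703684 — 3 statements merged into one kernel-verified Lean document; each statement's English description precedes it below -/
import Mathlib

section
/- For every z ∈ ℂ with Re z < 0, the operator P_min − z : 𝒟(P_min) → L²(ℝ^n) is bijective, and its inverse is bounded with ‖(P_min − z)^{-1}‖ ≤ |Re z|^{-1}. -/
open MeasureTheory Complex ComplexConjugate

noncomputable section

/-- Partial derivative `∂_{x_j} f (x)` of a complex-valued function on `ℝⁿ`. -/
def pd {n : ℕ} (j : Fin n) (f : (Fin n → ℝ) → ℂ) (x : Fin n → ℝ) : ℂ :=
  fderiv ℝ f x (Pi.single j 1)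

/-- The semiclassical momentum operator `h D_{x_j} = (h/i) ∂_{x_j}`. -/
def hD {n : ℕ} (h : ℝ) (j : Fin n) (f : (Fin n → ℝ) → ℂ) (x : Fin n → ℝ) : ℂ :=
  ((h : ℂ) / Complex.I) * pd j f x

/-- The operator
`P = Σ_{j,k} hD_{x_j} ∘ b_{jk} ∘ hD_{x_k} + (1/2) Σ_j (c_j h∂_{x_j} + h∂_{x_j} ∘ c_j) + p₀`. -/
def Pop (n : ℕ) (h : ℝ) (b : Fin n → Fin n → (Fin n → ℝ) → ℝ)
    (c : Fin n → (Fin n → ℝ) → ℝ) (p0 : (Fin n → ℝ) → ℝ)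
    (u : (Fin n → ℝ) → ℂ) (x : Fin n → ℝ) : ℂ :=
  (∑ j, ∑ k, hD h j (fun y => (b j k y : ℂ) * hD h k u y) x)
    + (1 / 2) * ∑ j, ((c j x : ℂ) * ((h : ℂ) * pd j u x)
        + (h : ℂ) * pd j (fun y => (c j y : ℂ) * u y) x)
    + (p0 x : ℂ) * u x

/-- The graph of `P` acting on Schwartz functions, as a subset of `L² × L²`.  Its closure
is the graph of the minimal closed extension `P_min` (the graph closure of `P` from `𝒮`). -/
def graphSet (n : ℕ) (h : ℝ) (b : Fin n → Fin n → (Fin n → ℝ) → ℝ)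
    (c : Fin n → (Fin n → ℝ) → ℝ) (p0 : (Fin n → ℝ) → ℝ) :
    Set (Lp ℂ 2 (volume : Measure (Fin n → ℝ)) × Lp ℂ 2 (volume : Measure (Fin n → ℝ))) :=
  {q | ∃ u : SchwartzMap (Fin n → ℝ) ℂ,
      (⇑q.1 =ᵐ[volume] ⇑u) ∧ (⇑q.2 =ᵐ[volume] Pop n h b c p0 ⇑u)}

section

open scoped LineDeriv ContDiff

/-! ### Multiplication and differentiation on Schwartz functions -/

/-- Complex-valued Schwartz functions on `ℝⁿ`. -/
abbrev Sch (n : ℕ) := SchwartzMap (Fin n → ℝ) ℂ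

/-- The Hilbert space `L²(ℝⁿ)`. -/
abbrev L2Space (n : ℕ) := Lp ℂ 2 (volume : Measure (Fin n → ℝ))

/-- Partial derivative of a real-valued function. -/
def pdR {n : ℕ} (j : Fin n) (a : (Fin n → ℝ) → ℝ) (x : Fin n → ℝ) : ℝ :=
  fderiv ℝ a x (Pi.single j 1)

/-- Multiplication of Schwartz functions by a real function of temperate growth. -/
def mulS {n : ℕ} (a : (Fin n → ℝ) → ℝ) : Sch n →L[ℂ] Sch n :=
  SchwartzMap.smulLeftCLM ℂ (fun x => (a x : ℂ))

/-- The partial derivative `∂_j` on Schwartz functions. -/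
def dS {n : ℕ} (j : Fin n) : Sch n →L[ℂ] Sch n :=
  LineDeriv.lineDerivOpCLM ℂ (Sch n) (Pi.single j 1 : Fin n → ℝ)

/-- Multiplication by the coordinate `x_j` on Schwartz functions. -/
def xS {n : ℕ} (j : Fin n) : Sch n →L[ℂ] Sch n := mulS (fun x => x j)

variable {n : ℕ}

lemma mulS_apply {a : (Fin n → ℝ) → ℝ} (ha : a.HasTemperateGrowth) (u : Sch n)
    (x : Fin n → ℝ) : mulS a u x = (a x : ℂ) * u x := by
  have : Function.HasTemperateGrowth (fun x => (a x : ℂ)) :=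
    Function.Complex.hasTemperateGrowth_ofReal.comp ha
  simp [mulS, SchwartzMap.smulLeftCLM_apply_apply this]

lemma dS_apply (j : Fin n) (u : Sch n) (x : Fin n → ℝ) : dS j u x = pd j u x :=
  SchwartzMap.lineDerivOp_apply_eq_fderiv (Pi.single j 1 : Fin n → ℝ) u x

lemma coord_hasTemperateGrowth (j : Fin n) :
    Function.HasTemperateGrowth (fun x : Fin n → ℝ => x j) :=
  (ContinuousLinearMap.proj (R := ℝ) (φ := fun _ : Fin n => ℝ) j).hasTemperateGrowth

lemma xS_apply (j : Fin n) (u : Sch n) (x : Fin n → ℝ) : xS j u x = (x j : ℂ) * u x :=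
  mulS_apply (coord_hasTemperateGrowth j) u x

lemma pdR_coord (i j : Fin n) :
    pdR i (fun x : Fin n → ℝ => x j) = fun _ => if i = j then 1 else 0 := by
  funext x
  have : HasFDerivAt (fun x : Fin n → ℝ => x j)
      (ContinuousLinearMap.proj (R := ℝ) (φ := fun _ : Fin n => ℝ) j) x :=
    (ContinuousLinearMap.proj (R := ℝ) (φ := fun _ : Fin n => ℝ) j).hasFDerivAt
  simp only [pdR, this.fderiv, ContinuousLinearMap.proj_apply, Pi.single_apply, eq_comm]

lemma pdR_hasTemperateGrowth {a : (Fin n → ℝ) → ℝ} (ha : a.HasTemperateGrowth) (j : Fin n) :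
    (pdR j a).HasTemperateGrowth := by
  have h1 : (fderiv ℝ a).HasTemperateGrowth := by
    refine ⟨ha.1.fderiv_right (by simp), fun m => ?_⟩
    obtain ⟨k, C, hC⟩ := ha.2 (m + 1)
    exact ⟨k, C, fun x => by rw [norm_iteratedFDeriv_fderiv]; exact hC x⟩
  exact (ContinuousLinearMap.apply ℝ ℝ
    (Pi.single j 1 : Fin n → ℝ)).hasTemperateGrowth.comp h1

/-- The Leibniz rule. -/
lemma dS_mulS {a : (Fin n → ℝ) → ℝ} (ha : a.HasTemperateGrowth) (j : Fin n) (u : Sch n) :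
    dS j (mulS a u) = mulS (pdR j a) u + mulS a (dS j u) := by
  ext x
  have h1 : HasFDerivAt (fun y => (a y : ℂ) * u y) _ x :=
    ((Complex.ofRealCLM.hasFDerivAt.comp x
      (ha.1.differentiable (by simp)).differentiableAt.hasFDerivAt)).mul (u.hasFDerivAt x)
  have h2 : (mulS a u : (Fin n → ℝ) → ℂ) = fun y => (a y : ℂ) * u y :=
    funext fun y => mulS_apply ha u y
  rw [_root_.add_apply, dS_apply, mulS_apply (pdR_hasTemperateGrowth ha j), mulS_apply ha,
    dS_apply, pd, h2, h1.fderiv]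
  simp [pd, pdR]
  ring

lemma mulS_comm {a b : (Fin n → ℝ) → ℝ} (ha : a.HasTemperateGrowth)
    (hb : b.HasTemperateGrowth) (u : Sch n) : mulS a (mulS b u) = mulS b (mulS a u) := by
  ext x
  simp only [mulS_apply ha, mulS_apply hb]
  ring

lemma dS_comm (i j : Fin n) (u : Sch n) : dS i (dS j u) = dS j (dS i u) := by
  ext x
  have hj (k : Fin n) : (dS k u : (Fin n → ℝ) → ℂ) = fun y => fderiv ℝ u y (Pi.single k 1) :=
    funext fun y => dS_apply k u y
  have hd : DifferentiableAt ℝ (fderiv ℝ u) x :=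
    (((u.smooth ⊤).fderiv_right (m := ∞) (by simp)).differentiable (by simp)).differentiableAt
  have key (k l : Fin n) :
      dS k (dS l u) x = fderiv ℝ (fderiv ℝ u) x (Pi.single k 1) (Pi.single l 1) := by
    rw [dS_apply, pd, hj, fderiv_clm_apply hd (by fun_prop)]
    simp
  rw [key, key]
  have h2 : minSmoothness ℝ 2 ≤ ((⊤ : ℕ∞) : WithTop ℕ∞) := by
    simp only [minSmoothness_of_isRCLikeNormedField]
    exact WithTop.coe_le_coe.2 le_top
  exact ((u.smooth ⊤).contDiffAt.isSymmSndFDerivAt h2) _ _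

lemma dS_xS (i j : Fin n) (u : Sch n) :
    dS i (xS j u) = (if i = j then u else 0) + xS j (dS i u) := by
  rw [xS, dS_mulS (coord_hasTemperateGrowth j), pdR_coord]
  congr 1
  ext x
  rw [mulS_apply (by fun_prop)]
  split_ifs <;> simp

/-! ### The real inner product -/

/-- The embedding of Schwartz functions in `L²`. -/
def emb : Sch n →L[ℂ] L2Space n := SchwartzMap.toLpCLM ℂ ℂ 2 volume

lemma emb_coe (u : Sch n) : ⇑(emb u) =ᵐ[volume] ⇑u := u.coeFn_toLp 2 volume

lemma emb_dense : DenseRange (emb : Sch n → L2Space n) :=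
  SchwartzMap.denseRange_toLpCLM (F := ℂ) (μ := (volume : Measure (Fin n → ℝ)))
    (p := 2) (by simp)

/-- The `L²` norm of a Schwartz function. -/
def nrm (u : Sch n) : ℝ := ‖emb u‖

lemma integrable_inner (u v : Sch n) : Integrable (fun x => inner ℝ (u x) (v x)) :=
  (SchwartzMap.bilinLeftCLM (innerSL ℝ) v.hasTemperateGrowth u).integrable

/-- The real part of the `L²` inner product of Schwartz functions. -/
def rip : Sch n →ₗ[ℝ] Sch n →ₗ[ℝ] ℝ :=
  LinearMap.mk₂ ℝ (fun u v => ∫ x, inner ℝ (u x) (v x))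
    (fun u u' v => by
      rw [← integral_add (integrable_inner _ _) (integrable_inner _ _)]
      simp only [_root_.add_apply, inner_add_left])
    (fun r u v => by
      rw [smul_eq_mul, ← integral_const_mul]
      simp only [_root_.smul_apply, real_inner_smul_left])
    (fun u v v' => by
      rw [← integral_add (integrable_inner _ _) (integrable_inner _ _)]
      simp only [_root_.add_apply, inner_add_right])
    (fun r u v => by
      rw [smul_eq_mul, ← integral_const_mul]
      simp only [_root_.smul_apply, real_inner_smul_right])

lemma rip_eq_integral (u v : Sch n) : rip u v = ∫ x, inner ℝ (u x) (v x) := rfl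

lemma rip_eq_re (u v : Sch n) : rip u v = (inner ℂ (emb u) (emb v)).re := by
  have h1 : inner ℂ (emb u) (emb v) = ∫ x, inner ℂ (u x) (v x) :=
    SchwartzMap.inner_toL2_toL2_eq u v volume
  have h2 : Integrable (fun x => inner ℂ (u x) (v x)) :=
    (L2.integrable_inner (𝕜 := ℂ) (emb u) (emb v)).congr <| by
      filter_upwards [emb_coe u, emb_coe v] with x hu hv
      rw [hu, hv]
  rw [h1, rip_eq_integral]
  exact integral_re h2

lemma rip_self (u : Sch n) : rip u u = nrm u ^ 2 := by
  rw [rip_eq_re, nrm]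
  exact inner_self_eq_norm_sq (𝕜 := ℂ) (emb u)

lemma rip_comm (u v : Sch n) : rip u v = rip v u := by
  rw [rip_eq_integral, rip_eq_integral]
  simp only [real_inner_comm]

lemma nrm_nonneg (u : Sch n) : 0 ≤ nrm u := norm_nonneg _

lemma nrm_add_le (u v : Sch n) : nrm (u + v) ≤ nrm u + nrm v := by
  rw [nrm, map_add]
  exact norm_add_le _ _

lemma nrm_smul (r : ℝ) (u : Sch n) : nrm (r • u) = |r| * nrm u := by
  rw [← Real.norm_eq_abs]
  exact norm_smul r (emb u)

lemma abs_rip_le (u v : Sch n) : |rip u v| ≤ nrm u * nrm v := by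
  rw [rip_eq_re]
  exact (Complex.abs_re_le_norm _).trans (norm_inner_le_norm _ _)

/-- Integration by parts. -/
lemma rip_dS (j : Fin n) (u v : Sch n) : rip (dS j u) v = - rip u (dS j v) := by
  have := SchwartzMap.integral_bilinear_lineDerivOp_right_eq_neg_left
    (μ := (volume : Measure (Fin n → ℝ))) u v (innerSL ℝ) (Pi.single j 1)
  rw [rip_eq_integral, rip_eq_integral]
  exact (neg_eq_iff_eq_neg.2 this).symm

lemma rip_mulS {a : (Fin n → ℝ) → ℝ} (ha : a.HasTemperateGrowth) (u v : Sch n) :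
    rip (mulS a u) v = rip u (mulS a v) := by
  rw [rip_eq_integral, rip_eq_integral]
  congr 1
  ext x
  rw [mulS_apply ha, mulS_apply ha, Complex.inner, Complex.inner]
  simp
  ring

lemma rip_xS (j : Fin n) (u v : Sch n) : rip (xS j u) v = rip u (xS j v) :=
  rip_mulS (coord_hasTemperateGrowth j) u v

lemma nrm_sq_le {ι : Type*} (s : Finset ι) (C : ℝ) (w : Sch n) (v : ι → Sch n)
    (h : ∀ x, ‖w x‖ ^ 2 ≤ C * ∑ i ∈ s, ‖v i x‖ ^ 2) :
    nrm w ^ 2 ≤ C * ∑ i ∈ s, nrm (v i) ^ 2 := by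
  simp only [← rip_self, rip_eq_integral]
  rw [← integral_finsetSum _ fun i _ => integrable_inner _ _, ← integral_const_mul]
  refine integral_mono (integrable_inner _ _)
    ((integrable_finsetSum _ fun i _ => integrable_inner _ _).const_mul _) fun x => ?_
  simpa using h x

lemma nrm_le (C : ℝ) (hC : 0 ≤ C) (w v : Sch n) (h : ∀ x, ‖w x‖ ≤ C * ‖v x‖) :
    nrm w ≤ C * nrm v := by
  have := nrm_sq_le {()} (C ^ 2) w (fun _ => v) fun x => by
    simpa [mul_pow] using pow_le_pow_left₀ (norm_nonneg _) (h x) 2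
  rw [← abs_of_nonneg (nrm_nonneg w), ← abs_of_nonneg (mul_nonneg hC (nrm_nonneg v))]
  exact sq_le_sq.1 (by simpa [mul_pow] using this)

lemma nrm_mulS_le {a : (Fin n → ℝ) → ℝ} (ha : a.HasTemperateGrowth) {C : ℝ}
    (hC : ∀ x, |a x| ≤ C) (u : Sch n) : nrm (mulS a u) ≤ C * nrm u := by
  refine nrm_le C ((abs_nonneg _).trans (hC 0)) _ _ fun x => ?_
  rw [mulS_apply ha, norm_mul]
  exact mul_le_mul_of_nonneg_right (by simpa using hC x) (norm_nonneg _)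

/-! ### The operator on Schwartz functions -/

/-- Second-order part `∑ ∂_i b_{ij} ∂_j`. -/
def secondPart (b : Fin n → Fin n → (Fin n → ℝ) → ℝ) (u : Sch n) : Sch n :=
  ∑ i, ∑ j, dS i (mulS (b i j) (dS j u))

/-- Symmetrized first-order part `∑ (c_j ∂_j + ∂_j c_j)`. -/
def firstPart (c : Fin n → (Fin n → ℝ) → ℝ) (u : Sch n) : Sch n :=
  ∑ j, (mulS (c j) (dS j u) + dS j (mulS (c j) u))

/-- The operator `P` as a map of the Schwartz space. -/
def opS (h : ℝ) (b : Fin n → Fin n → (Fin n → ℝ) → ℝ) (c : Fin n → (Fin n → ℝ) → ℝ)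
    (p0 : (Fin n → ℝ) → ℝ) (u : Sch n) : Sch n :=
  -(h ^ 2 • secondPart b u) + (h / 2) • firstPart c u + mulS p0 u

/-- The harmonic oscillator `1 + ∑ (x_j² - ∂_j²)`. -/
def harm (u : Sch n) : Sch n :=
  u + ∑ i, xS i (xS i u) - ∑ i, dS i (dS i u)

/-- The quadratic form of the harmonic oscillator. -/
def harmForm (u : Sch n) : ℝ :=
  nrm u ^ 2 + ∑ i, nrm (xS i u) ^ 2 + ∑ i, nrm (dS i u) ^ 2

/-- The first-order norm attached to the harmonic oscillator. -/
def firstNorm (u : Sch n) : ℝ :=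
  nrm u + ∑ i, nrm (xS i u) + ∑ i, nrm (dS i u)

lemma clm_map_smul_real (T : Sch n →L[ℂ] Sch n) (r : ℝ) (u : Sch n) :
    T (r • u) = r • T u := T.map_smul_of_tower r u

lemma opS_add (h : ℝ) (b : Fin n → Fin n → (Fin n → ℝ) → ℝ) (c : Fin n → (Fin n → ℝ) → ℝ)
    (p0 : (Fin n → ℝ) → ℝ) (u v : Sch n) :
    opS h b c p0 (u + v) = opS h b c p0 u + opS h b c p0 v := by
  simp only [opS, secondPart, firstPart, map_add, Finset.sum_add_distrib, smul_add]
  abel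

lemma opS_smul (h : ℝ) (b : Fin n → Fin n → (Fin n → ℝ) → ℝ) (c : Fin n → (Fin n → ℝ) → ℝ)
    (p0 : (Fin n → ℝ) → ℝ) (z : ℂ) (u : Sch n) :
    opS h b c p0 (z • u) = z • opS h b c p0 u := by
  simp only [opS, secondPart, firstPart, map_smul, ← Finset.smul_sum, ← smul_add]
  rw [smul_comm (h ^ 2) z, smul_comm (h / 2) z, ← smul_neg, ← smul_add, ← smul_add]

/-- On Schwartz functions the map `opS` is the differential operator `Pop`. -/
lemma opS_coe (h : ℝ) {b : Fin n → Fin n → (Fin n → ℝ) → ℝ} {c : Fin n → (Fin n → ℝ) → ℝ}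
    {p0 : (Fin n → ℝ) → ℝ} (hb : ∀ i j, (b i j).HasTemperateGrowth)
    (hc : ∀ j, (c j).HasTemperateGrowth) (hp : p0.HasTemperateGrowth) (u : Sch n) :
    ⇑(opS h b c p0 u) = Pop n h b c p0 u := by
  funext x
  have h1 (i j : Fin n) : hD h i (fun y => (b i j y : ℂ) * hD h j u y) x =
      -((h : ℂ) ^ 2 * dS i (mulS (b i j) (dS j u)) x) := by
    have : (fun y => (b i j y : ℂ) * hD h j u y) =
        ⇑(((h : ℂ) / Complex.I) • mulS (b i j) (dS j u)) := by
      funext y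
      simp only [_root_.smul_apply, mulS_apply (hb i j), dS_apply, hD, smul_eq_mul]
      ring
    rw [this, hD, ← dS_apply, map_smul, _root_.smul_apply, smul_eq_mul, ← mul_assoc]
    have hI : (h : ℂ) / Complex.I * (h / Complex.I) = -(h : ℂ) ^ 2 := by
      rw [div_mul_div_comm, Complex.I_mul_I]
      ring
    rw [hI]
    ring
  have h2 (j : Fin n) : pd j (fun y => (c j y : ℂ) * u y) x = dS j (mulS (c j) u) x := by
    rw [dS_apply]
    congr 1
    funext y
    rw [mulS_apply (hc j)]
  simp only [Pop, h1, h2, ← dS_apply]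
  simp only [opS, secondPart, firstPart, _root_.add_apply, _root_.neg_apply, _root_.smul_apply,
    _root_.sum_apply, mulS_apply hp, Complex.real_smul, mulS_apply (hc _), Finset.mul_sum]
  simp only [Finset.sum_neg_distrib]
  push_cast
  congr 2
  refine Finset.sum_congr rfl fun j _ => ?_
  ring

lemma rip_harm (u v : Sch n) :
    rip v (harm u) = rip v u + ∑ i, rip (xS i v) (xS i u) + ∑ i, rip (dS i v) (dS i u) := by
  simp only [harm, map_add, map_sub, map_sum, rip_xS, rip_dS, Finset.sum_neg_distrib]
  ring

lemma rip_harm_self (u : Sch n) : rip u (harm u) = harmForm u := by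
  simp only [rip_harm, rip_self, harmForm]

lemma harmForm_nonneg (u : Sch n) : 0 ≤ harmForm u := by
  unfold harmForm; positivity

lemma nrm_sq_le_harmForm (u : Sch n) : nrm u ^ 2 ≤ harmForm u := by
  have : 0 ≤ ∑ i, nrm (xS i u) ^ 2 + ∑ i, nrm (dS i u) ^ 2 := by positivity
  unfold harmForm; linarith

lemma nrm_xS_sq_le_harmForm (i : Fin n) (u : Sch n) : nrm (xS i u) ^ 2 ≤ harmForm u := by
  have h1 := Finset.single_le_sum (f := fun i => nrm (xS i u) ^ 2) (fun i _ => sq_nonneg _)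
    (Finset.mem_univ i)
  have h2 : 0 ≤ ∑ i, nrm (dS i u) ^ 2 := by positivity
  have := sq_nonneg (nrm u)
  unfold harmForm; linarith

lemma nrm_dS_sq_le_harmForm (i : Fin n) (u : Sch n) : nrm (dS i u) ^ 2 ≤ harmForm u := by
  have h1 := Finset.single_le_sum (f := fun i => nrm (dS i u) ^ 2) (fun i _ => sq_nonneg _)
    (Finset.mem_univ i)
  have h2 : 0 ≤ ∑ i, nrm (xS i u) ^ 2 := by positivity
  have := sq_nonneg (nrm u)
  unfold harmForm; linarith

lemma firstNorm_nonneg (u : Sch n) : 0 ≤ firstNorm u := by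
  have := nrm_nonneg (n := n)
  exact add_nonneg (add_nonneg (this _) (Finset.sum_nonneg fun _ _ => this _))
    (Finset.sum_nonneg fun _ _ => this _)

lemma firstNorm_sq_le (u : Sch n) : firstNorm u ^ 2 ≤ (2 * n + 1) ^ 2 * harmForm u := by
  have key {w : Sch n} (hw : nrm w ^ 2 ≤ harmForm u) : nrm w ≤ √(harmForm u) :=
    Real.le_sqrt_of_sq_le hw
  have h1 : firstNorm u ≤ (2 * n + 1) * √(harmForm u) := by
    have hx := Finset.sum_le_card_nsmul Finset.univ (fun i => nrm (xS i u)) _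
      fun i _ => key (nrm_xS_sq_le_harmForm i u)
    have hd := Finset.sum_le_card_nsmul Finset.univ (fun i => nrm (dS i u)) _
      fun i _ => key (nrm_dS_sq_le_harmForm i u)
    simp only [Finset.card_univ, Fintype.card_fin, nsmul_eq_mul] at hx hd
    have := key (nrm_sq_le_harmForm u)
    unfold firstNorm
    linarith
  calc firstNorm u ^ 2 ≤ ((2 * n + 1) * √(harmForm u)) ^ 2 :=
        pow_le_pow_left₀ (firstNorm_nonneg u) h1 2
    _ = _ := by rw [mul_pow, Real.sq_sqrt (harmForm_nonneg u)]

/-! ### Domination of operators -/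

/-- `T` is bounded relative to the functional `N`. -/
def DomBy (N : Sch n → ℝ) (T : Sch n → Sch n) : Prop :=
  ∃ C : ℝ, 0 ≤ C ∧ ∀ u, nrm (T u) ≤ C * N u

namespace DomBy

variable {N : Sch n → ℝ} {S T : Sch n → Sch n}

lemma add (hS : DomBy N S) (hT : DomBy N T) : DomBy N (fun u => S u + T u) := by
  obtain ⟨C, hC, h1⟩ := hS
  obtain ⟨D, hD, h2⟩ := hT
  refine ⟨C + D, add_nonneg hC hD, fun u => (nrm_add_le _ _).trans ?_⟩
  have := h1 u
  have := h2 u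
  linarith

lemma smul (r : ℝ) (hT : DomBy N T) : DomBy N (fun u => r • T u) := by
  obtain ⟨D, hD, h2⟩ := hT
  refine ⟨|r| * D, by positivity, fun u => ?_⟩
  rw [nrm_smul, mul_assoc]
  exact mul_le_mul_of_nonneg_left (h2 u) (abs_nonneg r)

lemma neg (hT : DomBy N T) : DomBy N (fun u => -T u) := by
  simpa using hT.smul (-1)

lemma sum {ι : Type*} (s : Finset ι) {F : ι → Sch n → Sch n}
    (hF : ∀ i ∈ s, DomBy N (F i)) : DomBy N (fun u => ∑ i ∈ s, F i u) := by
  classical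
  induction s using Finset.induction_on with
  | empty => exact ⟨0, le_rfl, fun u => by simp [nrm]⟩
  | insert a s ha ih =>
    simp only [Finset.sum_insert ha]
    exact (hF a (by simp)).add (ih fun i hi => hF i (by simp [hi]))

lemma mulS {a : (Fin n → ℝ) → ℝ} (ha : a.HasTemperateGrowth) {C : ℝ}
    (hC : ∀ x, |a x| ≤ C) (hT : DomBy N T) : DomBy N (fun u => mulS a (T u)) := by
  obtain ⟨D, hD, h2⟩ := hT
  have hC0 : 0 ≤ C := (abs_nonneg _).trans (hC 0)
  refine ⟨C * D, by positivity, fun u => (nrm_mulS_le ha hC _).trans ?_⟩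
  rw [mul_assoc]
  exact mul_le_mul_of_nonneg_left (h2 u) hC0

/-- The pairing of two dominated operators is bounded by the square. -/
lemma rip_le (hN : ∀ u, 0 ≤ N u) (hS : DomBy N S) (hT : DomBy N T) :
    ∃ C : ℝ, 0 ≤ C ∧ ∀ u, |rip (S u) (T u)| ≤ C * N u ^ 2 := by
  obtain ⟨C, hC, h1⟩ := hS
  obtain ⟨D, hD, h2⟩ := hT
  refine ⟨C * D, by positivity, fun u => (abs_rip_le _ _).trans ?_⟩
  calc nrm (S u) * nrm (T u) ≤ (C * N u) * (D * N u) :=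
        mul_le_mul (h1 u) (h2 u) (nrm_nonneg _) (mul_nonneg hC (hN u))
    _ = _ := by ring

end DomBy

lemma domBy_first_id : DomBy (n := n) firstNorm (fun u => u) := by
  refine ⟨1, zero_le_one, fun u => ?_⟩
  have := nrm_nonneg (n := n)
  have h1 : 0 ≤ ∑ i, nrm (xS i u) := Finset.sum_nonneg fun _ _ => this _
  have h2 : 0 ≤ ∑ i, nrm (dS i u) := Finset.sum_nonneg fun _ _ => this _
  unfold firstNorm; linarith

lemma domBy_first_xS (i : Fin n) : DomBy firstNorm (fun u => xS i u) := by
  refine ⟨1, zero_le_one, fun u => ?_⟩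
  have := nrm_nonneg (n := n)
  have h1 := Finset.single_le_sum (f := fun i => nrm (xS i u)) (fun i _ => this _)
    (Finset.mem_univ i)
  have h2 : 0 ≤ ∑ i, nrm (dS i u) := Finset.sum_nonneg fun _ _ => this _
  have := this u
  unfold firstNorm; linarith

lemma domBy_first_dS (i : Fin n) : DomBy firstNorm (fun u => dS i u) := by
  refine ⟨1, zero_le_one, fun u => ?_⟩
  have := nrm_nonneg (n := n)
  have h1 := Finset.single_le_sum (f := fun i => nrm (dS i u)) (fun i _ => this _)
    (Finset.mem_univ i)
  have h2 : 0 ≤ ∑ i, nrm (xS i u) := Finset.sum_nonneg fun _ _ => this _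
  have := this u
  unfold firstNorm; linarith

lemma nrm_mulS_linear_growth {a : (Fin n → ℝ) → ℝ} (ha : a.HasTemperateGrowth) {C : ℝ}
    (hC0 : 0 ≤ C) (hC : ∀ x, a x ^ 2 ≤ C * (1 + ∑ i, x i ^ 2)) (u : Sch n) :
    nrm (mulS a u) ≤ √C * (nrm u + ∑ i, nrm (xS i u)) := by
  have hn := nrm_nonneg (n := n)
  have h0 : 0 ≤ ∑ i, nrm (xS i u) := Finset.sum_nonneg fun _ _ => hn _
  have h1 := nrm_sq_le (Finset.univ : Finset (Option (Fin n))) C (mulS a u)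
    (fun o => o.elim u (fun i => xS i u)) fun x => by
      simp only [Fintype.sum_option, Option.elim, xS_apply, mulS_apply ha, norm_mul, mul_pow,
        Complex.norm_real, Real.norm_eq_abs, sq_abs, ← Finset.sum_mul]
      calc a x ^ 2 * ‖u x‖ ^ 2 ≤ (C * (1 + ∑ i, x i ^ 2)) * ‖u x‖ ^ 2 :=
            mul_le_mul_of_nonneg_right (hC x) (sq_nonneg _)
        _ = _ := by ring
  simp only [Fintype.sum_option, Option.elim] at h1
  have h2 : ∑ i, nrm (xS i u) ^ 2 ≤ (∑ i, nrm (xS i u)) ^ 2 :=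
    Finset.sum_sq_le_sq_sum_of_nonneg fun i _ => hn _
  have hu := hn u
  generalize ∑ i, nrm (xS i u) = s at h0 h2 ⊢
  have h3 : nrm (mulS a u) ^ 2 ≤ (√C * (nrm u + s)) ^ 2 := by
    rw [mul_pow, Real.sq_sqrt hC0]
    refine h1.trans (mul_le_mul_of_nonneg_left ?_ hC0)
    nlinarith
  exact le_of_sq_le_sq h3 (by positivity)

lemma domBy_first_mulS {a : (Fin n → ℝ) → ℝ} (ha : a.HasTemperateGrowth) {C : ℝ}
    (hC0 : 0 ≤ C) (hC : ∀ x, a x ^ 2 ≤ C * (1 + ∑ i, x i ^ 2)) :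
    DomBy firstNorm (fun u => mulS a u) := by
  refine ⟨√C, Real.sqrt_nonneg _, fun u => (nrm_mulS_linear_growth ha hC0 hC u).trans ?_⟩
  refine mul_le_mul_of_nonneg_left ?_ (Real.sqrt_nonneg _)
  have h2 : 0 ≤ ∑ i, nrm (dS i u) := Finset.sum_nonneg fun _ _ => nrm_nonneg _
  unfold firstNorm; linarith

/-! ### Energy estimates -/

/-- Growth, symmetry and positivity properties of the coefficients used in the estimates. -/
structure Admissible (b : Fin n → Fin n → (Fin n → ℝ) → ℝ) (c : Fin n → (Fin n → ℝ) → ℝ)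
    (p0 : (Fin n → ℝ) → ℝ) : Prop where
  b_growth : ∀ i j, (b i j).HasTemperateGrowth
  c_growth : ∀ j, (c j).HasTemperateGrowth
  p0_growth : p0.HasTemperateGrowth
  b_symm : ∀ i j, b i j = b j i
  b_bdd : ∀ i j, ∃ C : ℝ, ∀ x, |b i j x| ≤ C
  pd_b_bdd : ∀ l i j, ∃ C : ℝ, ∀ x, |pdR l (b i j) x| ≤ C
  pd_pd_b_bdd : ∀ k l i j, ∃ C : ℝ, ∀ x, |pdR k (pdR l (b i j)) x| ≤ C
  c_linear : ∀ j, ∃ C : ℝ, 0 ≤ C ∧ ∀ x, c j x ^ 2 ≤ C * (1 + ∑ i, x i ^ 2)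
  pd_c_bdd : ∀ l j, ∃ C : ℝ, ∀ x, |pdR l (c j) x| ≤ C
  pd_pd_c_bdd : ∀ k l j, ∃ C : ℝ, ∀ x, |pdR k (pdR l (c j)) x| ≤ C
  p0_quadratic : ∃ C : ℝ, 0 ≤ C ∧ ∀ x, |p0 x| ≤ C * (1 + ∑ i, x i ^ 2)
  pd_p0_linear : ∀ l, ∃ C : ℝ, 0 ≤ C ∧ ∀ x, pdR l p0 x ^ 2 ≤ C * (1 + ∑ i, x i ^ 2)
  b_pos : ∀ (x ξ : Fin n → ℝ), 0 ≤ ∑ i, ∑ j, b i j x * ξ i * ξ j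
  p0_pos : ∀ x, 0 ≤ p0 x

lemma rip_secondPart (b : Fin n → Fin n → (Fin n → ℝ) → ℝ) (u v : Sch n) :
    rip (secondPart b u) v = -∑ i, ∑ j, rip (mulS (b i j) (dS j u)) (dS i v) := by
  simp only [secondPart, map_sum, LinearMap.sum_apply, rip_dS, Finset.sum_neg_distrib]

lemma rip_firstPart_self {c : Fin n → (Fin n → ℝ) → ℝ} (hc : ∀ j, (c j).HasTemperateGrowth)
    (u : Sch n) : rip (firstPart c u) u = 0 := by
  simp only [firstPart, map_sum, LinearMap.sum_apply, map_add, LinearMap.add_apply]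
  refine Finset.sum_eq_zero fun j _ => ?_
  rw [rip_dS, rip_mulS (hc j), rip_mulS (hc j), rip_comm (dS j u), rip_mulS (hc j)]
  ring

lemma rip_secondPart_self_nonpos {b : Fin n → Fin n → (Fin n → ℝ) → ℝ}
    (hb : ∀ i j, (b i j).HasTemperateGrowth)
    (hpos : ∀ (x ξ : Fin n → ℝ), 0 ≤ ∑ i, ∑ j, b i j x * ξ i * ξ j) (u : Sch n) :
    rip (secondPart b u) u ≤ 0 := by
  rw [rip_secondPart, neg_nonpos]
  simp only [rip_eq_integral]
  have hint (i j : Fin n) := integrable_inner (mulS (b i j) (dS j u)) (dS i u)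
  simp only [← integral_finsetSum _ fun j _ => hint _ j]
  rw [← integral_finsetSum _ fun i _ => integrable_finsetSum _ fun j _ => hint i j]
  refine integral_nonneg fun x => ?_
  have h1 := hpos x (fun i => (dS i u x).re)
  have h2 := hpos x (fun i => (dS i u x).im)
  have h3 := add_nonneg h1 h2
  simp only [← Finset.sum_add_distrib] at h3
  refine h3.trans_eq (Finset.sum_congr rfl fun i _ => Finset.sum_congr rfl fun j _ => ?_)
  rw [mulS_apply (hb i j), Complex.inner]
  simp
  ring

lemma rip_mulS_self_nonneg {a : (Fin n → ℝ) → ℝ} (ha : a.HasTemperateGrowth)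
    (hpos : ∀ x, 0 ≤ a x) (u : Sch n) : 0 ≤ rip (mulS a u) u := by
  rw [rip_eq_integral]
  refine integral_nonneg fun x => ?_
  rw [mulS_apply ha, Complex.inner]
  have : (u x * conj ((a x : ℂ) * u x)).re = a x * ((u x).re ^ 2 + (u x).im ^ 2) := by
    simp
    ring
  change (0 : ℝ) ≤ _
  rw [this]
  have := hpos x
  positivity

/-- `P` is accretive. -/
lemma rip_opS_self_nonneg (h : ℝ) {b : Fin n → Fin n → (Fin n → ℝ) → ℝ}
    {c : Fin n → (Fin n → ℝ) → ℝ} {p0 : (Fin n → ℝ) → ℝ} (H : Admissible b c p0) (u : Sch n) :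
    0 ≤ rip (opS h b c p0 u) u := by
  simp only [opS, map_add, map_neg, map_smul, LinearMap.add_apply, LinearMap.neg_apply,
    LinearMap.smul_apply, rip_firstPart_self H.c_growth, smul_eq_mul]
  have h1 := rip_secondPart_self_nonpos H.b_growth H.b_pos u
  have h2 := rip_mulS_self_nonneg H.p0_growth H.p0_pos u
  nlinarith [sq_nonneg h]

lemma dS_secondPart {b : Fin n → Fin n → (Fin n → ℝ) → ℝ}
    (hb : ∀ i j, (b i j).HasTemperateGrowth) (l : Fin n) (u : Sch n) :
    dS l (secondPart b u) = secondPart (fun i j => pdR l (b i j)) u + secondPart b (dS l u) := by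
  simp only [secondPart, map_sum, ← Finset.sum_add_distrib]
  refine Finset.sum_congr rfl fun i _ => Finset.sum_congr rfl fun j _ => ?_
  rw [dS_comm, dS_mulS (hb i j), map_add, dS_comm l j]

lemma dS_firstPart {c : Fin n → (Fin n → ℝ) → ℝ} (hc : ∀ j, (c j).HasTemperateGrowth)
    (l : Fin n) (u : Sch n) :
    dS l (firstPart c u) = firstPart (fun j => pdR l (c j)) u + firstPart c (dS l u) := by
  simp only [firstPart, map_sum, ← Finset.sum_add_distrib]
  refine Finset.sum_congr rfl fun j _ => ?_
  rw [map_add, dS_mulS (hc j) l (dS j u), dS_comm l j u, dS_comm l j (mulS (c j) u),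
    dS_mulS (hc j) l u, map_add]
  abel

lemma xS_dS (l i : Fin n) (u : Sch n) :
    xS l (dS i u) = dS i (xS l u) - (if i = l then u else 0) := by
  rw [dS_xS]; abel

lemma xS_secondPart {b : Fin n → Fin n → (Fin n → ℝ) → ℝ}
    (hb : ∀ i j, (b i j).HasTemperateGrowth) (l : Fin n) (u : Sch n) :
    xS l (secondPart b u) = secondPart b (xS l u) -
      (∑ i, dS i (mulS (b i l) u) + ∑ j, mulS (b l j) (dS j u)) := by
  have h1 (i j : Fin n) : xS l (dS i (mulS (b i j) (dS j u))) =
      dS i (mulS (b i j) (dS j (xS l u))) - (if j = l then dS i (mulS (b i j) u) else 0)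
        - (if i = l then mulS (b i j) (dS j u) else 0) := by
    rw [xS_dS, xS, mulS_comm (coord_hasTemperateGrowth l) (hb i j), ← xS, xS_dS, map_sub, map_sub]
    congr 2
    split_ifs <;> simp
  simp only [secondPart, map_sum, h1, Finset.sum_sub_distrib]
  simp only [Finset.sum_ite_eq', Finset.mem_univ, if_true]
  rw [Finset.sum_comm (f := fun i j => if i = l then mulS (b i j) (dS j u) else 0)]
  simp only [Finset.sum_ite_eq', Finset.mem_univ, if_true]
  abel

lemma xS_firstPart {c : Fin n → (Fin n → ℝ) → ℝ} (hc : ∀ j, (c j).HasTemperateGrowth)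
    (l : Fin n) (u : Sch n) :
    xS l (firstPart c u) = firstPart c (xS l u) - (2 : ℝ) • mulS (c l) u := by
  have h1 (j : Fin n) : xS l (mulS (c j) (dS j u) + dS j (mulS (c j) u)) =
      (mulS (c j) (dS j (xS l u)) + dS j (mulS (c j) (xS l u))) -
        (if j = l then (2 : ℝ) • mulS (c j) u else 0) := by
    have hcomm (w : Sch n) : xS l (mulS (c j) w) = mulS (c j) (xS l w) :=
      mulS_comm (coord_hasTemperateGrowth l) (hc j) w
    rw [map_add, hcomm, xS_dS, xS_dS, hcomm, map_sub]
    split_ifs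
    · rw [two_smul]; abel
    · simp
  simp only [firstPart, map_sum, h1, Finset.sum_sub_distrib]
  simp

section Energy

variable {b : Fin n → Fin n → (Fin n → ℝ) → ℝ} {c : Fin n → (Fin n → ℝ) → ℝ}
  {p0 : (Fin n → ℝ) → ℝ}

lemma domBy_dS_mulS {N : Sch n → ℝ} {T : Sch n → Sch n} {a : (Fin n → ℝ) → ℝ}
    (ha : a.HasTemperateGrowth) (i : Fin n) (h0 : DomBy N (fun u => mulS (pdR i a) (T u)))
    (h1 : DomBy N (fun u => mulS a (dS i (T u)))) :
    DomBy N (fun u => dS i (mulS a (T u))) := by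
  simp only [dS_mulS ha]
  exact h0.add h1

/-- The commutator of `P` with a coordinate is of first order. -/
lemma xS_opS (h : ℝ) (H : Admissible b c p0) (l : Fin n) :
    ∃ T : Sch n → Sch n, DomBy firstNorm T ∧
      ∀ u, xS l (opS h b c p0 u) = opS h b c p0 (xS l u) + T u := by
  refine ⟨fun u => h ^ 2 • (∑ i, dS i (mulS (b i l) u) + ∑ j, mulS (b l j) (dS j u)) +
    (-h) • mulS (c l) u, ?_, fun u => ?_⟩
  · refine DomBy.add (DomBy.smul _ (DomBy.add (DomBy.sum _ fun i _ => ?_)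
      (DomBy.sum _ fun j _ => ?_))) (DomBy.smul _ ?_)
    · obtain ⟨C, hC⟩ := H.b_bdd i l
      obtain ⟨D, hD⟩ := H.pd_b_bdd i i l
      exact domBy_dS_mulS (T := fun u => u) (H.b_growth i l) i
        (domBy_first_id.mulS (pdR_hasTemperateGrowth (H.b_growth i l) i) hD)
        ((domBy_first_dS i).mulS (H.b_growth i l) hC)
    · obtain ⟨C, hC⟩ := H.b_bdd l j
      exact (domBy_first_dS j).mulS (H.b_growth l j) hC
    · obtain ⟨C, hC0, hC⟩ := H.c_linear l
      exact domBy_first_mulS (H.c_growth l) hC0 hC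
  · have hcomm : xS l (mulS p0 u) = mulS p0 (xS l u) :=
      mulS_comm (coord_hasTemperateGrowth l) H.p0_growth u
    simp only [opS, map_add, map_neg, clm_map_smul_real, xS_secondPart H.b_growth,
      xS_firstPart H.c_growth, hcomm]
    module

lemma dS_opS (h : ℝ) (H : Admissible b c p0) (l : Fin n) (u : Sch n) :
    dS l (opS h b c p0 u) = opS h b c p0 (dS l u) +
      opS h (fun i j => pdR l (b i j)) (fun j => pdR l (c j)) (pdR l p0) u := by
  simp only [opS, map_add, map_neg, clm_map_smul_real, dS_secondPart H.b_growth,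
    dS_firstPart H.c_growth, dS_mulS H.p0_growth]
  module

/-- The gain from symmetry: the commutator of `∂_l` with the second-order part is harmless. -/
lemma rip_secondPart_pd (H : Admissible b c p0) (l : Fin n) (u : Sch n) :
    2 * rip (secondPart (fun i j => pdR l (b i j)) u) (dS l u) =
      ∑ i, ∑ j, rip (mulS (pdR l (pdR l (b i j))) (dS j u)) (dS i u) := by
  have hg (i j : Fin n) := pdR_hasTemperateGrowth (H.b_growth i j) l
  set Q := ∑ i, ∑ j, rip (mulS (pdR l (b i j)) (dS j u)) (dS l (dS i u)) with hQ
  have h1 : rip (secondPart (fun i j => pdR l (b i j)) u) (dS l u) = -Q := by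
    rw [rip_secondPart, hQ]
    simp only [dS_comm l]
  have h2 : Q = -(∑ i, ∑ j, rip (mulS (pdR l (pdR l (b i j))) (dS j u)) (dS i u)) -
      ∑ i, ∑ j, rip (mulS (pdR l (b i j)) (dS l (dS j u))) (dS i u) := by
    rw [hQ, ← Finset.sum_neg_distrib, ← Finset.sum_sub_distrib]
    refine Finset.sum_congr rfl fun i _ => ?_
    rw [← Finset.sum_neg_distrib, ← Finset.sum_sub_distrib]
    refine Finset.sum_congr rfl fun j _ => ?_
    have := rip_dS l (mulS (pdR l (b i j)) (dS j u)) (dS i u)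
    rw [dS_mulS (hg i j), map_add, LinearMap.add_apply] at this
    linarith
  have h3 : ∑ i, ∑ j, rip (mulS (pdR l (b i j)) (dS l (dS j u))) (dS i u) = Q := by
    rw [hQ, Finset.sum_comm]
    refine Finset.sum_congr rfl fun j _ => Finset.sum_congr rfl fun i _ => ?_
    rw [rip_mulS (hg i j), rip_comm, H.b_symm i j]
  rw [h1]
  linarith

lemma domBy_first_firstPart (H : Admissible b c p0) (l : Fin n) :
    DomBy firstNorm (fun u => firstPart (fun j => pdR l (c j)) u) := by
  refine DomBy.sum _ fun j _ => ?_
  have hg := pdR_hasTemperateGrowth (H.c_growth j) l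
  obtain ⟨C, hC⟩ := H.pd_c_bdd l j
  obtain ⟨D, hD⟩ := H.pd_pd_c_bdd j l j
  have h1 := (domBy_first_dS j).mulS hg hC
  exact h1.add (domBy_dS_mulS (T := fun u => u) hg j
    (domBy_first_id.mulS (pdR_hasTemperateGrowth hg j) hD) h1)

lemma exists_sum_bound {ι α : Type*} (s : Finset ι) {f : ι → α → ℝ} {g : α → ℝ}
    (h : ∀ i ∈ s, ∃ C : ℝ, 0 ≤ C ∧ ∀ a, |f i a| ≤ C * g a) :
    ∃ C : ℝ, 0 ≤ C ∧ ∀ a, |∑ i ∈ s, f i a| ≤ C * g a := by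
  choose! C hC0 hC using h
  refine ⟨∑ i ∈ s, C i, Finset.sum_nonneg hC0, fun a => ?_⟩
  rw [Finset.sum_mul]
  exact (Finset.abs_sum_le_sum_abs _ _).trans (Finset.sum_le_sum fun i hi => hC i hi a)

lemma rip_dS_opS (h : ℝ) (H : Admissible b c p0) (l : Fin n) :
    ∃ C : ℝ, 0 ≤ C ∧ ∀ u,
      -(C * firstNorm u ^ 2) ≤ rip (dS l (opS h b c p0 u)) (dS l u) := by
  have hb : ∃ C : ℝ, 0 ≤ C ∧ ∀ u, |∑ i, ∑ j, rip (mulS (pdR l (pdR l (b i j))) (dS j u))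
      (dS i u)| ≤ C * firstNorm u ^ 2 := by
    refine exists_sum_bound (g := fun u : Sch n => firstNorm u ^ 2) _ fun i _ =>
      exists_sum_bound (g := fun u : Sch n => firstNorm u ^ 2) _ fun j _ => ?_
    obtain ⟨D, hD⟩ := H.pd_pd_b_bdd l l i j
    exact DomBy.rip_le firstNorm_nonneg ((domBy_first_dS j).mulS
      (pdR_hasTemperateGrowth (pdR_hasTemperateGrowth (H.b_growth i j) l) l) hD)
      (domBy_first_dS i)
  obtain ⟨C₁, hC₁, h1⟩ := hb
  obtain ⟨C₂, hC₂, h2⟩ := DomBy.rip_le firstNorm_nonneg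
    ((domBy_first_firstPart H l).smul (h / 2)) (domBy_first_dS l)
  obtain ⟨D, hD0, hD⟩ := H.pd_p0_linear l
  obtain ⟨C₃, hC₃, h3⟩ := DomBy.rip_le firstNorm_nonneg
    (domBy_first_mulS (pdR_hasTemperateGrowth H.p0_growth l) hD0 hD) (domBy_first_dS l)
  refine ⟨h ^ 2 / 2 * C₁ + C₂ + C₃, by positivity, fun u => ?_⟩
  have h4 := rip_secondPart_pd H l u
  have h5 := rip_opS_self_nonneg h H (dS l u)
  have e1 : rip (dS l (opS h b c p0 u)) (dS l u) = rip (opS h b c p0 (dS l u)) (dS l u) +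
      (-(h ^ 2 * rip (secondPart (fun i j => pdR l (b i j)) u) (dS l u)) +
        rip ((h / 2) • firstPart (fun j => pdR l (c j)) u) (dS l u) +
        rip (mulS (pdR l p0) u) (dS l u)) := by
    rw [dS_opS h H, map_add, LinearMap.add_apply]
    congr 1
    rw [opS, map_add, map_add, map_neg, map_smul, LinearMap.add_apply, LinearMap.add_apply,
      LinearMap.neg_apply, LinearMap.smul_apply, smul_eq_mul]
  have a1 := mul_le_mul_of_nonneg_left (le_of_abs_le (h1 u)) (sq_nonneg h)
  have a2 := neg_le_of_abs_le (h2 u)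
  have a3 := neg_le_of_abs_le (h3 u)
  rw [e1]
  rw [← h4] at a1
  linarith

lemma rip_xS_opS (h : ℝ) (H : Admissible b c p0) (l : Fin n) :
    ∃ C : ℝ, 0 ≤ C ∧ ∀ u,
      -(C * firstNorm u ^ 2) ≤ rip (xS l (opS h b c p0 u)) (xS l u) := by
  obtain ⟨T, hT, hcomm⟩ := xS_opS h H l
  obtain ⟨C, hC, h1⟩ := DomBy.rip_le firstNorm_nonneg hT (domBy_first_xS l)
  refine ⟨C, hC, fun u => ?_⟩
  rw [hcomm, map_add, LinearMap.add_apply]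
  have := rip_opS_self_nonneg h H (xS l u)
  have := neg_le_of_abs_le (h1 u)
  linarith

/-- `P` is bounded below relative to the harmonic oscillator. -/
lemma rip_opS_harm (h : ℝ) (H : Admissible b c p0) :
    ∃ C : ℝ, 0 ≤ C ∧ ∀ u, -(C * harmForm u) ≤ rip (opS h b c p0 u) (harm u) := by
  choose C hC0 hC using rip_xS_opS h H
  choose D hD0 hD using rip_dS_opS h H
  have hE : 0 ≤ ∑ i, C i + ∑ i, D i :=
    add_nonneg (Finset.sum_nonneg fun i _ => hC0 i) (Finset.sum_nonneg fun i _ => hD0 i)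
  refine ⟨(∑ i, C i + ∑ i, D i) * (2 * n + 1) ^ 2, by positivity, fun u => ?_⟩
  have h1 := mul_le_mul_of_nonneg_left (firstNorm_sq_le u) hE
  have h2 := Finset.sum_le_sum fun i (_ : i ∈ Finset.univ) => hC i u
  have h3 := Finset.sum_le_sum fun i (_ : i ∈ Finset.univ) => hD i u
  simp only [Finset.sum_neg_distrib, ← Finset.sum_mul] at h2 h3
  have h4 := rip_opS_self_nonneg h H u
  rw [rip_harm]
  linarith

/-! ### Relative boundedness -/

lemma harm_xS (i : Fin n) (u : Sch n) : harm (xS i u) = xS i (harm u) - (2 : ℝ) • dS i u := by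
  have hx (j : Fin n) (w : Sch n) : xS j (xS i w) = xS i (xS j w) :=
    mulS_comm (coord_hasTemperateGrowth j) (coord_hasTemperateGrowth i) w
  have h1 (j : Fin n) : dS j (dS j (xS i u)) =
      xS i (dS j (dS j u)) + (if j = i then (2 : ℝ) • dS j u else 0) := by
    rw [dS_xS, map_add, dS_xS]
    split_ifs
    · rw [two_smul]; abel
    · simp
  simp only [harm, map_add, map_sub, map_sum, hx, h1, Finset.sum_add_distrib,
    Finset.sum_ite_eq', Finset.mem_univ, if_true]
  abel

lemma harm_dS (i : Fin n) (u : Sch n) : harm (dS i u) = dS i (harm u) - (2 : ℝ) • xS i u := by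
  have h1 (j : Fin n) : dS i (xS j (xS j u)) =
      xS j (xS j (dS i u)) + (if i = j then (2 : ℝ) • xS j u else 0) := by
    rw [dS_xS, dS_xS, map_add]
    split_ifs
    · rw [two_smul]; abel
    · simp
  simp only [harm, map_add, map_sub, map_sum, dS_comm i, h1, Finset.sum_add_distrib,
    Finset.sum_ite_eq, Finset.mem_univ, if_true]
  abel

lemma nrm_le_nrm_harm (u : Sch n) : nrm u ≤ nrm (harm u) := by
  have h1 := nrm_sq_le_harmForm u
  rw [← rip_harm_self] at h1
  have h2 := le_of_abs_le (abs_rip_le u (harm u))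
  by_contra! h
  have := nrm_nonneg (harm u)
  nlinarith

lemma harmForm_le (u : Sch n) : harmForm u ≤ nrm (harm u) ^ 2 := by
  rw [← rip_harm_self]
  have h2 := le_of_abs_le (abs_rip_le u (harm u))
  have := nrm_le_nrm_harm u
  have := nrm_nonneg (harm u)
  nlinarith

lemma sum_harmForm_le (u : Sch n) :
    ∑ i, harmForm (xS i u) + ∑ i, harmForm (dS i u) ≤ 3 * nrm (harm u) ^ 2 := by
  have hx (i : Fin n) : harmForm (xS i u) ≤
      rip (xS i (harm u)) (xS i u) + (nrm (xS i u) ^ 2 + nrm (dS i u) ^ 2) := by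
    rw [rip_comm (xS i (harm u)), ← rip_harm_self, harm_xS, map_sub, map_smul, smul_eq_mul]
    have := neg_le_of_abs_le (abs_rip_le (xS i u) (dS i u))
    nlinarith [sq_nonneg (nrm (xS i u) - nrm (dS i u))]
  have hd (i : Fin n) : harmForm (dS i u) ≤
      rip (dS i (harm u)) (dS i u) + (nrm (xS i u) ^ 2 + nrm (dS i u) ^ 2) := by
    rw [rip_comm (dS i (harm u)), ← rip_harm_self, harm_dS, map_sub, map_smul, smul_eq_mul]
    have := neg_le_of_abs_le (abs_rip_le (dS i u) (xS i u))
    nlinarith [sq_nonneg (nrm (xS i u) - nrm (dS i u))]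
  have sx := Finset.sum_le_sum fun i (_ : i ∈ Finset.univ) => hx i
  have sd := Finset.sum_le_sum fun i (_ : i ∈ Finset.univ) => hd i
  simp only [Finset.sum_add_distrib] at sx sd
  have h1 := rip_harm u (harm u)
  rw [rip_self, rip_comm, rip_harm_self] at h1
  have h2 := harmForm_le u
  have h3 := harmForm_nonneg u
  have h4 := sq_nonneg (nrm u)
  unfold harmForm at h1 h2 h3 ⊢
  unfold harmForm at sx sd
  linarith

lemma domBy_harm_comp {T A : Sch n → Sch n} (hT : DomBy firstNorm T)
    (hA : ∀ u, harmForm (A u) ≤ 3 * nrm (harm u) ^ 2) :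
    DomBy (fun u => nrm (harm u)) (fun u => T (A u)) := by
  obtain ⟨C, hC, h1⟩ := hT
  refine ⟨C * ((2 * n + 1) * 2), by positivity, fun u => (h1 (A u)).trans ?_⟩
  rw [mul_assoc]
  refine mul_le_mul_of_nonneg_left ?_ hC
  have hn := nrm_nonneg (harm u)
  refine le_of_sq_le_sq ((firstNorm_sq_le _).trans ?_) (by positivity)
  rw [mul_pow, mul_pow, mul_assoc]
  refine mul_le_mul_of_nonneg_left ((hA u).trans ?_) (by positivity)
  have := sq_nonneg (nrm (harm u))
  linarith

lemma domBy_harm_xS {T : Sch n → Sch n} (hT : DomBy firstNorm T) (i : Fin n) :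
    DomBy (fun u => nrm (harm u)) (fun u => T (xS i u)) := by
  refine domBy_harm_comp hT fun u => le_trans ?_ (sum_harmForm_le u)
  have h1 := Finset.single_le_sum (f := fun i => harmForm (xS i u))
    (fun i _ => harmForm_nonneg _) (Finset.mem_univ i)
  have h2 : 0 ≤ ∑ i, harmForm (dS i u) := Finset.sum_nonneg fun _ _ => harmForm_nonneg _
  linarith

lemma domBy_harm_dS {T : Sch n → Sch n} (hT : DomBy firstNorm T) (i : Fin n) :
    DomBy (fun u => nrm (harm u)) (fun u => T (dS i u)) := by
  refine domBy_harm_comp hT fun u => le_trans ?_ (sum_harmForm_le u)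
  have h1 := Finset.single_le_sum (f := fun i => harmForm (dS i u))
    (fun i _ => harmForm_nonneg _) (Finset.mem_univ i)
  have h2 : 0 ≤ ∑ i, harmForm (xS i u) := Finset.sum_nonneg fun _ _ => harmForm_nonneg _
  linarith

lemma domBy_harm_id : DomBy (n := n) (fun u => nrm (harm u)) (fun u => u) :=
  ⟨1, zero_le_one, fun u => by simpa using nrm_le_nrm_harm u⟩

lemma domBy_harm_mulS {a : (Fin n → ℝ) → ℝ} (ha : a.HasTemperateGrowth) {C : ℝ}
    (hC0 : 0 ≤ C) (hC : ∀ x, |a x| ≤ C * (1 + ∑ i, x i ^ 2)) :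
    DomBy (fun u => nrm (harm u)) (fun u => mulS a u) := by
  have h1 : DomBy (n := n) (fun u => nrm (harm u)) (fun u => u + ∑ i, xS i (xS i u)) :=
    domBy_harm_id.add (DomBy.sum _ fun i _ => domBy_harm_xS (domBy_first_xS i) i)
  obtain ⟨D, hD, h2⟩ := h1
  refine ⟨C * D, by positivity, fun u => ?_⟩
  rw [mul_assoc]
  refine (nrm_le C hC0 _ (u + ∑ i, xS i (xS i u)) fun x => ?_).trans
    (mul_le_mul_of_nonneg_left (h2 u) hC0)
  have e : (u + ∑ i, xS i (xS i u)) x = ((1 + ∑ i, x i ^ 2 : ℝ) : ℂ) * u x := by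
    simp only [_root_.add_apply, _root_.sum_apply, xS_apply]
    push_cast
    rw [add_mul, Finset.sum_mul, one_mul]
    congr 1
    exact Finset.sum_congr rfl fun i _ => by ring
  rw [e, mulS_apply ha, norm_mul, norm_mul, ← mul_assoc, Complex.norm_real, Complex.norm_real,
    Real.norm_eq_abs, Real.norm_of_nonneg (by positivity)]
  exact mul_le_mul_of_nonneg_right (hC x) (norm_nonneg _)

/-- `P` is bounded relative to the harmonic oscillator. -/
lemma domBy_harm_opS (h : ℝ) (H : Admissible b c p0) :
    DomBy (fun u => nrm (harm u)) (fun u => opS h b c p0 u) := by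
  refine DomBy.add (DomBy.add (DomBy.neg (DomBy.smul _ (DomBy.sum _ fun i _ =>
    DomBy.sum _ fun j _ => ?_))) (DomBy.smul _ (DomBy.sum _ fun j _ => ?_))) ?_
  · obtain ⟨C, hC⟩ := H.b_bdd i j
    obtain ⟨D, hD⟩ := H.pd_b_bdd i i j
    have hg := H.b_growth i j
    exact domBy_dS_mulS (T := fun u => dS j u) hg i
      ((domBy_harm_dS domBy_first_id j).mulS (pdR_hasTemperateGrowth hg i) hD)
      ((domBy_harm_dS (domBy_first_dS i) j).mulS hg hC)
  · obtain ⟨C, hC0, hC⟩ := H.c_linear j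
    obtain ⟨D, hD⟩ := H.pd_c_bdd j j
    have hg := H.c_growth j
    have h1 := domBy_harm_dS (domBy_first_mulS hg hC0 hC) j
    exact h1.add (domBy_dS_mulS (T := fun u => u) hg j
      (domBy_harm_id.mulS (pdR_hasTemperateGrowth hg j) hD) h1)
  · obtain ⟨C, hC0, hC⟩ := H.p0_quadratic
    exact domBy_harm_mulS H.p0_growth hC0 hC

end Energy

/-! ### Modulated Gaussians -/

lemma norm_iteratedFDeriv_cexp (i : ℕ) (a : ℂ) :
    ‖iteratedFDeriv ℝ i Complex.exp a‖ =
      ‖Complex.exp a‖ * ‖iteratedFDeriv ℝ i Complex.exp 0‖ := by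
  have h1 := iteratedFDeriv_comp_add_right (𝕜 := ℝ) (f := Complex.exp) i a 0
  have h2 : (fun z => Complex.exp (z + a)) = Complex.exp a • Complex.exp := by
    funext z
    simp [Complex.exp_add, mul_comm]
  rw [h2, iteratedFDeriv_const_smul_apply (Complex.contDiff_exp (n := i)).contDiffAt,
    zero_add] at h1
  rw [← h1, norm_smul]

/-- The exponential of a function of temperate growth is a Schwartz function as soon as it
decays rapidly. -/
lemma exists_schwartz_cexp {φ : (Fin n → ℝ) → ℂ} (hφ : φ.HasTemperateGrowth)
    (hdecay : ∀ k : ℕ, ∃ C : ℝ, ∀ x, (1 + ‖x‖) ^ k * ‖Complex.exp (φ x)‖ ≤ C) :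
    ∃ G : Sch n, ∀ x, G x = Complex.exp (φ x) := by
  refine ⟨⟨fun x => Complex.exp (φ x), Complex.contDiff_exp.comp hφ.1, fun k m => ?_⟩,
    fun x => rfl⟩
  obtain ⟨l, C, hC0, hC⟩ := hφ.norm_iteratedFDeriv_le_uniform m
  obtain ⟨D, hD⟩ := hdecay (k + l * m)
  set M := ∑ i ∈ Finset.range (m + 1), ‖iteratedFDeriv ℝ i Complex.exp 0‖ with hM
  have hM0 : 0 ≤ M := Finset.sum_nonneg fun _ _ => norm_nonneg _
  refine ⟨m.factorial * M * (C + 1) ^ m * D, fun x => ?_⟩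
  have hx1 : 1 ≤ (1 + ‖x‖) ^ l := one_le_pow₀ (by linarith [norm_nonneg x])
  have key := norm_iteratedFDeriv_comp_le (𝕜 := ℝ) (g := Complex.exp) (f := φ) (n := m)
    (N := ∞) (C := ‖Complex.exp (φ x)‖ * M) (D := (C + 1) * (1 + ‖x‖) ^ l)
    Complex.contDiff_exp hφ.1 (mod_cast le_top) x (fun i hi => by
      rw [norm_iteratedFDeriv_cexp]
      gcongr
      exact Finset.single_le_sum (f := fun i => ‖iteratedFDeriv ℝ i Complex.exp 0‖)
        (fun _ _ => norm_nonneg _) (Finset.mem_range.2 (by omega)))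
    (fun i hi1 hi => by
      refine (hC i hi x).trans ?_
      have h1 : 1 ≤ (C + 1) * (1 + ‖x‖) ^ l := by nlinarith
      refine le_trans ?_ (le_self_pow₀ h1 (by omega))
      gcongr
      linarith)
  calc ‖x‖ ^ k * ‖iteratedFDeriv ℝ m (Complex.exp ∘ φ) x‖
      ≤ (1 + ‖x‖) ^ k * (m.factorial * (‖Complex.exp (φ x)‖ * M)
          * ((C + 1) * (1 + ‖x‖) ^ l) ^ m) := by
        gcongr
        linarith
    _ = m.factorial * M * (C + 1) ^ m * ((1 + ‖x‖) ^ (k + l * m) * ‖Complex.exp (φ x)‖) := by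
        rw [mul_pow, ← pow_mul, pow_add]; ring
    _ ≤ _ := by
        gcongr
        exact hD x

lemma sq_norm_le_sum_sq (x : Fin n → ℝ) : ‖x‖ ^ 2 ≤ ∑ i, x i ^ 2 := by
  have h0 : 0 ≤ ∑ i, x i ^ 2 := Finset.sum_nonneg fun _ _ => sq_nonneg _
  rw [← Real.sqrt_le_sqrt_iff h0, Real.sqrt_sq (norm_nonneg _)]
  refine (pi_norm_le_iff_of_nonneg (Real.sqrt_nonneg _)).2 fun i => ?_
  rw [Real.norm_eq_abs, ← Real.sqrt_sq_eq_abs]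
  exact Real.sqrt_le_sqrt (Finset.single_le_sum (f := fun i => x i ^ 2)
    (fun _ _ => sq_nonneg _) (Finset.mem_univ i))

/-- The exponent of a modulated Gaussian. -/
def gaussExponent (L : (Fin n → ℝ) →L[ℝ] ℝ) (x : Fin n → ℝ) : ℂ :=
  ((-(1 / 2) * ∑ i, x i ^ 2 : ℝ) : ℂ) + ((L x : ℝ) : ℂ) * I

lemma gaussExponent_hasTemperateGrowth (L : (Fin n → ℝ) →L[ℝ] ℝ) :
    (gaussExponent L).HasTemperateGrowth := by
  refine Function.HasTemperateGrowth.add (Function.Complex.hasTemperateGrowth_ofReal.comp ?_)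
    (Function.HasTemperateGrowth.mul
      (Function.Complex.hasTemperateGrowth_ofReal.comp L.hasTemperateGrowth)
      (Function.HasTemperateGrowth.const I))
  exact (Function.HasTemperateGrowth.const _).mul
    (Function.HasTemperateGrowth.sum fun i _ => (coord_hasTemperateGrowth i).pow 2)

lemma norm_exp_gaussExponent (L : (Fin n → ℝ) →L[ℝ] ℝ) (x : Fin n → ℝ) :
    ‖Complex.exp (gaussExponent L x)‖ = Real.exp (-(1 / 2) * ∑ i, x i ^ 2) := by
  rw [Complex.norm_exp, gaussExponent]
  congr 1
  rw [Complex.add_re, Complex.ofReal_re, Complex.re_ofReal_mul, Complex.I_re, mul_zero, add_zero]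

lemma exists_gauss (L : (Fin n → ℝ) →L[ℝ] ℝ) :
    ∃ G : Sch n, ∀ x, G x = Complex.exp (gaussExponent L x) := by
  refine exists_schwartz_cexp (gaussExponent_hasTemperateGrowth L) fun k =>
    ⟨k.factorial * Real.exp (3 / 2), fun x => ?_⟩
  have h0 := norm_nonneg x
  have h1 := Real.pow_div_factorial_le_exp (1 + ‖x‖) (by positivity) k
  rw [div_le_iff₀ (by positivity)] at h1
  have h2 := sq_norm_le_sum_sq x
  rw [norm_exp_gaussExponent]
  calc (1 + ‖x‖) ^ k * Real.exp (-(1 / 2) * ∑ i, x i ^ 2)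
      ≤ (Real.exp (1 + ‖x‖) * k.factorial) * Real.exp (-(1 / 2) * ∑ i, x i ^ 2) := by gcongr
    _ = k.factorial * Real.exp (1 + ‖x‖ + -(1 / 2) * ∑ i, x i ^ 2) := by
        rw [Real.exp_add (1 + ‖x‖)]; ring
    _ ≤ _ := by
        gcongr
        nlinarith [sq_nonneg (‖x‖ - 1)]

/-- The modulated Gaussian `exp (-|x|² / 2 + i L(x))`. -/
def gauss (L : (Fin n → ℝ) →L[ℝ] ℝ) : Sch n := (exists_gauss L).choose

lemma gauss_apply (L : (Fin n → ℝ) →L[ℝ] ℝ) (x : Fin n → ℝ) :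
    gauss L x = Complex.exp (gaussExponent L x) := (exists_gauss L).choose_spec x

lemma norm_gauss (L : (Fin n → ℝ) →L[ℝ] ℝ) (x : Fin n → ℝ) : ‖gauss L x‖ = ‖gauss 0 x‖ := by
  simp only [gauss_apply, norm_exp_gaussExponent]

lemma dS_gauss (L : (Fin n → ℝ) →L[ℝ] ℝ) (i : Fin n) :
    dS i (gauss L) = ((L (Pi.single i 1) : ℂ) * I) • gauss L - xS i (gauss L) := by
  ext x
  have h1 : HasFDerivAt (fun y : Fin n → ℝ => -(1 / 2) * ∑ i, y i ^ 2)
      (-(1 / 2 : ℝ) • ∑ j, (2 * x j) • ContinuousLinearMap.proj (R := ℝ)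
        (φ := fun _ : Fin n => ℝ) j) x := by
    refine HasFDerivAt.const_mul (HasFDerivAt.fun_sum fun j _ => ?_) _
    have := ((ContinuousLinearMap.proj (R := ℝ) (φ := fun _ : Fin n => ℝ) j).hasFDerivAt
      (x := x)).pow 2
    simpa using this
  have h2 : HasFDerivAt (gaussExponent L) _ x :=
    (Complex.ofRealCLM.hasFDerivAt.comp x h1).add
      ((Complex.ofRealCLM.hasFDerivAt.comp x L.hasFDerivAt).mul_const I)
  have h3 := h2.cexp
  have h4 : (gauss L : (Fin n → ℝ) → ℂ) = fun y => Complex.exp (gaussExponent L y) :=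
    funext (gauss_apply L)
  have h5 : (∑ j, 2 * x j * (Pi.single i 1 : Fin n → ℝ) j) = 2 * x i := by
    simp [Pi.single_apply]
  rw [dS_apply, pd, _root_.sub_apply, _root_.smul_apply, xS_apply, h4, h3.fderiv]
  simp only [_root_.smul_apply, _root_.add_apply, ContinuousLinearMap.comp_apply,
    _root_.sum_apply, ContinuousLinearMap.proj_apply, smul_eq_mul, h5, Complex.ofRealCLM_apply]
  push_cast
  ring

lemma harm_gauss_apply (L : (Fin n → ℝ) →L[ℝ] ℝ) (x : Fin n → ℝ) :
    harm (gauss L) x = ((1 + n + ∑ i, L (Pi.single i 1) ^ 2 : ℝ) + 2 * L x * I) * gauss L x := by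
  have h1 (i : Fin n) : dS i (dS i (gauss L)) x =
      ((x i : ℂ) ^ 2 - 2 * (L (Pi.single i 1) : ℂ) * I * x i - 1
        - (L (Pi.single i 1) : ℂ) ^ 2) * gauss L x := by
    have h := xS_dS i i (gauss L)
    rw [if_pos rfl] at h
    have h2 : dS i (xS i (gauss L)) = xS i (dS i (gauss L)) + gauss L := by rw [h]; abel
    have h3 : dS i (dS i (gauss L)) = ((L (Pi.single i 1) : ℂ) * I) • dS i (gauss L)
        - (xS i (dS i (gauss L)) + gauss L) := by
      rw [← h2, ← map_smul, ← map_sub, ← dS_gauss]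
    rw [h3, _root_.sub_apply, _root_.add_apply, _root_.smul_apply, xS_apply, dS_gauss,
      _root_.sub_apply, _root_.smul_apply, xS_apply, smul_eq_mul, smul_eq_mul]
    linear_combination (L (Pi.single i 1) : ℂ) ^ 2 * gauss L x * I_sq
  have h2 : ((L x : ℝ) : ℂ) = ∑ i, (L (Pi.single i 1) : ℂ) * x i := by
    conv_lhs => rw [← Finset.univ_sum_single x]
    rw [map_sum]
    push_cast
    refine Finset.sum_congr rfl fun i _ => ?_
    have : (Pi.single i (x i) : Fin n → ℝ) = x i • Pi.single i 1 := by
      rw [← Pi.single_smul]; simp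
    rw [this, map_smul, smul_eq_mul]
    push_cast
    ring
  have h3 : (n : ℂ) = ∑ _i : Fin n, 1 := by simp
  simp only [harm, _root_.sub_apply, _root_.add_apply, _root_.sum_apply, h1, xS_apply]
  rw [add_sub_assoc, ← Finset.sum_sub_distrib]
  push_cast
  rw [h2, h3, add_mul, add_mul, add_mul, one_mul, add_assoc, add_assoc, Finset.mul_sum,
    Finset.sum_mul, Finset.sum_mul, Finset.sum_mul, Finset.sum_mul, ← Finset.sum_add_distrib,
    ← Finset.sum_add_distrib]
  congr 1
  refine Finset.sum_congr rfl fun i _ => ?_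
  ring

/-! ### The range of the harmonic oscillator is dense -/

/-- A real integrable function with vanishing Fourier transform vanishes. -/
lemma ae_eq_zero_of_fourier_real {k : (Fin n → ℝ) → ℝ} (hk : Integrable k)
    (h : ∀ L : (Fin n → ℝ) →L[ℝ] ℝ, ∫ x, (k x : ℂ) * Complex.exp (L x * I) = 0) :
    k =ᵐ[volume] 0 := by
  have hk' : Integrable (fun x => -k x) := hk.neg
  have := isFiniteMeasure_withDensity_ofReal hk.2
  have := isFiniteMeasure_withDensity_ofReal hk'.2
  have hint {g : (Fin n → ℝ) → ℝ} (hg : Integrable g) (L : (Fin n → ℝ) →L[ℝ] ℝ) :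
      Integrable (fun x => (g x : ℂ) * Complex.exp (L x * I)) := by
    refine hg.ofReal.mul_bdd (c := 1) (by fun_prop) (Filter.Eventually.of_forall fun x => ?_)
    rw [Complex.norm_exp_ofReal_mul_I]
  have key : (volume.withDensity fun x => ENNReal.ofReal (k x)) =
      volume.withDensity fun x => ENNReal.ofReal (-k x) := by
    refine Measure.ext_of_charFunDual (funext fun L => ?_)
    rw [charFunDual_apply, charFunDual_apply,
      integral_withDensity_eq_integral_toReal_smul₀ hk.1.aemeasurable.ennreal_ofReal (by simp),
      integral_withDensity_eq_integral_toReal_smul₀ hk'.1.aemeasurable.ennreal_ofReal (by simp),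
      ← sub_eq_zero, ← integral_sub, ← h L]
    · refine integral_congr_ae (Filter.Eventually.of_forall fun x => ?_)
      simp only [Complex.real_smul, ENNReal.toReal_ofReal', ← sub_mul]
      congr 1
      rw [← Complex.ofReal_sub, max_zero_sub_max_neg_zero_eq_self]
    · simpa only [Complex.real_smul, ENNReal.toReal_ofReal'] using hint hk.pos_part L
    · simpa only [Complex.real_smul, ENNReal.toReal_ofReal'] using hint hk'.pos_part L
  rw [withDensity_eq_iff_of_sigmaFinite hk.1.aemeasurable.ennreal_ofReal
    hk'.1.aemeasurable.ennreal_ofReal] at key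
  filter_upwards [key] with x hx
  rcases le_total (k x) 0 with h0 | h0
  · rw [ENNReal.ofReal_of_nonpos h0, eq_comm, ENNReal.ofReal_eq_zero] at hx
    exact le_antisymm h0 (neg_nonpos.1 hx)
  · rw [ENNReal.ofReal_of_nonpos (p := -k x) (by linarith), ENNReal.ofReal_eq_zero] at hx
    exact le_antisymm hx h0

/-- An integrable function with vanishing Fourier transform vanishes. -/
lemma ae_eq_zero_of_fourier {k : (Fin n → ℝ) → ℂ} (hk : Integrable k)
    (h : ∀ L : (Fin n → ℝ) →L[ℝ] ℝ, ∫ x, k x * Complex.exp (L x * I) = 0) :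
    k =ᵐ[volume] 0 := by
  have hint {g : (Fin n → ℝ) → ℂ} (hg : Integrable g) (L : (Fin n → ℝ) →L[ℝ] ℝ) :
      Integrable (fun x => g x * Complex.exp (L x * I)) := by
    refine hg.mul_bdd (c := 1) (by fun_prop) (Filter.Eventually.of_forall fun x => ?_)
    rw [Complex.norm_exp_ofReal_mul_I]
  have hck : Integrable (fun x => conj (k x)) :=
    Complex.conjCLE.toContinuousLinearMap.integrable_comp hk
  have hconj (L : (Fin n → ℝ) →L[ℝ] ℝ) : ∫ x, conj (k x) * Complex.exp (L x * I) = 0 := by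
    rw [← map_zero conj, ← h (-L), ← integral_conj]
    refine integral_congr_ae (Filter.Eventually.of_forall fun x => ?_)
    simp [← Complex.exp_conj]
  have hre : (fun x => (k x).re) =ᵐ[volume] 0 := by
    refine ae_eq_zero_of_fourier_real hk.re fun L => ?_
    have e : ∀ x, ((k x).re : ℂ) * Complex.exp (L x * I) = (1 / 2) *
        (k x * Complex.exp (L x * I) + conj (k x) * Complex.exp (L x * I)) := fun x => by
      rw [← add_mul, Complex.add_conj]; push_cast; ring
    simp_rw [e]
    rw [integral_const_mul, integral_add (hint hk L) (hint hck L), h, hconj, add_zero, mul_zero]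
  have him : (fun x => (k x).im) =ᵐ[volume] 0 := by
    refine ae_eq_zero_of_fourier_real hk.im fun L => ?_
    have e : ∀ x, ((k x).im : ℂ) * Complex.exp (L x * I) = (-I / 2) *
        (k x * Complex.exp (L x * I) - conj (k x) * Complex.exp (L x * I)) := fun x => by
      rw [← sub_mul, Complex.sub_conj]; push_cast
      linear_combination ((k x).im : ℂ) * Complex.exp (L x * I) * I_sq
    simp_rw [e]
    rw [integral_const_mul, integral_sub (hint hk L) (hint hck L), h, hconj, sub_zero, mul_zero]
  filter_upwards [hre, him] with x h1 h2
  exact Complex.ext h1 h2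

lemma inner_emb (f : L2Space n) (u : Sch n) :
    inner ℂ f (emb u) = ∫ x, u x * conj (f x) := by
  rw [L2.inner_def]
  refine integral_congr_ae ?_
  filter_upwards [emb_coe u] with x hx
  rw [hx, RCLike.inner_apply]

lemma integrable_mul_conj (f : L2Space n) (u : Sch n) :
    Integrable (fun x => u x * conj (f x)) := by
  refine (L2.integrable_inner (𝕜 := ℂ) f (emb u)).congr ?_
  filter_upwards [emb_coe u] with x hx
  rw [hx, RCLike.inner_apply]

lemma gauss_eq_mul_exp (L : (Fin n → ℝ) →L[ℝ] ℝ) (x : Fin n → ℝ) :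
    gauss L x = gauss 0 x * Complex.exp (L x * I) := by
  rw [gauss_apply, gauss_apply, ← Complex.exp_add]
  simp [gaussExponent]

lemma hasDerivAt_inner_gauss (f : L2Space n) (L : (Fin n → ℝ) →L[ℝ] ℝ) (s : ℝ) :
    Integrable (fun x => (L x : ℂ) * I * gauss (s • L) x * conj (f x)) ∧
    HasDerivAt (fun s : ℝ => ∫ x, gauss (s • L) x * conj (f x))
      (∫ x, (L x : ℂ) * I * gauss (s • L) x * conj (f x)) s := by
  have hmul (x : Fin n → ℝ) : mulS (fun y => L y) (gauss 0) x = (L x : ℂ) * gauss 0 x :=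
    mulS_apply L.hasTemperateGrowth _ x
  refine hasDerivAt_integral_of_dominated_loc_of_deriv_le
    (F := fun (s : ℝ) x => gauss (s • L) x * conj (f x))
    (F' := fun (s : ℝ) x => (L x : ℂ) * I * gauss (s • L) x * conj (f x)) (s := Set.univ)
    (bound := fun x => ‖mulS (fun y => L y) (gauss 0) x * conj (f x)‖)
    Filter.univ_mem (Filter.Eventually.of_forall fun t => (integrable_mul_conj f _).1)
    (integrable_mul_conj f _) ?_ ?_ (integrable_mul_conj f _).norm ?_
  · have h1 : AEStronglyMeasurable (fun x => (L x : ℂ) * I) (volume : Measure (Fin n → ℝ)) := by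
      fun_prop
    have h2 := h1.mul (integrable_mul_conj f (gauss (s • L))).1
    simpa only [Pi.mul_def, mul_assoc] using h2
  · refine Filter.Eventually.of_forall fun x t _ => le_of_eq ?_
    rw [hmul, norm_mul, norm_mul, norm_mul, norm_mul, norm_mul, norm_gauss, Complex.norm_I,
      mul_one]
  · refine Filter.Eventually.of_forall fun x t _ => ?_
    have e (t : ℝ) : gauss (t • L) x = gauss 0 x * Complex.exp (t * (L x * I)) := by
      rw [gauss_eq_mul_exp, _root_.smul_apply, smul_eq_mul]
      push_cast
      rw [mul_assoc]
    have h1 : HasDerivAt (fun t : ℝ => (t : ℂ) * (L x * I)) (L x * I) t := by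
      simpa using (Complex.ofRealCLM.hasDerivAt (x := t)).mul_const ((L x : ℂ) * I)
    have h2 := ((h1.cexp).const_mul (gauss 0 x)).mul_const (conj (f x))
    simp only [e]
    exact h2.congr_deriv (by ring)

/-- A function orthogonal to the range of the harmonic oscillator is orthogonal to the
modulated Gaussians. -/
lemma integral_gauss_eq_zero {f : L2Space n} (hf : ∀ u : Sch n, inner ℂ f (emb (harm u)) = 0)
    (L : (Fin n → ℝ) →L[ℝ] ℝ) : ∫ x, gauss L x * conj (f x) = 0 := by
  set Q : ℝ := ∑ i, L (Pi.single i 1) ^ 2 with hQ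
  set F : ℝ → ℂ := fun s => ∫ x, gauss (s • L) x * conj (f x) with hF
  set F' : ℝ → ℂ := fun s => ∫ x, (L x : ℂ) * I * gauss (s • L) x * conj (f x) with hF'
  have hode (s : ℝ) : (1 + n + s ^ 2 * Q : ℂ) * F s + 2 * s * F' s = 0 := by
    have h1 := hf (gauss (s • L))
    rw [inner_emb] at h1
    rw [← h1, hF, hF']
    simp only
    rw [← integral_const_mul, ← integral_const_mul, ← integral_add
      ((integrable_mul_conj f _).const_mul _) ((hasDerivAt_inner_gauss f L s).1.const_mul _)]
    refine integral_congr_ae (Filter.Eventually.of_forall fun x => ?_)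
    simp only [harm_gauss_apply, _root_.smul_apply, smul_eq_mul, mul_pow, ← Finset.mul_sum, hQ]
    push_cast
    ring
  have hE (s : ℝ) : HasDerivAt (fun s : ℝ => (s : ℂ) ^ (n + 1) * Complex.exp ((s : ℂ) ^ 2 * Q / 2)
      * F s ^ 2) 0 s := by
    have hs : HasDerivAt (fun s : ℝ => (s : ℂ)) 1 s := Complex.ofRealCLM.hasDerivAt
    have h1 := hs.pow (n + 1)
    have h2 := (((hs.pow 2).mul_const (Q : ℂ)).div_const 2).cexp
    have h3 := (hasDerivAt_inner_gauss f L s).2.pow 2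
    refine ((h1.mul h2).mul h3).congr_deriv ?_
    have := hode s
    change (_ + _) * F s ^ 2 + _ * (_ * F s ^ (2 - 1) * F' s) = 0
    simp only [Pi.mul_apply, Pi.pow_apply, Nat.add_sub_cancel]
    push_cast
    linear_combination ((s : ℂ) ^ n * Complex.exp ((s : ℂ) ^ 2 * Q / 2) * F s) * this
  have hconst := is_const_of_deriv_eq_zero (fun s => (hE s).differentiableAt)
    (fun s => (hE s).deriv) 1 0
  simp only [Complex.ofReal_one, Complex.ofReal_zero, one_pow, zero_pow (Nat.succ_ne_zero n),
    zero_mul, one_mul, mul_eq_zero, Complex.exp_ne_zero, false_or] at hconst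
  simpa [hF] using hconst

/-- The range of the harmonic oscillator on Schwartz functions is dense. -/
lemma eq_zero_of_orthogonal_harm {f : L2Space n}
    (hf : ∀ u : Sch n, inner ℂ f (emb (harm u)) = 0) : f = 0 := by
  have h1 := ae_eq_zero_of_fourier (integrable_mul_conj f (gauss 0)) fun L => by
    rw [← integral_gauss_eq_zero hf L]
    refine integral_congr_ae (Filter.Eventually.of_forall fun x => ?_)
    simp only [gauss_eq_mul_exp L]
    ring
  refine Lp.ext ?_
  filter_upwards [h1, Lp.coeFn_zero ℂ 2 volume] with x hx h0
  rw [h0]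
  simpa [gauss_apply] using hx

/-! ### Coefficients with bounded derivatives -/

lemma norm_le_of_norm_fderiv_le {F : Type*} [NormedAddCommGroup F] [NormedSpace ℝ F]
    {f : (Fin n → ℝ) → F} (hf : Differentiable ℝ f) {A C : ℝ} (hC : 0 ≤ C)
    (h : ∀ x, ‖fderiv ℝ f x‖ ≤ A + C * ‖x‖) (x : Fin n → ℝ) :
    ‖f x‖ ≤ ‖f 0‖ + (A + C * ‖x‖) * ‖x‖ := by
  have h1 := (convex_closedBall (0 : Fin n → ℝ) ‖x‖).norm_image_sub_le_of_norm_fderiv_le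
    (𝕜 := ℝ) (f := f) (C := A + C * ‖x‖) (x := 0) (y := x) (fun y _ => hf y)
    (fun y hy => (h y).trans (by
      have : ‖y‖ ≤ ‖x‖ := by simpa using hy
      gcongr)) (by simp) (by simp)
  rw [sub_zero] at h1
  have h2 := norm_le_insert' (f x) (f 0)
  linarith

lemma norm_le_of_norm_fderiv_bdd {F : Type*} [NormedAddCommGroup F] [NormedSpace ℝ F]
    {f : (Fin n → ℝ) → F} (hf : Differentiable ℝ f) {C : ℝ}
    (h : ∀ x, ‖fderiv ℝ f x‖ ≤ C) (x : Fin n → ℝ) : ‖f x‖ ≤ ‖f 0‖ + C * ‖x‖ := by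
  simpa using norm_le_of_norm_fderiv_le hf le_rfl
    (fun x => by simpa using h x) x

lemma sq_le_of_norm_fderiv_bdd {f : (Fin n → ℝ) → ℝ} (hf : Differentiable ℝ f) {C : ℝ}
    (h : ∀ x, ‖fderiv ℝ f x‖ ≤ C) :
    ∃ D : ℝ, 0 ≤ D ∧ ∀ x, f x ^ 2 ≤ D * (1 + ∑ i, x i ^ 2) := by
  refine ⟨2 * (‖f 0‖ ^ 2 + C ^ 2), by positivity, fun x => ?_⟩
  have h1 := norm_le_of_norm_fderiv_bdd hf h x
  have h2 := sq_norm_le_sum_sq x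
  have h3 : f x ^ 2 ≤ (‖f 0‖ + C * ‖x‖) ^ 2 := by
    rw [← sq_abs, ← Real.norm_eq_abs]
    gcongr
  have h4 : C ^ 2 * ‖x‖ ^ 2 ≤ C ^ 2 * ∑ i, x i ^ 2 := by gcongr
  have h5 : 0 ≤ ‖f 0‖ ^ 2 * ∑ i, x i ^ 2 :=
    mul_nonneg (sq_nonneg _) ((sq_nonneg _).trans h2)
  nlinarith [sq_nonneg (‖f 0‖ - C * ‖x‖), sq_nonneg C]

lemma norm_apply_single_le (L : (Fin n → ℝ) →L[ℝ] ℝ) (l : Fin n) :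
    ‖L (Pi.single l 1)‖ ≤ ‖L‖ := by
  refine (L.le_opNorm _).trans_eq ?_
  rw [Pi.norm_single, norm_one, mul_one]

lemma abs_pdR_le (a : (Fin n → ℝ) → ℝ) (l : Fin n) (x : Fin n → ℝ) :
    |pdR l a x| ≤ ‖iteratedFDeriv ℝ 1 a x‖ := by
  rw [norm_iteratedFDeriv_one]
  exact norm_apply_single_le _ l

lemma norm_fderiv_fderiv (a : (Fin n → ℝ) → ℝ) (x : Fin n → ℝ) :
    ‖fderiv ℝ (fderiv ℝ a) x‖ = ‖iteratedFDeriv ℝ 2 a x‖ := by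
  rw [← norm_iteratedFDeriv_one, norm_iteratedFDeriv_fderiv]

lemma differentiable_fderiv {a : (Fin n → ℝ) → ℝ} (ha : ContDiff ℝ ∞ a) :
    Differentiable ℝ (fderiv ℝ a) :=
  (ha.fderiv_right (m := ∞) (by simp)).differentiable (by simp)

lemma norm_fderiv_pdR_le {a : (Fin n → ℝ) → ℝ} (ha : ContDiff ℝ ∞ a) (l : Fin n)
    (x : Fin n → ℝ) : ‖fderiv ℝ (pdR l a) x‖ ≤ ‖iteratedFDeriv ℝ 2 a x‖ := by
  have h1 : HasFDerivAt (fderiv ℝ a) (fderiv ℝ (fderiv ℝ a) x) x :=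
    (differentiable_fderiv ha x).hasFDerivAt
  have h2 := (ContinuousLinearMap.apply ℝ ℝ (Pi.single l 1 : Fin n → ℝ)).hasFDerivAt.comp x h1
  have h3 : fderiv ℝ (pdR l a) x = (ContinuousLinearMap.apply ℝ ℝ
      (Pi.single l 1 : Fin n → ℝ)).comp (fderiv ℝ (fderiv ℝ a) x) := h2.fderiv
  rw [h3, ← norm_fderiv_fderiv]
  refine ContinuousLinearMap.opNorm_le_bound _ (by positivity) fun v => ?_
  exact (norm_apply_single_le (fderiv ℝ (fderiv ℝ a) x v) l).trans
    ((fderiv ℝ (fderiv ℝ a) x).le_opNorm v)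

lemma differentiable_pdR {a : (Fin n → ℝ) → ℝ} (ha : ContDiff ℝ ∞ a) (l : Fin n) :
    Differentiable ℝ (pdR l a) := by
  exact fun x => (differentiable_fderiv ha x).clm_apply (differentiableAt_const _)

lemma abs_pdR_pdR_le {a : (Fin n → ℝ) → ℝ} (ha : ContDiff ℝ ∞ a) (k l : Fin n)
    (x : Fin n → ℝ) : |pdR k (pdR l a) x| ≤ ‖iteratedFDeriv ℝ 2 a x‖ :=
  (norm_apply_single_le _ k).trans (norm_fderiv_pdR_le ha l x)

lemma norm_fderiv_linear_growth {a : (Fin n → ℝ) → ℝ} (ha : ContDiff ℝ ∞ a) {C : ℝ}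
    (hC : ∀ x, ‖iteratedFDeriv ℝ 2 a x‖ ≤ C) (x : Fin n → ℝ) :
    ‖fderiv ℝ a x‖ ≤ ‖fderiv ℝ a 0‖ + C * ‖x‖ :=
  norm_le_of_norm_fderiv_bdd (differentiable_fderiv ha)
    (fun x => (norm_fderiv_fderiv a x).trans_le (hC x)) x

lemma norm_quadratic_growth {a : (Fin n → ℝ) → ℝ} (ha : ContDiff ℝ ∞ a) {C : ℝ}
    (hC : ∀ x, ‖iteratedFDeriv ℝ 2 a x‖ ≤ C) (x : Fin n → ℝ) :
    ‖a x‖ ≤ ‖a 0‖ + (‖fderiv ℝ a 0‖ + C * ‖x‖) * ‖x‖ :=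
  norm_le_of_norm_fderiv_le (ha.differentiable (by simp))
    ((norm_nonneg _).trans (hC 0)) (norm_fderiv_linear_growth ha hC) x

lemma hasTemperateGrowth_of_bdd {a : (Fin n → ℝ) → ℝ} (ha : ContDiff ℝ ∞ a)
    (h : ∀ m : ℕ, ∃ C : ℝ, ∀ x, ‖iteratedFDeriv ℝ m a x‖ ≤ C) : a.HasTemperateGrowth := by
  refine ⟨ha, fun m => ?_⟩
  obtain ⟨C, hC⟩ := h m
  exact ⟨0, C, by simpa using hC⟩

lemma hasTemperateGrowth_of_bdd_one {a : (Fin n → ℝ) → ℝ} (ha : ContDiff ℝ ∞ a)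
    (h : ∀ m : ℕ, 1 ≤ m → ∃ C : ℝ, ∀ x, ‖iteratedFDeriv ℝ m a x‖ ≤ C) :
    a.HasTemperateGrowth := by
  refine ⟨ha, fun m => ?_⟩
  rcases Nat.eq_zero_or_pos m with rfl | hm
  · obtain ⟨C, hC⟩ := h 1 le_rfl
    simp only [norm_iteratedFDeriv_one] at hC
    refine ⟨1, ‖a 0‖ + C, fun x => ?_⟩
    have h1 := norm_le_of_norm_fderiv_bdd (ha.differentiable (by simp)) hC x
    have h2 := (norm_nonneg _).trans (hC 0)
    rw [norm_iteratedFDeriv_zero]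
    nlinarith [norm_nonneg x, norm_nonneg (a 0), mul_nonneg (norm_nonneg (a 0)) (norm_nonneg x)]
  · obtain ⟨C, hC⟩ := h m hm
    exact ⟨0, C, by simpa using hC⟩

lemma hasTemperateGrowth_of_bdd_two {a : (Fin n → ℝ) → ℝ} (ha : ContDiff ℝ ∞ a)
    (h : ∀ m : ℕ, 2 ≤ m → ∃ C : ℝ, ∀ x, ‖iteratedFDeriv ℝ m a x‖ ≤ C) :
    a.HasTemperateGrowth := by
  obtain ⟨C, hC⟩ := h 2 le_rfl
  have hC0 := (norm_nonneg _).trans (hC 0)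
  refine ⟨ha, fun m => ?_⟩
  rcases Nat.lt_or_ge m 2 with hm | hm
  · refine ⟨2, ‖a 0‖ + ‖fderiv ℝ a 0‖ + C, fun x => ?_⟩
    have h0 := norm_nonneg x
    have hA := norm_nonneg (a 0)
    have hB := norm_nonneg (fderiv ℝ a 0)
    have h1 := mul_nonneg hA h0
    have h2 := mul_nonneg hB h0
    have h3 := mul_nonneg hC0 h0
    have h4 := mul_nonneg h1 h0
    have h5 := mul_nonneg h2 h0
    have h6 := mul_nonneg h3 h0
    interval_cases m
    · rw [norm_iteratedFDeriv_zero]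
      have := norm_quadratic_growth ha hC x
      nlinarith
    · rw [norm_iteratedFDeriv_one]
      have := norm_fderiv_linear_growth ha hC x
      nlinarith
  · obtain ⟨C, hC⟩ := h m hm
    exact ⟨0, C, by simpa using hC⟩

lemma quadratic_growth {a : (Fin n → ℝ) → ℝ} (ha : ContDiff ℝ ∞ a) {C : ℝ}
    (hC : ∀ x, ‖iteratedFDeriv ℝ 2 a x‖ ≤ C) :
    ∃ D : ℝ, 0 ≤ D ∧ ∀ x, |a x| ≤ D * (1 + ∑ i, x i ^ 2) := by
  have hC0 := (norm_nonneg _).trans (hC 0)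
  have hA := norm_nonneg (a 0)
  have hB := norm_nonneg (fderiv ℝ a 0)
  refine ⟨‖a 0‖ + ‖fderiv ℝ a 0‖ + C, by positivity, fun x => ?_⟩
  have h1 := norm_quadratic_growth ha hC x
  have h2 := sq_norm_le_sum_sq x
  rw [Real.norm_eq_abs (a x)] at h1
  have h3 : ‖x‖ ≤ 1 + ‖x‖ ^ 2 := by nlinarith [sq_nonneg (‖x‖ - 1)]
  have h4 := mul_le_mul_of_nonneg_left h3 hB
  have h5 := mul_nonneg hA (sq_nonneg ‖x‖)
  calc |a x| ≤ (‖a 0‖ + ‖fderiv ℝ a 0‖ + C) * (1 + ‖x‖ ^ 2) := by nlinarith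
    _ ≤ _ := by gcongr

lemma admissible_of_bdd {b : Fin n → Fin n → (Fin n → ℝ) → ℝ} {c : Fin n → (Fin n → ℝ) → ℝ}
    {p0 : (Fin n → ℝ) → ℝ}
    (hb_smooth : ∀ j k, ContDiff ℝ ∞ (b j k)) (hc_smooth : ∀ j, ContDiff ℝ ∞ (c j))
    (hp0_smooth : ContDiff ℝ ∞ p0) (hb_symm : ∀ j k x, b j k x = b k j x)
    (hb_bdd : ∀ j k (m : ℕ), ∃ C : ℝ, ∀ x, ‖iteratedFDeriv ℝ m (b j k) x‖ ≤ C)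
    (hc_bdd : ∀ j (m : ℕ), 1 ≤ m → ∃ C : ℝ, ∀ x, ‖iteratedFDeriv ℝ m (c j) x‖ ≤ C)
    (hp0_bdd : ∀ m : ℕ, 2 ≤ m → ∃ C : ℝ, ∀ x, ‖iteratedFDeriv ℝ m p0 x‖ ≤ C)
    (hp2_pos : ∀ (x ξ : Fin n → ℝ), 0 ≤ ∑ j, ∑ k, b j k x * ξ j * ξ k)
    (hp0_pos : ∀ x, 0 ≤ p0 x) : Admissible b c p0 where
  b_growth i j := hasTemperateGrowth_of_bdd (hb_smooth i j) (hb_bdd i j)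
  c_growth j := hasTemperateGrowth_of_bdd_one (hc_smooth j) (hc_bdd j)
  p0_growth := hasTemperateGrowth_of_bdd_two hp0_smooth hp0_bdd
  b_symm i j := funext (hb_symm i j)
  b_bdd i j := by simpa using hb_bdd i j 0
  pd_b_bdd l i j := (hb_bdd i j 1).imp fun _ hC x => (abs_pdR_le _ l x).trans (hC x)
  pd_pd_b_bdd k l i j :=
    (hb_bdd i j 2).imp fun _ hC x => (abs_pdR_pdR_le (hb_smooth i j) k l x).trans (hC x)
  c_linear j := by
    obtain ⟨C, hC⟩ := hc_bdd j 1 le_rfl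
    simp only [norm_iteratedFDeriv_one] at hC
    exact sq_le_of_norm_fderiv_bdd ((hc_smooth j).differentiable (by simp)) hC
  pd_c_bdd l j := (hc_bdd j 1 le_rfl).imp fun _ hC x => (abs_pdR_le _ l x).trans (hC x)
  pd_pd_c_bdd k l j := (hc_bdd j 2 one_le_two).imp fun _ hC x =>
    (abs_pdR_pdR_le (hc_smooth j) k l x).trans (hC x)
  p0_quadratic := by
    obtain ⟨C, hC⟩ := hp0_bdd 2 le_rfl
    exact quadratic_growth hp0_smooth hC
  pd_p0_linear l := by
    obtain ⟨C, hC⟩ := hp0_bdd 2 le_rfl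
    exact sq_le_of_norm_fderiv_bdd (differentiable_pdR hp0_smooth l)
      fun x => (norm_fderiv_pdR_le hp0_smooth l x).trans (hC x)
  b_pos := hp2_pos
  p0_pos := hp0_pos

/-! ### Closed accretive graphs -/

section AccretiveGraph

variable {E : Type*} [NormedAddCommGroup E] [InnerProductSpace ℂ E]

/-- The resolvent estimate for an accretive graph. -/
lemma norm_fst_le_of_accretive {q : E × E} (hq : 0 ≤ (inner ℂ q.1 q.2).re) {z : ℂ}
    (hz : z.re < 0) : ‖q.1‖ ≤ |z.re|⁻¹ * ‖q.2 - z • q.1‖ := by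
  rw [abs_of_neg hz, inv_mul_eq_div, le_div_iff₀ (by linarith)]
  have h1 : (inner ℂ q.1 (q.2 - z • q.1)).re = (inner ℂ q.1 q.2).re - z.re * ‖q.1‖ ^ 2 := by
    rw [inner_sub_right, inner_smul_right, inner_self_eq_norm_sq_to_K, Complex.sub_re]
    have h3 : (z * (‖q.1‖ : ℂ) ^ 2).re = z.re * ‖q.1‖ ^ 2 := by
      rw [← Complex.ofReal_pow, Complex.re_mul_ofReal]
    exact congrArg _ h3
  have h2 : (inner ℂ q.1 (q.2 - z • q.1)).re ≤ ‖q.1‖ * ‖q.2 - z • q.1‖ :=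
    (Complex.re_le_norm _).trans (norm_inner_le_norm _ _)
  rcases (norm_nonneg q.1).eq_or_lt with h0 | h0
  · rw [← h0, zero_mul]; exact norm_nonneg _
  · refine le_of_mul_le_mul_left ?_ h0
    nlinarith

variable [CompleteSpace E]

/-- Surjectivity at one point of the negative real axis, from density of the range. -/
lemma exists_mem_of_dense {K : Submodule ℂ (E × E)} (hK : IsClosed (K : Set (E × E)))
    (hacc : ∀ q ∈ K, 0 ≤ (inner ℂ q.1 q.2).re) {r : ℝ} (hr : 0 < r)
    (hd : Dense {v : E | ∃ q ∈ K, q.2 + (r : ℂ) • q.1 = v}) (v : E) :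
    ∃ q ∈ K, q.2 + (r : ℂ) • q.1 = v := by
  have : CompleteSpace K := hK.completeSpace_coe
  set A : K →L[ℂ] E := ((ContinuousLinearMap.snd ℂ E E) +
    (r : ℂ) • (ContinuousLinearMap.fst ℂ E E)).comp K.subtypeL with hA
  have hAq (q : K) : A q = q.1.2 + (r : ℂ) • q.1.1 := rfl
  have h1 (q : K) : ‖q.1.1‖ ≤ r⁻¹ * ‖A q‖ := by
    have := norm_fst_le_of_accretive (hacc q q.2) (z := -(r : ℂ)) (by simpa using hr)
    simpa [hAq, abs_of_pos hr] using this
  have h2 (q : K) : ‖q.1.2‖ ≤ 2 * ‖A q‖ := by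
    have h3 : q.1.2 = A q - (r : ℂ) • q.1.1 := by rw [hAq]; abel
    have h4 : ‖(r : ℂ) • q.1.1‖ ≤ ‖A q‖ := by
      rw [norm_smul, Complex.norm_real, Real.norm_of_nonneg hr.le]
      calc r * ‖q.1.1‖ ≤ r * (r⁻¹ * ‖A q‖) := by gcongr; exact h1 q
        _ = ‖A q‖ := by field_simp
    rw [h3]
    refine (norm_sub_le _ _).trans ?_
    linarith
  have hanti : AntilipschitzWith (max r⁻¹ 2).toNNReal A := by
    refine A.antilipschitz_of_bound fun q => ?_
    have h0 := norm_nonneg (A q)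
    rw [Real.coe_toNNReal _ (by positivity)]
    refine max_le ((h1 q).trans ?_) ((h2 q).trans ?_)
    · exact mul_le_mul_of_nonneg_right (le_max_left _ _) h0
    · exact mul_le_mul_of_nonneg_right (le_max_right _ _) h0
  have hcl : IsClosed (Set.range A) := hanti.isClosed_range A.uniformContinuous
  have hdr : DenseRange A := by
    refine hd.mono ?_
    rintro w ⟨q, hq, rfl⟩
    exact ⟨⟨q, hq⟩, rfl⟩
  have hv : v ∈ Set.range A := by
    rw [← hcl.closure_eq]
    exact hdr v
  obtain ⟨q, hq⟩ := hv
  exact ⟨q, q.2, hq⟩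

/-- Surjectivity in the whole left half-plane. -/
lemma exists_mem_of_accretive {K : Submodule ℂ (E × E)} (hK : IsClosed (K : Set (E × E)))
    (hacc : ∀ q ∈ K, 0 ≤ (inner ℂ q.1 q.2).re) {C : ℝ}
    (hd : ∀ r : ℝ, C < r → Dense {v : E | ∃ q ∈ K, q.2 + (r : ℂ) • q.1 = v})
    {z : ℂ} (hz : z.re < 0) (v : E) : ∃ q ∈ K, q.2 - z • q.1 = v := by
  obtain ⟨r, hr0, hrC, hrz⟩ : ∃ r : ℝ, 0 < r ∧ C < r ∧ ‖z + r‖ < r := by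
    have hD : 0 ≤ ‖z‖ ^ 2 / (-2 * z.re) := div_nonneg (sq_nonneg _) (by linarith)
    have hr : 0 < |C| + ‖z‖ ^ 2 / (-2 * z.re) + 1 := by positivity
    refine ⟨|C| + ‖z‖ ^ 2 / (-2 * z.re) + 1, hr, ?_, ?_⟩
    · have := le_abs_self C
      linarith
    · set r := |C| + ‖z‖ ^ 2 / (-2 * z.re) + 1 with hrdef
      have h1 : ‖z‖ ^ 2 / (-2 * z.re) < r := by
        have := abs_nonneg C
        linarith
      rw [div_lt_iff₀ (by linarith)] at h1
      refine lt_of_pow_lt_pow_left₀ 2 hr.le ?_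
      rw [← Complex.normSq_eq_norm_sq, Complex.normSq_apply] at h1 ⊢
      simp only [Complex.add_re, Complex.add_im, Complex.ofReal_re, Complex.ofReal_im]
      nlinarith
  choose R hRK hR using exists_mem_of_dense hK hacc hr0 (hd r hrC)
  have hlip (g g' : E) : ‖(R g).1 - (R g').1‖ ≤ r⁻¹ * ‖g - g'‖ := by
    have h1 := norm_fst_le_of_accretive (hacc _ (K.sub_mem (hRK g) (hRK g'))) (z := -(r : ℂ))
      (by simpa using hr0)
    have h2 : (R g - R g').2 - (-(r : ℂ)) • (R g - R g').1 = g - g' := by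
      have h3 : g - g' = ((R g).2 + (r : ℂ) • (R g).1) - ((R g').2 + (r : ℂ) • (R g').1) := by
        rw [hR, hR]
      rw [h3, Prod.snd_sub, Prod.fst_sub, neg_smul, smul_sub]
      abel
    rw [h2] at h1
    simpa [abs_of_pos hr0] using h1
  set F : E → E := fun g => v + (z + r) • (R g).1 with hF
  have hcontr : ContractingWith (‖z + r‖ / r).toNNReal F := by
    refine ⟨by rw [Real.toNNReal_lt_one]; exact (div_lt_one hr0).2 hrz,
      LipschitzWith.of_dist_le_mul fun g g' => ?_⟩
    rw [dist_eq_norm, dist_eq_norm, hF, Real.coe_toNNReal _ (by positivity)]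
    simp only [add_sub_add_left_eq_sub]
    rw [← smul_sub, norm_smul, div_eq_mul_inv, mul_assoc]
    gcongr
    exact hlip g g'
  have hfix : F (hcontr.fixedPoint F) = hcontr.fixedPoint F := hcontr.fixedPoint_isFixedPt
  set g := hcontr.fixedPoint F
  refine ⟨R g, hRK g, ?_⟩
  have h1 : (R g).2 + (r : ℂ) • (R g).1 = v + (z + r) • (R g).1 := (hR g).trans hfix.symm
  rw [add_smul, ← add_assoc] at h1
  rw [sub_eq_iff_eq_add]
  exact add_right_cancel h1

end AccretiveGraph

/-! ### Density of the range -/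

/-- The map `u ↦ (1 + ∑ (x_j² - ∂_j²)) u` from the Schwartz space to `L²`. -/
def harmL2 : Sch n →ₗ[ℂ] L2Space n where
  toFun u := emb (harm u)
  map_add' u v := by
    rw [← map_add]
    congr 1
    simp only [harm, map_add, Finset.sum_add_distrib]
    abel
  map_smul' z u := by
    rw [RingHom.id_apply, ← map_smul]
    congr 1
    simp only [harm, map_smul, ← Finset.smul_sum, ← smul_add, ← smul_sub]

lemma denseRange_harm : DenseRange fun u : Sch n => emb (harm u) := by
  have h : (LinearMap.range (harmL2 (n := n))).topologicalClosure = ⊤ := by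
    rw [Submodule.topologicalClosure_eq_top_iff, Submodule.eq_bot_iff]
    exact fun f hf => eq_zero_of_orthogonal_harm fun u =>
      Submodule.inner_left_of_mem_orthogonal (LinearMap.mem_range_self harmL2 u) hf
  have := (Submodule.dense_iff_topologicalClosure_eq_top).2 h
  rwa [LinearMap.coe_range] at this

lemma rip_harm_comm (u v : Sch n) : rip (harm u) v = rip u (harm v) := by
  rw [rip_comm, rip_harm, rip_harm, rip_comm u v]
  simp only [rip_comm (xS _ v), rip_comm (dS _ v)]

lemma eq_zero_of_re_inner_emb {f : L2Space n} (hf : ∀ u : Sch n, (inner ℂ f (emb u)).re = 0) :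
    f = 0 := by
  have h : (fun y : L2Space n => (inner ℂ f y).re) = fun _ => 0 :=
    emb_dense.equalizer (by fun_prop) continuous_const (funext hf)
  have h1 := congrFun h f
  rw [inner_self_eq_norm_sq_to_K] at h1
  have h2 : ‖f‖ ^ 2 = 0 := by exact_mod_cast h1
  simpa using h2

section MinGraph

variable {b : Fin n → Fin n → (Fin n → ℝ) → ℝ} {c : Fin n → (Fin n → ℝ) → ℝ}
  {p0 : (Fin n → ℝ) → ℝ}

lemma eq_zero_of_orthogonal_opS (h : ℝ) (H : Admissible b c p0) {C r : ℝ}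
    (hC : ∀ u, -(C * harmForm u) ≤ rip (opS h b c p0 u) (harm u)) (hr : C < r) {f : L2Space n}
    (hf : ∀ u, inner ℂ f (emb (opS h b c p0 u + r • u)) = 0) : f = 0 := by
  obtain ⟨D, hD0, hD⟩ := (domBy_harm_opS h H).add (domBy_harm_id.smul r)
  obtain ⟨s, hs, hsf⟩ := mem_closure_iff_seq_limit.1 (denseRange_harm f)
  choose g hg using hs
  simp only at hg
  have hgf : Filter.Tendsto (fun m => emb (harm (g m))) Filter.atTop (nhds f) := by
    simpa only [hg] using hsf
  have hbound (m : ℕ) : (r - C) * nrm (g m) ^ 2 ≤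
      ‖emb (harm (g m)) - f‖ * (D * ‖emb (harm (g m))‖) := by
    set w := opS h b c p0 (g m) + r • g m with hw
    have h1 : rip (harm (g m)) w = (inner ℂ (emb (harm (g m)) - f) (emb w)).re := by
      rw [rip_eq_re, inner_sub_left, hf, sub_zero]
    have h2 : rip (harm (g m)) w ≤ ‖emb (harm (g m)) - f‖ * (D * ‖emb (harm (g m))‖) := by
      rw [h1]
      refine (Complex.re_le_norm _).trans ((norm_inner_le_norm _ _).trans ?_)
      exact mul_le_mul_of_nonneg_left (hD (g m)) (norm_nonneg _)
    have h3 : rip (harm (g m)) w = rip (opS h b c p0 (g m)) (harm (g m))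
        + r * harmForm (g m) := by
      rw [rip_comm, hw, map_add, LinearMap.add_apply, map_smul, LinearMap.smul_apply,
        rip_harm_self, smul_eq_mul]
    have h4 := hC (g m)
    have h5 := mul_le_mul_of_nonneg_left (nrm_sq_le_harmForm (g m)) (sub_nonneg.2 hr.le)
    linarith
  have hlim : Filter.Tendsto (fun m => ‖emb (harm (g m)) - f‖ * (D * ‖emb (harm (g m))‖))
      Filter.atTop (nhds 0) := by
    have h1 := (hgf.sub_const f).norm.mul (hgf.norm.const_mul D)
    simpa using h1
  have hsq : Filter.Tendsto (fun m => (r - C) * nrm (g m) ^ 2) Filter.atTop (nhds 0) :=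
    squeeze_zero (fun m => mul_nonneg (sub_nonneg.2 hr.le) (sq_nonneg _)) hbound hlim
  have hg0 : Filter.Tendsto (fun m => emb (g m)) Filter.atTop (nhds 0) := by
    rw [tendsto_zero_iff_norm_tendsto_zero]
    have h1 := (hsq.const_mul (r - C)⁻¹).sqrt
    have h2 : (r - C) ≠ 0 := (sub_pos.2 hr).ne'
    simpa [inv_mul_cancel_left₀ h2, nrm] using h1
  refine eq_zero_of_re_inner_emb fun φ => ?_
  have h1 : Filter.Tendsto (fun m => (inner ℂ (emb (harm (g m))) (emb φ)).re) Filter.atTop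
      (nhds (inner ℂ f (emb φ)).re) :=
    (Complex.continuous_re.tendsto _).comp (hgf.inner tendsto_const_nhds)
  have h2 : Filter.Tendsto (fun m => (inner ℂ (emb (g m)) (emb (harm φ))).re) Filter.atTop
      (nhds (inner ℂ (0 : L2Space n) (emb (harm φ))).re) :=
    (Complex.continuous_re.tendsto _).comp (hg0.inner tendsto_const_nhds)
  simp only [← rip_eq_re, rip_harm_comm] at h1 h2
  rw [tendsto_nhds_unique h1 h2, inner_zero_left, Complex.zero_re]

/-! ### The closed graph -/

/-- The graph embedding `u ↦ (u, P u)` of the Schwartz space into `L² × L²`. -/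
def graphMap (h : ℝ) (b : Fin n → Fin n → (Fin n → ℝ) → ℝ) (c : Fin n → (Fin n → ℝ) → ℝ)
    (p0 : (Fin n → ℝ) → ℝ) : Sch n →ₗ[ℂ] L2Space n × L2Space n where
  toFun u := (emb u, emb (opS h b c p0 u))
  map_add' u v := by rw [opS_add, map_add, map_add, Prod.mk_add_mk]
  map_smul' z u := by rw [opS_smul, map_smul, map_smul, RingHom.id_apply, Prod.smul_mk]

lemma range_graphMap (h : ℝ) (H : Admissible b c p0) :
    (LinearMap.range (graphMap h b c p0) : Set (L2Space n × L2Space n)) =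
      graphSet n h b c p0 := by
  have hop (u : Sch n) : ⇑(emb (opS h b c p0 u)) =ᵐ[volume] Pop n h b c p0 u := by
    rw [← opS_coe h H.b_growth H.c_growth H.p0_growth]
    exact emb_coe _
  ext q
  simp only [SetLike.mem_coe, LinearMap.mem_range, graphSet, Set.mem_ofPred_eq]
  refine exists_congr fun u => ⟨?_, fun hq => ?_⟩
  · rintro rfl
    exact ⟨emb_coe u, hop u⟩
  · exact Prod.ext (Lp.ext ((emb_coe u).trans hq.1.symm)) (Lp.ext ((hop u).trans hq.2.symm))

/-- The graph of the minimal closed extension, as a subspace. -/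
def minGraph (h : ℝ) (b : Fin n → Fin n → (Fin n → ℝ) → ℝ) (c : Fin n → (Fin n → ℝ) → ℝ)
    (p0 : (Fin n → ℝ) → ℝ) : Submodule ℂ (L2Space n × L2Space n) :=
  (LinearMap.range (graphMap h b c p0)).topologicalClosure

lemma mem_minGraph_iff (h : ℝ) (H : Admissible b c p0) {q : L2Space n × L2Space n} :
    q ∈ minGraph h b c p0 ↔ q ∈ closure (graphSet n h b c p0) := by
  rw [← range_graphMap h H]
  rfl

lemma re_inner_nonneg_of_mem_minGraph (h : ℝ) (H : Admissible b c p0) :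
    ∀ q ∈ minGraph h b c p0, 0 ≤ (inner ℂ q.1 q.2).re := by
  have hcl : IsClosed {q : L2Space n × L2Space n | 0 ≤ (inner ℂ q.1 q.2).re} :=
    isClosed_le continuous_const (by fun_prop)
  refine fun q hq => closure_minimal ?_ hcl hq
  rintro _ ⟨u, rfl⟩
  change 0 ≤ (inner ℂ (emb u) (emb (opS h b c p0 u))).re
  rw [← rip_eq_re, rip_comm]
  exact rip_opS_self_nonneg h H u

lemma dense_range_minGraph (h : ℝ) (H : Admissible b c p0) :
    ∃ C : ℝ, ∀ r : ℝ, C < r →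
      Dense {v : L2Space n | ∃ q ∈ minGraph h b c p0, q.2 + (r : ℂ) • q.1 = v} := by
  obtain ⟨C, -, hC⟩ := rip_opS_harm h H
  refine ⟨C, fun r hr => ?_⟩
  set A : L2Space n × L2Space n →ₗ[ℂ] L2Space n :=
    LinearMap.snd ℂ _ _ + (r : ℂ) • LinearMap.fst ℂ _ _ with hA
  have htop : ((minGraph h b c p0).map A).topologicalClosure = ⊤ := by
    rw [Submodule.topologicalClosure_eq_top_iff, Submodule.eq_bot_iff]
    refine fun f hf => eq_zero_of_orthogonal_opS h H hC hr fun u => ?_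
    refine Submodule.inner_left_of_mem_orthogonal (K := (minGraph h b c p0).map A) ?_ hf
    refine ⟨graphMap h b c p0 u, subset_closure ⟨u, rfl⟩, ?_⟩
    change emb (opS h b c p0 u) + (r : ℂ) • emb u = _
    rw [map_add, ← Complex.coe_smul, map_smul]
  exact (Submodule.dense_iff_topologicalClosure_eq_top).2 htop

end MinGraph

end

/-- Proposition 3.1: for `Re z < 0`, `P_min − z : 𝒟(P_min) → L²` is
bijective with `‖(P_min − z)⁻¹‖ ≤ |Re z|⁻¹`.  Bijectivity is expressed through the closed
graph of `P_min`: for every `v ∈ L²` there is a unique point `(u, w)` of the closure of the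
graph with `w − z u = v`, and on the graph one has `‖u‖ ≤ |Re z|⁻¹ ‖w − z u‖`. -/
theorem statement2 (n : ℕ) (h : ℝ) (hh : 0 < h)
    (b : Fin n → Fin n → (Fin n → ℝ) → ℝ) (c : Fin n → (Fin n → ℝ) → ℝ)
    (p0 : (Fin n → ℝ) → ℝ)
    (hb_smooth : ∀ j k, ContDiff ℝ (⊤ : ℕ∞) (b j k))
    (hc_smooth : ∀ j, ContDiff ℝ (⊤ : ℕ∞) (c j))
    (hp0_smooth : ContDiff ℝ (⊤ : ℕ∞) p0)
    (hb_symm : ∀ j k x, b j k x = b k j x)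
    (hb_bdd : ∀ j k (m : ℕ), ∃ C : ℝ, ∀ x, ‖iteratedFDeriv ℝ m (b j k) x‖ ≤ C)
    (hc_bdd : ∀ j (m : ℕ), 1 ≤ m → ∃ C : ℝ, ∀ x, ‖iteratedFDeriv ℝ m (c j) x‖ ≤ C)
    (hp0_bdd : ∀ m : ℕ, 2 ≤ m → ∃ C : ℝ, ∀ x, ‖iteratedFDeriv ℝ m p0 x‖ ≤ C)
    (hp2_pos : ∀ (x ξ : Fin n → ℝ), 0 ≤ ∑ j, ∑ k, b j k x * ξ j * ξ k)
    (hp0_pos : ∀ x, 0 ≤ p0 x)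
    (z : ℂ) (hz : z.re < 0) :
    (∀ v : Lp ℂ 2 (volume : Measure (Fin n → ℝ)),
      ∃! q : Lp ℂ 2 (volume : Measure (Fin n → ℝ)) × Lp ℂ 2 (volume : Measure (Fin n → ℝ)),
        q ∈ closure (graphSet n h b c p0) ∧ q.2 - z • q.1 = v) ∧
    (∀ q ∈ closure (graphSet n h b c p0), ‖q.1‖ ≤ |z.re|⁻¹ * ‖q.2 - z • q.1‖) := by
  have H : Admissible b c p0 := admissible_of_bdd hb_smooth hc_smooth hp0_smooth hb_symm hb_bdd
    hc_bdd hp0_bdd hp2_pos hp0_pos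
  have hacc := re_inner_nonneg_of_mem_minGraph h H
  have hK : IsClosed (minGraph h b c p0 : Set (L2Space n × L2Space n)) :=
    Submodule.isClosed_topologicalClosure _
  obtain ⟨C, hC⟩ := dense_range_minGraph h H
  simp only [← mem_minGraph_iff h H]
  refine ⟨fun v => ?_, fun q hq => norm_fst_le_of_accretive (hacc q hq) hz⟩
  obtain ⟨q, hq, hqv⟩ := exists_mem_of_accretive hK hacc hC hz v
  refine ⟨q, ⟨hq, hqv⟩, fun q' hq' => ?_⟩
  have hd : (q' - q).2 - z • (q' - q).1 = 0 := by
    rw [Prod.snd_sub, Prod.fst_sub, smul_sub, sub_sub_sub_comm, hq'.2, hqv, sub_self]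
  have h1 := norm_fst_le_of_accretive (hacc _ (Submodule.sub_mem _ hq'.1 hq)) hz
  rw [hd, norm_zero, mul_zero, norm_le_zero_iff] at h1
  rw [h1, smul_zero, sub_zero] at hd
  exact sub_eq_zero.1 (Prod.ext h1 hd)
end
end

section
/- For every z ∈ Ω the Grushin operator 𝒫(z) : 𝒟(P) × ℂ^N → H × ℂ^N, (u, u_−) ↦ ((P − z)u + R_− u_−, R_+ u), is bijective, and whenever 𝒫(z)(u, u_−) = (v, v_+) one has ‖u‖ + |u_−| ≤ C(‖v‖ + |v_+|). -/
open scoped InnerProductSpace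

noncomputable section

/-- If `L` is bijective onto a Banach space and dominates `J`, then small multiples of `J`
do not destroy surjectivity. -/
theorem LinearMap.surjective_sub_smul_of_bijective {V Y : Type*} [AddCommGroup V] [Module ℂ V]
    [NormedAddCommGroup Y] [NormedSpace ℂ Y] [CompleteSpace Y] (L J : V →ₗ[ℂ] Y)
    (hL : Function.Bijective L) {K : ℝ} (hJ : ∀ q, ‖J q‖ ≤ K * ‖L q‖) {a : ℂ}
    (hK : 0 ≤ K) (ha : ‖a‖ * K < 1) : Function.Surjective (L - a • J) := by
  let e := LinearEquiv.ofBijective L hL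
  have hLe : ∀ y, L (e.symm y) = y := e.apply_symm_apply
  let T : Y →L[ℂ] Y := (J ∘ₗ e.symm.toLinearMap).mkContinuous K fun y => by
    simpa [hLe] using hJ (e.symm y)
  have hT : ‖a • T‖ < 1 := by
    rw [norm_smul]
    exact (mul_le_mul_of_nonneg_left (LinearMap.mkContinuous_norm_le _ hK _)
      (norm_nonneg a)).trans_lt ha
  obtain ⟨B, hB⟩ := (isUnit_one_sub_of_norm_lt_one hT).exists_right_inv
  intro y
  refine ⟨e.symm (B y), ?_⟩
  have := DFunLike.congr_fun hB y
  simpa [hLe, T] using this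

section Grushin

variable {H : Type*} [NormedAddCommGroup H] [InnerProductSpace ℂ H]
  {D : Submodule ℂ H} {E : Type*} [NormedAddCommGroup E] [NormedSpace ℂ E]

/-- The Grushin operator `(u, u₋) ↦ ((P - z) u + R₋ u₋, R₊ u)`. -/
def grushinMap (P : D →ₗ[ℂ] H) (Rm : E →L[ℂ] H) (Rp : H →L[ℂ] E) (z : ℂ) :
    D × E →ₗ[ℂ] H × E :=
  ((P - z • D.subtype).coprod Rm.toLinearMap).prod
    (Rp.toLinearMap ∘ₗ D.subtype ∘ₗ LinearMap.fst ℂ D E)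

@[simp]
theorem grushinMap_apply (P : D →ₗ[ℂ] H) (Rm : E →L[ℂ] H) (Rp : H →L[ℂ] E) (z : ℂ)
    (q : D × E) :
    grushinMap P Rm Rp z q = (P q.1 - z • (q.1 : H) + Rm q.2, Rp (q.1 : H)) := rfl

theorem grushinMap_eq_sub_smul (P : D →ₗ[ℂ] H) (Rm : E →L[ℂ] H) (Rp : H →L[ℂ] E) (z w : ℂ) :
    grushinMap P Rm Rp w = grushinMap P Rm Rp z -
      (w - z) • (LinearMap.inl ℂ H E ∘ₗ D.subtype ∘ₗ LinearMap.fst ℂ D E) := by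
  refine LinearMap.ext fun q => Prod.ext ?_ ?_
  · simp [sub_smul]
    abel
  · simp

/-- At a point where `P - z` is bijective, an injective Grushin operator with
finite-dimensional auxiliary space is surjective. -/
theorem grushinMap_surjective_of_bijective [FiniteDimensional ℂ E] (P : D →ₗ[ℂ] H)
    (Rm : E →L[ℂ] H) (Rp : H →L[ℂ] E) {z : ℂ}
    (hP : Function.Bijective (P - z • D.subtype))
    (hinj : Function.Injective (grushinMap P Rm Rp z)) :
    Function.Surjective (grushinMap P Rm Rp z) := by
  let e := LinearEquiv.ofBijective (P - z • D.subtype) hP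
  have he : ∀ v, P (e.symm v) - z • (e.symm v : H) = v := e.apply_symm_apply
  let F : E →ₗ[ℂ] E := Rp.toLinearMap ∘ₗ D.subtype ∘ₗ e.symm.toLinearMap ∘ₗ Rm.toLinearMap
  have hF : Function.Injective F := by
    refine (injective_iff_map_eq_zero F).2 fun x hx => ?_
    have hx' : Rp (e.symm (Rm x) : H) = 0 := hx
    have : grushinMap P Rm Rp z (-e.symm (Rm x), x) = grushinMap P Rm Rp z 0 := by
      rw [← map_neg]
      simp only [grushinMap_apply, he]
      simp [hx']
    exact congrArg Prod.snd (hinj this)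
  rintro ⟨v, vp⟩
  obtain ⟨x, hx⟩ := LinearMap.injective_iff_surjective.1 hF (Rp (e.symm v : H) - vp)
  have hx' : Rp (e.symm (Rm x) : H) = Rp (e.symm v : H) - vp := hx
  refine ⟨(e.symm (v - Rm x), x), ?_⟩
  simp only [grushinMap_apply, he]
  simp [hx']

theorem grushinMap_injective_of_estimate (P : D →ₗ[ℂ] H) (Rm : E →L[ℂ] H) (Rp : H →L[ℂ] E)
    {z : ℂ} {C : ℝ}
    (h : ∀ (u : D) (x : E),
      ‖(u : H)‖ + ‖x‖ ≤ C * (‖P u - z • (u : H) + Rm x‖ + ‖Rp (u : H)‖)) :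
    Function.Injective (grushinMap P Rm Rp z) := by
  refine (injective_iff_map_eq_zero _).2 fun ⟨u, x⟩ hq => ?_
  have h1 : P u - z • (u : H) + Rm x = 0 := congrArg Prod.fst hq
  have h2 : Rp (u : H) = 0 := congrArg Prod.snd hq
  have := h u x
  rw [h1, h2] at this
  simp only [norm_zero, add_zero, mul_zero] at this
  have hu : (u : H) = 0 := norm_le_zero_iff.1 (by linarith [norm_nonneg x])
  have hx : x = 0 := norm_le_zero_iff.1 (by linarith [norm_nonneg (u : H)])
  exact Prod.ext (Subtype.ext hu) hx

/-- Surjectivity of the Grushin operator propagates to distance `1 / (2C)`. -/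
theorem grushinMap_surjective_of_dist_lt [CompleteSpace H] [CompleteSpace E]
    (P : D →ₗ[ℂ] H) (Rm : E →L[ℂ] H) (Rp : H →L[ℂ] E) {z w : ℂ} {C : ℝ} (hC : 0 < C)
    (h : ∀ (u : D) (x : E),
      ‖(u : H)‖ + ‖x‖ ≤ C * (‖P u - z • (u : H) + Rm x‖ + ‖Rp (u : H)‖))
    (hz : Function.Surjective (grushinMap P Rm Rp z)) (hw : dist w z < (2 * C)⁻¹) :
    Function.Surjective (grushinMap P Rm Rp w) := by
  rw [grushinMap_eq_sub_smul P Rm Rp z w]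
  refine LinearMap.surjective_sub_smul_of_bijective _ _
    ⟨grushinMap_injective_of_estimate P Rm Rp h, hz⟩ (K := 2 * C) (fun q => ?_) (by positivity) ?_
  · have h1 := norm_fst_le (grushinMap P Rm Rp z q)
    have h2 := norm_snd_le (grushinMap P Rm Rp z q)
    have hJ : ‖(LinearMap.inl ℂ H E ∘ₗ D.subtype ∘ₗ LinearMap.fst ℂ D E) q‖ = ‖(q.1 : H)‖ := by
      simp [Prod.norm_def]
    rw [hJ]
    calc ‖(q.1 : H)‖ ≤ ‖(q.1 : H)‖ + ‖q.2‖ := le_add_of_nonneg_right (norm_nonneg _)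
      _ ≤ _ := h q.1 q.2
      _ ≤ C * (‖grushinMap P Rm Rp z q‖ + ‖grushinMap P Rm Rp z q‖) :=
        mul_le_mul_of_nonneg_left (add_le_add h1 h2) hC.le
      _ = _ := by ring
  · rw [← dist_eq_norm]
    rwa [← lt_div_iff₀ (by positivity), one_div]

end Grushin

/-- a Grushin problem.  Let `P` be a closed densely defined operator in a
complex Hilbert space `H` (with domain the submodule `D`, action `Pop`, and closed graph),
let `R₋ : ℂᴺ → H`, `R₊ : H → ℂᴺ` be bounded, and let `Ω` be an open connected set meeting
the resolvent set of `P`.  If the a priori estimate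
`‖u‖ + |u₋| ≤ C(‖(P − z)u + R₋u₋‖ + |R₊u|)` holds for all `z ∈ Ω`, then for every `z ∈ Ω`
the Grushin operator `𝒫(z)(u, u₋) = ((P − z)u + R₋u₋, R₊u)` is bijective, and the same
estimate holds for solutions. -/
theorem statement4 (H : Type*) [NormedAddCommGroup H] [InnerProductSpace ℂ H]
    [CompleteSpace H]
    (D : Submodule ℂ H) (Pop : D →ₗ[ℂ] H)
    (hdense : Dense (D : Set H))
    (hclosed : IsClosed {q : H × H | ∃ u : D, q.1 = (u : H) ∧ q.2 = Pop u})
    (N : ℕ)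
    (Rm : EuclideanSpace ℂ (Fin N) →L[ℂ] H) (Rp : H →L[ℂ] EuclideanSpace ℂ (Fin N))
    (Ω : Set ℂ) (hΩopen : IsOpen Ω) (hΩconn : IsConnected Ω)
    (hΩres : ∃ z ∈ Ω, Function.Bijective (fun u : D => Pop u - z • (u : H)) ∧
      ∃ M : ℝ, ∀ u : D, ‖(u : H)‖ ≤ M * ‖Pop u - z • (u : H)‖)
    (C : ℝ) (hC : 0 < C)
    (hapriori : ∀ z ∈ Ω, ∀ (u : D) (um : EuclideanSpace ℂ (Fin N)),
      ‖(u : H)‖ + ‖um‖ ≤ C * (‖Pop u - z • (u : H) + Rm um‖ + ‖Rp (u : H)‖)) :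
    ∀ z ∈ Ω,
      Function.Bijective
        (fun q : D × EuclideanSpace ℂ (Fin N) =>
          ((Pop q.1 - z • (q.1 : H) + Rm q.2, Rp (q.1 : H)) : H × EuclideanSpace ℂ (Fin N))) ∧
      ∀ (u : D) (um : EuclideanSpace ℂ (Fin N)) (v : H) (vp : EuclideanSpace ℂ (Fin N)),
        Pop u - z • (u : H) + Rm um = v → Rp (u : H) = vp →
        ‖(u : H)‖ + ‖um‖ ≤ C * (‖v‖ + ‖vp‖) := by
  have hsub : Ω ⊆ {z | z ∈ Ω ∧ Function.Surjective (grushinMap Pop Rm Rp z)} := by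
    have hr : 0 < (2 * C)⁻¹ := by positivity
    refine hΩconn.isPreconnected.subset_of_closure_inter_subset ?_ ?_ ?_
    · rw [Metric.isOpen_iff]
      rintro z ⟨hz, hs⟩
      obtain ⟨ε, hε, hball⟩ := Metric.isOpen_iff.1 hΩopen z hz
      refine ⟨min ε (2 * C)⁻¹, lt_min hε hr, fun w hw => ⟨?_, ?_⟩⟩
      · exact hball (Metric.ball_subset_ball (min_le_left _ _) hw)
      · exact grushinMap_surjective_of_dist_lt Pop Rm Rp hC (hapriori z hz) hs
          ((Metric.mem_ball.1 hw).trans_le (min_le_right _ _))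
    · obtain ⟨z, hz, hbij, -⟩ := hΩres
      exact ⟨z, hz, hz, grushinMap_surjective_of_bijective Pop Rm Rp hbij
        (grushinMap_injective_of_estimate Pop Rm Rp (hapriori z hz))⟩
    · rintro w ⟨hwcl, hw⟩
      obtain ⟨z, ⟨hz, hs⟩, hd⟩ := Metric.mem_closure_iff.1 hwcl _ hr
      exact ⟨hw, grushinMap_surjective_of_dist_lt Pop Rm Rp hC (hapriori z hz) hs hd⟩
  intro z hz
  refine ⟨⟨grushinMap_injective_of_estimate Pop Rm Rp (hapriori z hz), (hsub hz).2⟩, ?_⟩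
  rintro u um v vp rfl rfl
  exact hapriori z hz u um
end
end

section
/- Fix T_0 > 0. For every C > 0 there exist C̃ > 0 and h_0 > 0 such that for all h ∈ (0, h_0], all u ∈ 𝒮(ℝ^n) and all z ∈ ℂ with Re z ≤ C h: ‖(p_0 + h)^{1/2} u‖ ≤ C̃ ( ‖(p_0 + h)^{−1/2} (P − z) u‖ + h^{1/2} ‖u‖_{L²(Ω_h)} ), where Ω_h = { x ∈ ℝ^n : ⟨f_{C̃h} ∘ p_0⟩_{T_0}(x) ≤ C̃ h }. -/
open MeasureTheory Complex ComplexConjugate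

noncomputable section

/-- The time `T₀` average `⟨f_ε ∘ p₀⟩_{T₀}(x) = (1/T₀)∫_{−T₀/2}^{T₀/2} f_ε(p₀(Φ_t x)) dt`
along the flow `Φ` of the vector field `ν = Σ c_j ∂_{x_j}`, where `f_ε(t) = ε f(t/ε)`. -/
def favg (n : ℕ) (T0 : ℝ) (f : ℝ → ℝ) (p0 : (Fin n → ℝ) → ℝ)
    (Φ : ℝ → (Fin n → ℝ) → (Fin n → ℝ)) (ε : ℝ) (x : Fin n → ℝ) : ℝ :=
  (1 / T0) * ∫ t in (-(T0 / 2))..(T0 / 2), ε * f (p0 (Φ t x) / ε)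

/-- A smooth function whose derivatives of sufficiently high order are all bounded has temperate
growth. -/
theorem hasTemperateGrowth_of_bounded_iteratedFDeriv {E F : Type*}
    [NormedAddCommGroup E] [NormedSpace ℝ E] [NormedAddCommGroup F] [NormedSpace ℝ F]
    {g : E → F} (hg : ContDiff ℝ (⊤ : ℕ∞) g) {M : ℕ}
    (hM : ∀ m : ℕ, M ≤ m → ∃ C : ℝ, ∀ x, ‖iteratedFDeriv ℝ m g x‖ ≤ C) :
    Function.HasTemperateGrowth g := by
  refine ⟨hg, ?_⟩
  have step : ∀ m : ℕ,
      (∃ (k : ℕ) (C : ℝ), ∀ x, ‖iteratedFDeriv ℝ (m + 1) g x‖ ≤ C * (1 + ‖x‖) ^ k) →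
      ∃ (k : ℕ) (C : ℝ), ∀ x, ‖iteratedFDeriv ℝ m g x‖ ≤ C * (1 + ‖x‖) ^ k := by
    rintro m ⟨k, C, hC⟩
    refine ⟨k + 1, ‖iteratedFDeriv ℝ m g 0‖ + C, fun x => ?_⟩
    have hC0 : 0 ≤ C := by simpa using (norm_nonneg _).trans (hC 0)
    have hd : ∀ y ∈ Metric.closedBall (0 : E) ‖x‖,
        DifferentiableAt ℝ (iteratedFDeriv ℝ m g) y := fun y _ =>
      (hg.differentiable_iteratedFDeriv (by exact_mod_cast ENat.natCast_lt_top m)) y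
    have hb : ∀ y ∈ Metric.closedBall (0 : E) ‖x‖,
        ‖fderiv ℝ (iteratedFDeriv ℝ m g) y‖ ≤ C * (1 + ‖x‖) ^ k := fun y hy => by
      rw [norm_fderiv_iteratedFDeriv]
      refine (hC y).trans ?_
      have : ‖y‖ ≤ ‖x‖ := by simpa using hy
      gcongr
    have := (convex_closedBall (0 : E) ‖x‖).norm_image_sub_le_of_norm_fderiv_le hd hb
      (x := 0) (y := x) (by simp) (by simp)
    have h1 : 1 ≤ (1 + ‖x‖) ^ (k + 1) := one_le_pow₀ (by linarith [norm_nonneg x])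
    calc ‖iteratedFDeriv ℝ m g x‖
        ≤ ‖iteratedFDeriv ℝ m g 0‖ + ‖iteratedFDeriv ℝ m g x - iteratedFDeriv ℝ m g 0‖ :=
          norm_le_insert' _ _
      _ ≤ ‖iteratedFDeriv ℝ m g 0‖ + C * (1 + ‖x‖) ^ k * ‖x - 0‖ := by gcongr
      _ ≤ ‖iteratedFDeriv ℝ m g 0‖ * (1 + ‖x‖) ^ (k + 1) + C * (1 + ‖x‖) ^ k * (1 + ‖x‖) := by
          gcongr
          · exact le_mul_of_one_le_right (norm_nonneg _) h1
          · simp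
      _ = _ := by ring
  have key : ∀ d m : ℕ, M ≤ m + d →
      ∃ (k : ℕ) (C : ℝ), ∀ x, ‖iteratedFDeriv ℝ m g x‖ ≤ C * (1 + ‖x‖) ^ k := by
    intro d
    induction d with
    | zero =>
      intro m hm
      obtain ⟨C, hC⟩ := hM m (by simpa using hm)
      exact ⟨0, C, by simpa using hC⟩
    | succ d ih => exact fun m hm => step m (ih (m + 1) (by omega))
  exact fun m => key M m (by omega)

/-- The square root of a nonnegative function with bounded Hessian is Lipschitz. -/
theorem abs_sqrt_sub_sqrt_le {E : Type*} [NormedAddCommGroup E] [NormedSpace ℝ E]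
    {p : E → ℝ} (hp : ContDiff ℝ 2 p) (hp0 : ∀ x, 0 ≤ p x) {M : ℝ}
    (hM : ∀ x, ‖iteratedFDeriv ℝ 2 p x‖ ≤ M) (x y : E) :
    |√(p x) - √(p y)| ≤ √M * ‖x - y‖ := by
  have hM0 : 0 ≤ M := (norm_nonneg _).trans (hM 0)
  have hd : Differentiable ℝ p := hp.differentiable (by norm_num)
  have hd1 : Differentiable ℝ (fderiv ℝ p) :=
    (hp.fderiv_right (m := 1) (by norm_num)).differentiable (by norm_num)
  have hlip : ∀ y z, ‖fderiv ℝ p y - fderiv ℝ p z‖ ≤ M * ‖y - z‖ := fun y z =>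
    convex_univ.norm_image_sub_le_of_norm_fderiv_le (fun w _ => hd1 w)
      (fun w _ => by
        have : ‖iteratedFDeriv ℝ 1 (fderiv ℝ p) w‖ = ‖iteratedFDeriv ℝ 2 p w‖ :=
          norm_iteratedFDeriv_fderiv
        rw [← norm_iteratedFDeriv_one, this]
        exact hM w) trivial trivial
  have taylor : ∀ z v, |p (z + v) - p z - fderiv ℝ p z v| ≤ M * ‖v‖ * ‖v‖ := fun z v => by
    have := (convex_closedBall z ‖v‖).norm_image_sub_le_of_norm_fderiv_le' (𝕜 := ℝ) (f := p)
      (φ := fderiv ℝ p z) (C := M * ‖v‖) (fun w _ => hd w)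
      (fun w hw => (hlip w z).trans (by
        have : ‖w - z‖ ≤ ‖v‖ := by simpa [dist_eq_norm] using hw
        gcongr)) (x := z) (y := z + v) (by simp) (by simp)
    simpa using this
  have grad : ∀ z, ‖fderiv ℝ p z‖ ≤ 2 * √M * √(p z) := fun z => by
    refine ContinuousLinearMap.opNorm_le_bound _ (by positivity) fun v => ?_
    have hdis : ∀ t : ℝ, 0 ≤ M * ‖v‖ ^ 2 * (t * t) + fderiv ℝ p z v * t + p z := fun t => by
      have h1 := (abs_le.1 (taylor z (t • v))).2
      have h2 := hp0 (z + t • v)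
      simp only [map_smul, norm_smul, Real.norm_eq_abs, smul_eq_mul] at h1
      have h3 : |t| * |t| = t * t := abs_mul_abs_self t
      have h4 : M * (|t| * ‖v‖) * (|t| * ‖v‖) = M * ‖v‖ ^ 2 * (t * t) := by rw [← h3]; ring
      linarith
    have := discrim_le_zero hdis
    rw [discrim] at this
    rw [Real.norm_eq_abs]
    refine abs_le_of_sq_le_sq ?_ (by positivity)
    have e1 := Real.sq_sqrt hM0
    have e2 := Real.sq_sqrt (hp0 z)
    calc (fderiv ℝ p z v) ^ 2 ≤ 4 * (M * ‖v‖ ^ 2) * p z := by linarith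
      _ = _ := by rw [mul_pow, mul_pow, mul_pow, e1, e2]; ring
  have reg : ∀ η : ℝ, 0 < η → |√(p x + η) - √(p y + η)| ≤ √M * ‖x - y‖ := fun η hη => by
    have hpos : ∀ z, 0 < p z + η := fun z => by linarith [hp0 z]
    refine convex_univ.norm_image_sub_le_of_norm_hasFDerivWithin_le (𝕜 := ℝ)
      (f := fun z => √(p z + η)) (fun z _ =>
        (((hd z).hasFDerivAt.add_const η).sqrt (hpos z).ne').hasFDerivWithinAt)
      (fun z _ => ?_) trivial trivial
    rw [norm_smul, Real.norm_of_nonneg (by positivity), one_div, inv_mul_le_iff₀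
      (by have := Real.sqrt_pos.2 (hpos z); positivity)]
    refine (grad z).trans ?_
    have : √(p z) ≤ √(p z + η) := Real.sqrt_le_sqrt (by linarith)
    nlinarith [Real.sqrt_nonneg M]
  have hlim : Filter.Tendsto (fun η : ℝ => |√(p x + η) - √(p y + η)|) (nhdsWithin 0 (Set.Ioi 0))
      (nhds |√(p x) - √(p y)|) := by
    have : Continuous (fun η : ℝ => |√(p x + η) - √(p y + η)|) := by fun_prop
    simpa using (this.tendsto 0).mono_left nhdsWithin_le_nhds
  exact le_of_tendsto hlim (Filter.eventually_of_mem self_mem_nhdsWithin reg)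

/-- A `C¹` function on the half-line that is eventually constant becomes Lipschitz after
composition with the square. -/
theorem exists_lipschitz_comp_sq {f : ℝ → ℝ} (hf : ContDiffOn ℝ 1 f (Set.Ici 0)) {a : ℝ}
    (hconst : ∀ t, 2 ≤ t → f t = a) :
    ∃ L : ℝ, 0 ≤ L ∧ ∀ s t : ℝ, 0 ≤ s → 0 ≤ t → |f (s ^ 2) - f (t ^ 2)| ≤ L * |s - t| := by
  have hf2 : ContDiffOn ℝ 1 f (Set.Icc 0 2) := hf.mono Set.Icc_subset_Ici_self
  obtain ⟨K, hK⟩ := hf2.exists_lipschitzOnWith one_ne_zero (convex_Icc 0 2) isCompact_Icc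
  have hmin : ∀ s : ℝ, 0 ≤ s → f (s ^ 2) = f ((min s √2) ^ 2) := fun s hs => by
    rcases le_total s √2 with h | h
    · rw [min_eq_left h]
    · rw [min_eq_right h, Real.sq_sqrt (by norm_num), hconst _ le_rfl, hconst]
      rw [← Real.sq_sqrt (zero_le_two (α := ℝ))]
      gcongr
  have hmem : ∀ s : ℝ, 0 ≤ s → (min s √2) ^ 2 ∈ Set.Icc (0 : ℝ) 2 := fun s hs =>
    ⟨sq_nonneg _, by
      rw [← Real.sq_sqrt (zero_le_two (α := ℝ))]
      gcongr
      simp⟩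
  refine ⟨K * (2 * √2), by positivity, fun s t hs ht => ?_⟩
  rw [hmin s hs, hmin t ht]
  have h1 := hK.dist_le_mul _ (hmem s hs) _ (hmem t ht)
  rw [Real.dist_eq, Real.dist_eq] at h1
  refine h1.trans ?_
  rw [mul_assoc]
  gcongr
  rw [sq_sub_sq, abs_mul]
  have h2 : |min s √2 + min t √2| ≤ 2 * √2 := by
    rw [abs_of_nonneg (by positivity)]
    linarith [min_le_right s √2, min_le_right t √2]
  have h3 : |min s √2 - min t √2| ≤ |s - t| := by
    simpa using abs_min_sub_min_le_max s √2 t √2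
  gcongr

/-- Grönwall: the flow of a Lipschitz vector field is Lipschitz in space. -/
theorem dist_flow_le {E : Type*} [NormedAddCommGroup E] [NormedSpace ℝ E] {v : E → E}
    {K : NNReal} (hv : LipschitzWith K v) {Φ : ℝ → E → E} (hΦ0 : ∀ x, Φ 0 x = x)
    (hΦ : ∀ t x, HasDerivAt (fun s => Φ s x) (v (Φ t x)) t) (t : ℝ) (x y : E) :
    dist (Φ t x) (Φ t y) ≤ Real.exp (K * |t|) * dist x y := by
  have forward : ∀ {w : E → E}, LipschitzWith K w → ∀ Ψ : ℝ → E → E, (∀ x, Ψ 0 x = x) →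
      (∀ t x, HasDerivAt (fun s => Ψ s x) (w (Ψ t x)) t) → ∀ t, 0 ≤ t →
      dist (Ψ t x) (Ψ t y) ≤ Real.exp (K * t) * dist x y := by
    intro w hw Ψ hΨ0 hΨ t ht
    have := dist_le_of_trajectories_ODE (v := fun _ => w) (K := K) (a := 0) (b := t)
      (f := fun s => Ψ s x) (g := fun s => Ψ s y) (δ := dist x y) (fun _ => hw)
      (fun s _ => (hΨ s x).continuousAt.continuousWithinAt)
      (fun s _ => (hΨ s x).hasDerivWithinAt)
      (fun s _ => (hΨ s y).continuousAt.continuousWithinAt)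
      (fun s _ => (hΨ s y).hasDerivWithinAt) (by simp [hΨ0]) t ⟨ht, le_rfl⟩
    simpa [mul_comm] using this
  rcases le_total 0 t with ht | ht
  · simpa [abs_of_nonneg ht] using forward hv Φ hΦ0 hΦ t ht
  · have := forward (w := fun x => -v x) hv.neg (fun s => Φ (-s)) (by simpa using hΦ0)
      (fun s x => by simpa [Function.comp_def] using (hΦ (-s) x).scomp s (hasDerivAt_neg s))
      (-t) (by linarith)
    simpa [abs_of_nonpos ht] using this

/-- The group law for the flow of a Lipschitz vector field. -/
theorem flow_add {E : Type*} [NormedAddCommGroup E] [NormedSpace ℝ E] {v : E → E}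
    {K : NNReal} (hv : LipschitzWith K v) {Φ : ℝ → E → E} (hΦ0 : ∀ x, Φ 0 x = x)
    (hΦ : ∀ t x, HasDerivAt (fun s => Φ s x) (v (Φ t x)) t) (t s : ℝ) (x : E) :
    Φ t (Φ s x) = Φ (t + s) x := by
  have := ODE_solution_unique_univ (v := fun _ => v) (s := fun _ => Set.univ) (K := K) (t₀ := 0)
    (f := fun r => Φ r (Φ s x)) (g := fun r => Φ (r + s) x) (fun _ => hv.lipschitzOnWith)
    (fun r => ⟨hΦ r _, trivial⟩) (fun r => ⟨(hΦ (r + s) x).comp_add_const r s, trivial⟩)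
    (by simp [hΦ0])
  exact congrFun this t

theorem abs_intervalIntegral_sub_le {g₁ g₂ : ℝ → ℝ} (h₁ : Continuous g₁) (h₂ : Continuous g₂)
    {a b C : ℝ} (h : ∀ t ∈ Set.uIoc a b, |g₁ t - g₂ t| ≤ C) :
    |(∫ t in a..b, g₁ t) - ∫ t in a..b, g₂ t| ≤ C * |b - a| := by
  rw [← intervalIntegral.integral_sub (h₁.intervalIntegrable _ _) (h₂.intervalIntegrable _ _)]
  simpa only [Real.norm_eq_abs] using
    intervalIntegral.norm_integral_le_of_norm_le_const (f := fun t => g₁ t - g₂ t)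
      (by simpa using h)

/-- The weight `φ` solving `ν φ = G - ⟨G⟩_T`, where `⟨G⟩_T` is the average of `G` along the flow
over a time interval of length `T`. -/
def flowWeight {E : Type*} (T : ℝ) (Φ : ℝ → E → E) (G : E → ℝ) (x : E) : ℝ :=
  -((1 / T) * ∫ t in (-(T / 2))..(T / 2), ∫ τ in (0 : ℝ)..t, G (Φ τ x))

theorem continuous_comp_flow {E : Type*} [NormedAddCommGroup E] [NormedSpace ℝ E] {v : E → E}
    {Φ : ℝ → E → E} (hΦ : ∀ t x, HasDerivAt (fun s => Φ s x) (v (Φ t x)) t)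
    {G : E → ℝ} (hG : Continuous G) (x : E) : Continuous (fun t => G (Φ t x)) :=
  hG.comp (continuous_iff_continuousAt.2 fun t => (hΦ t x).continuousAt)

theorem continuous_primitive_comp_flow {E : Type*} [NormedAddCommGroup E] [NormedSpace ℝ E]
    {v : E → E} {Φ : ℝ → E → E} (hΦ : ∀ t x, HasDerivAt (fun s => Φ s x) (v (Φ t x)) t)
    {G : E → ℝ} (hG : Continuous G) (x : E) :
    Continuous (fun t => ∫ τ in (0 : ℝ)..t, G (Φ τ x)) :=
  intervalIntegral.continuous_primitive
    (fun _ _ => (continuous_comp_flow hΦ hG x).intervalIntegrable _ _) 0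

theorem mem_uIoc_half {T t : ℝ} (hT : 0 < T) (ht : t ∈ Set.uIoc (-(T / 2)) (T / 2)) :
    |t| ≤ T / 2 := by
  rw [Set.uIoc_of_le (by linarith)] at ht
  exact abs_le.2 ⟨ht.1.le, ht.2⟩

theorem abs_flowWeight_le {E : Type*} {T : ℝ} (hT : 0 < T) (Φ : ℝ → E → E) {G : E → ℝ} {m : ℝ}
    (hm : 0 ≤ m) (hG : ∀ x, |G x| ≤ m) (x : E) : |flowWeight T Φ G x| ≤ T * m := by
  have inner : ∀ t, |∫ τ in (0 : ℝ)..t, G (Φ τ x)| ≤ m * |t - 0| := fun t => by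
    simpa only [Real.norm_eq_abs] using intervalIntegral.norm_integral_le_of_norm_le_const
      (f := fun τ => G (Φ τ x)) fun τ _ => hG (Φ τ x)
  have outer : |∫ t in (-(T / 2))..(T / 2), ∫ τ in (0 : ℝ)..t, G (Φ τ x)|
      ≤ (m * T) * |T / 2 - -(T / 2)| := by
    simpa only [Real.norm_eq_abs] using intervalIntegral.norm_integral_le_of_norm_le_const
      (f := fun t => ∫ τ in (0 : ℝ)..t, G (Φ τ x)) fun t ht => (inner t).trans (by
      have := mem_uIoc_half hT ht
      rw [sub_zero]
      gcongr
      linarith)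
  rw [show T / 2 - -(T / 2) = T by ring, abs_of_pos hT] at outer
  rw [flowWeight, abs_neg, abs_mul, abs_of_pos (by positivity), one_div, inv_mul_le_iff₀ hT]
  linarith

theorem abs_flowWeight_sub_le {E : Type*} [NormedAddCommGroup E] [NormedSpace ℝ E] {v : E → E}
    {K : NNReal} (hv : LipschitzWith K v) {Φ : ℝ → E → E} (hΦ0 : ∀ x, Φ 0 x = x)
    (hΦ : ∀ t x, HasDerivAt (fun s => Φ s x) (v (Φ t x)) t) {T : ℝ} (hT : 0 < T)
    {G : E → ℝ} (hGc : Continuous G) {L : ℝ} (hL : 0 ≤ L)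
    (hG : ∀ x y, |G x - G y| ≤ L * dist x y) (x y : E) :
    |flowWeight T Φ G x - flowWeight T Φ G y| ≤ T * L * Real.exp (K * T) * dist x y := by
  have pt : ∀ τ, |τ| ≤ T → |G (Φ τ x) - G (Φ τ y)| ≤ L * (Real.exp (K * T) * dist x y) :=
    fun τ hτ => (hG _ _).trans (by
      gcongr
      exact (dist_flow_le hv hΦ0 hΦ τ x y).trans (by gcongr))
  have inner : ∀ t ∈ Set.uIoc (-(T / 2)) (T / 2),
      |(∫ τ in (0 : ℝ)..t, G (Φ τ x)) - ∫ τ in (0 : ℝ)..t, G (Φ τ y)|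
        ≤ L * (Real.exp (K * T) * dist x y) * T := fun t ht => by
    have htT := mem_uIoc_half hT ht
    refine (abs_intervalIntegral_sub_le (continuous_comp_flow hΦ hGc x)
      (continuous_comp_flow hΦ hGc y) fun τ hτ => pt τ ?_).trans ?_
    · have := Set.abs_sub_left_of_mem_uIcc (Set.uIoc_subset_uIcc hτ)
      rw [sub_zero, sub_zero] at this
      linarith
    · rw [sub_zero]
      gcongr
      linarith
  have outer := abs_intervalIntegral_sub_le (continuous_primitive_comp_flow hΦ hGc x)
    (continuous_primitive_comp_flow hΦ hGc y) inner
  rw [show T / 2 - -(T / 2) = T by ring, abs_of_pos hT] at outer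
  rw [flowWeight, flowWeight, neg_sub_neg, ← mul_sub, abs_mul, abs_of_pos (by positivity),
    one_div, inv_mul_le_iff₀ hT, abs_sub_comm]
  linarith

/-- The averages of a Lipschitz function along the flow depend continuously on the point. -/
theorem continuous_flowAverage {E : Type*} [NormedAddCommGroup E] [NormedSpace ℝ E] {v : E → E}
    {K : NNReal} (hv : LipschitzWith K v) {Φ : ℝ → E → E} (hΦ0 : ∀ x, Φ 0 x = x)
    (hΦ : ∀ t x, HasDerivAt (fun s => Φ s x) (v (Φ t x)) t) {T : ℝ} (hT : 0 < T)
    {G : E → ℝ} (hGc : Continuous G) {L : ℝ} (hL : 0 ≤ L)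
    (hG : ∀ x y, |G x - G y| ≤ L * dist x y) :
    Continuous (fun x => (1 / T) * ∫ t in (-(T / 2))..(T / 2), G (Φ t x)) := by
  refine continuous_const.mul (LipschitzWith.of_dist_le_mul
    (K := Real.toNNReal (L * Real.exp (K * T) * T)) fun x y => ?_).continuous
  rw [Real.coe_toNNReal _ (by positivity), Real.dist_eq]
  refine (abs_intervalIntegral_sub_le (continuous_comp_flow hΦ hGc x)
      (continuous_comp_flow hΦ hGc y) (C := L * (Real.exp (K * T) * dist x y))
      fun τ hτ => (hG _ _).trans ?_).trans (le_of_eq ?_)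
  · have := mem_uIoc_half hT hτ
    gcongr
    exact (dist_flow_le hv hΦ0 hΦ τ x y).trans (by gcongr; linarith)
  · rw [show T / 2 - -(T / 2) = T by ring, abs_of_pos hT]
    ring

/-- `ν φ = G - ⟨G⟩_T` for the weight `φ = flowWeight T Φ G`. -/
theorem hasDerivAt_flowWeight_comp_flow {E : Type*} [NormedAddCommGroup E] [NormedSpace ℝ E]
    {v : E → E} {K : NNReal} (hv : LipschitzWith K v) {Φ : ℝ → E → E} (hΦ0 : ∀ x, Φ 0 x = x)
    (hΦ : ∀ t x, HasDerivAt (fun s => Φ s x) (v (Φ t x)) t) {T : ℝ} (hT : 0 < T)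
    {G : E → ℝ} (hGc : Continuous G) (x : E) :
    HasDerivAt (fun s => flowWeight T Φ G (Φ s x))
      (G x - (1 / T) * ∫ t in (-(T / 2))..(T / 2), G (Φ t x)) 0 := by
  have hg := continuous_comp_flow hΦ hGc x
  set g : ℝ → ℝ := fun t => G (Φ t x) with hgdef
  set a : ℝ → ℝ := fun r => ∫ τ in (0 : ℝ)..r, g τ with hadef
  have ha : ∀ r, HasDerivAt a (g r) r := fun r => hg.integral_hasStrictDerivAt 0 r |>.hasDerivAt
  have hac : Continuous a := continuous_iff_continuousAt.2 fun r => (ha r).continuousAt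
  set A : ℝ → ℝ := fun r => ∫ τ in (0 : ℝ)..r, a τ with hAdef
  have hA : ∀ r, HasDerivAt A (a r) r := fun r => hac.integral_hasStrictDerivAt 0 r |>.hasDerivAt
  have hint : ∀ b c, ∫ t in b..c, a t = A c - A b := fun b c =>
    (intervalIntegral.integral_interval_sub_left (hac.intervalIntegrable _ _)
      (hac.intervalIntegrable _ _)).symm
  have hformula : (fun s => flowWeight T Φ G (Φ s x))
      = fun s => a s - (1 / T) * (A (T / 2 + s) - A (-(T / 2) + s)) := by
    funext s
    have h1 : ∀ t, ∫ τ in (0 : ℝ)..t, G (Φ τ (Φ s x)) = a (t + s) - a s := fun t => by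
      simp_rw [flow_add hv hΦ0 hΦ]
      rw [intervalIntegral.integral_comp_add_right (fun τ => g τ) s, zero_add]
      exact (intervalIntegral.integral_interval_sub_left (hg.intervalIntegrable _ _)
        (hg.intervalIntegrable _ _)).symm
    rw [flowWeight]
    simp_rw [h1]
    have hshift : Continuous fun t => a (t + s) := by fun_prop
    rw [intervalIntegral.integral_sub (hshift.intervalIntegrable _ _)
      (by simp), intervalIntegral.integral_comp_add_right a s, hint,
      intervalIntegral.integral_const, smul_eq_mul]
    field_simp
    ring
  rw [hformula]
  have h2 : HasDerivAt (fun s => A (T / 2 + s)) (a (T / 2)) 0 := by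
    simpa using (hA (T / 2 + 0)).comp_const_add (T / 2) 0
  have h3 : HasDerivAt (fun s => A (-(T / 2) + s)) (a (-(T / 2))) 0 := by
    simpa using (hA (-(T / 2) + 0)).comp_const_add (-(T / 2)) 0
  have h4 : ∫ t in (-(T / 2))..(T / 2), G (Φ t x) = a (T / 2) - a (-(T / 2)) :=
    (intervalIntegral.integral_interval_sub_left (hg.intervalIntegrable _ _)
      (hg.intervalIntegrable _ _)).symm
  rw [h4]
  have h5 : g 0 = G x := by simp [hgdef, hΦ0]
  rw [← h5]
  exact (ha 0).sub ((h2.sub h3).const_mul _)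

open scoped SchwartzMap LineDeriv in
/-- Integration by parts of a Schwartz function against a bounded Lipschitz weight. -/
theorem integral_lipschitz_mul_schwartz {E : Type*} [NormedAddCommGroup E] [NormedSpace ℝ E]
    [FiniteDimensional ℝ E] [MeasurableSpace E] [BorelSpace E] {μ : Measure E} [μ.IsAddHaarMeasure]
    {w : E → ℝ} {C : NNReal} (hw : LipschitzWith C w) {B : ℝ} (hB : ∀ x, |w x| ≤ B)
    (V : 𝓢(E, ℝ)) (e : E) :
    Integrable (fun x => w x * fderiv ℝ V x e + lineDeriv ℝ w x e * V x) μ ∧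
      ∫ x, (w x * fderiv ℝ V x e + lineDeriv ℝ w x e * V x) ∂μ = 0 := by
  have hVi : Integrable V μ := V.integrable
  have hdVi : Integrable (fun x => fderiv ℝ V x e) μ := by
    have h := (∂_{e} V).integrable (μ := μ)
    refine h.congr (Filter.Eventually.of_forall fun x => ?_)
    exact V.lineDerivOp_apply_eq_fderiv e x
  have hB0 : 0 ≤ B := (abs_nonneg _).trans (hB 0)
  have i1 : Integrable (fun x => w x * fderiv ℝ V x e) μ :=
    hdVi.bdd_mul hw.continuous.aestronglyMeasurable (Filter.Eventually.of_forall hB)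
  have hwd : ∀ x, ‖lineDeriv ℝ w x e‖ ≤ C * ‖e‖ := fun x => norm_lineDeriv_le_of_lipschitz ℝ hw
  have i2 : Integrable (fun x => lineDeriv ℝ w x e * V x) μ :=
    hVi.bdd_mul (aestronglyMeasurable_lineDeriv hw.continuous μ)
      (Filter.Eventually.of_forall hwd)
  have hi := i1.add i2
  refine ⟨hi, ?_⟩
  let χ : ContDiffBump (0 : E) := ⟨1, 2, one_pos, one_lt_two⟩
  have hχ : ContDiff ℝ 1 χ := χ.contDiff
  obtain ⟨D, hD⟩ : ∃ D, ∀ x, ‖fderiv ℝ χ x‖ ≤ D :=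
    (hχ.continuous_fderiv one_ne_zero).bounded_above_of_compact_support
      (χ.hasCompactSupport.fderiv ℝ)
  have hD0 : 0 ≤ D := (norm_nonneg _).trans (hD 0)
  let r : ℕ → ℝ := fun m => 1 / ((m : ℝ) + 1)
  have hr : ∀ m, 0 < r m := fun m => Nat.one_div_pos_of_nat
  have hr1 : ∀ m, r m ≤ 1 := fun m => by
    simpa [r] using Nat.one_div_le_one_div (α := ℝ) (Nat.zero_le m)
  have hrl : Filter.Tendsto r Filter.atTop (nhds 0) := tendsto_one_div_add_atTop_nhds_zero_nat
  have hχd : ∀ m x, HasFDerivAt (fun y : E => χ (r m • y)) (r m • fderiv ℝ χ (r m • x)) x :=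
    fun m x => by
      have h1 : HasFDerivAt χ (fderiv ℝ χ (r m • x)) (r m • x) :=
        (hχ.differentiable one_ne_zero _).hasFDerivAt
      have h2 : HasFDerivAt (fun y : E => r m • y) (r m • ContinuousLinearMap.id ℝ E) x :=
        (hasFDerivAt_id x).const_smul (r m)
      exact (h1.comp x h2).congr_fderiv (by ext v; simp)
  let Q : E → ℝ := fun x => w x * fderiv ℝ V x e + lineDeriv ℝ w x e * V x
  let R : ℕ → E → ℝ := fun m x => w x * (r m * fderiv ℝ χ (r m • x) e * V x)
  have hzero : ∀ m, ∫ x, (χ (r m • x) * Q x + R m x) ∂μ = 0 := fun m => by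
    let g : E → ℝ := fun x => χ (r m • x) * V x
    have hgc : HasCompactSupport g := by
      have : HasCompactSupport (fun x : E => χ (r m • x)) :=
        χ.hasCompactSupport.comp_smul (hr m).ne'
      exact this.mul_right
    have hgd : ContDiff ℝ 1 g :=
      (hχ.comp (contDiff_const_smul (r m))).mul (V.smooth 1)
    obtain ⟨K, hK⟩ := hgd.lipschitzWith_of_hasCompactSupport hgc one_ne_zero
    have hgder : ∀ x, lineDeriv ℝ g x (-e)
        = -(r m * fderiv ℝ χ (r m • x) e * V x + χ (r m • x) * fderiv ℝ V x e) := fun x => by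
      have h1 := (hχd m x).mul (V.hasFDerivAt x)
      have h2 := h1.hasLineDerivAt (-e)
      rw [show g = (fun y : E => χ (r m • y)) * ⇑V from rfl, h2.lineDeriv]
      simp
      ring
    have key := hw.integral_lineDeriv_mul_eq (μ := μ) hK hgc e
    have hχb : ∀ x, ‖χ (r m • x)‖ ≤ 1 := fun x => by
      rw [Real.norm_of_nonneg χ.nonneg]; exact χ.le_one
    have hχm : AEStronglyMeasurable (fun x => χ (r m • x)) μ :=
      (hχ.continuous.comp (continuous_const_smul (r m))).aestronglyMeasurable
    have j1 : Integrable (fun x => lineDeriv ℝ w x e * g x) μ :=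
      (i2.bdd_mul hχm (Filter.Eventually.of_forall hχb)).congr
        (Filter.Eventually.of_forall fun x => by simp only [g]; ring)
    have j2 : Integrable (fun x => lineDeriv ℝ g x (-e) * w x) μ := by
      have hgi : Integrable (fun x => lineDeriv ℝ g x (-e)) μ := by
        have hcont : Continuous fun x => fderiv ℝ g x (-e) :=
          (hgd.continuous_fderiv one_ne_zero).clm_apply continuous_const
        have := hcont.integrable_of_hasCompactSupport (μ := μ) (hgc.fderiv_apply ℝ (-e))
        refine this.congr (Filter.Eventually.of_forall fun x => ?_)
        exact ((hgd.differentiable one_ne_zero x).lineDeriv_eq_fderiv).symm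
      exact hgi.mul_bdd hw.continuous.aestronglyMeasurable (Filter.Eventually.of_forall hB)
    rw [← sub_eq_zero, ← integral_sub j1 j2] at key
    rw [← key]
    refine integral_congr_ae (Filter.Eventually.of_forall fun x => ?_)
    simp only [hgder, g, Q, R]
    ring
  have hlim : Filter.Tendsto (fun m => ∫ x, (χ (r m • x) * Q x + R m x) ∂μ) Filter.atTop
      (nhds (∫ x, Q x ∂μ)) := by
    refine tendsto_integral_of_dominated_convergence
      (fun x => ‖Q x‖ + B * (D * ‖e‖ * ‖V x‖)) (fun m => ?_)
      (hi.norm.add ((hVi.norm.const_mul _).const_mul _)) (fun m => ?_) ?_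
    · refine ((hχ.continuous.comp (continuous_const_smul (r m))).aestronglyMeasurable.mul
        hi.aestronglyMeasurable).add (Continuous.aestronglyMeasurable ?_)
      exact hw.continuous.mul ((continuous_const.mul
        (((hχ.continuous_fderiv one_ne_zero).comp (continuous_const_smul (r m))).clm_apply
          continuous_const)).mul V.continuous)
    · refine Filter.Eventually.of_forall fun x => (norm_add_le _ _).trans ?_
      gcongr
      · rw [norm_mul, Real.norm_of_nonneg χ.nonneg]
        exact mul_le_of_le_one_left (norm_nonneg _) χ.le_one
      · simp only [R, norm_mul]
        rw [Real.norm_of_nonneg (hr m).le]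
        have := hr m
        refine mul_le_mul (hB x) (mul_le_mul_of_nonneg_right ?_ (norm_nonneg _))
          (by positivity) hB0
        calc r m * ‖fderiv ℝ χ (r m • x) e‖ ≤ 1 * ‖fderiv ℝ χ (r m • x) e‖ := by
              gcongr; exact hr1 m
          _ ≤ D * ‖e‖ := by
              rw [one_mul]; exact (fderiv ℝ χ _).le_of_opNorm_le (hD _) e
    · refine Filter.Eventually.of_forall fun x => ?_
      have h1 : Filter.Tendsto (fun m => χ (r m • x)) Filter.atTop (nhds 1) := by
        have : Filter.Tendsto (fun m => r m • x) Filter.atTop (nhds 0) := by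
          simpa using hrl.smul_const x
        have h := (hχ.continuous.tendsto 0).comp this
        rwa [χ.one_of_mem_closedBall (by simp [χ])] at h
      have h2 : Filter.Tendsto (fun m => R m x) Filter.atTop (nhds 0) := by
        have hb : ∀ m, ‖R m x‖ ≤ r m * (B * (D * ‖e‖ * ‖V x‖)) := fun m => by
          simp only [R, norm_mul]
          rw [Real.norm_of_nonneg (hr m).le]
          calc ‖w x‖ * (r m * ‖fderiv ℝ χ (r m • x) e‖ * ‖V x‖)
              ≤ B * (r m * (D * ‖e‖) * ‖V x‖) := by
                have := hr m
                gcongr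
                · exact hB x
                · exact (fderiv ℝ χ _).le_of_opNorm_le (hD _) e
            _ = _ := by ring
        refine squeeze_zero_norm hb ?_
        simpa using hrl.mul_const (B * (D * ‖e‖ * ‖V x‖))
      simpa using (h1.mul_const (Q x)).add h2
  simp only [hzero] at hlim
  exact (tendsto_nhds_unique hlim tendsto_const_nhds)

theorem real_inner_mul_self (z U : ℂ) : inner ℝ U (z * U) = z.re * ‖U‖ ^ 2 := by
  rw [Complex.inner, ← Complex.normSq_eq_norm_sq, Complex.normSq_apply]
  simp
  ring

/-- A nonnegative symmetric real quadratic form is nonnegative on complex vectors. -/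
theorem sum_inner_nonneg {ι : Type*} [Fintype ι] {b : ι → ι → ℝ}
    (hb : ∀ ξ : ι → ℝ, 0 ≤ ∑ j, ∑ k, b j k * ξ j * ξ k) (ζ : ι → ℂ) :
    0 ≤ ∑ j, ∑ k, b j k * inner ℝ (ζ j) (ζ k) := by
  have h := add_nonneg (hb fun j => (ζ j).re) (hb fun j => (ζ j).im)
  simp only [← Finset.sum_add_distrib] at h
  refine h.trans_eq (Finset.sum_congr rfl fun j _ => Finset.sum_congr rfl fun k _ => ?_)
  rw [Complex.inner]
  simp
  ring

/-- The pointwise lower bound behind the weighted energy estimate: `U`, `a j`, `X j`, `D j`, `θ j`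
stand for the values at a point of `u`, `∂_j u`, the flux `X_j`, `∂_j X_j` and `∂_j φ`. -/
theorem energy_pointwise {ι : Type*} [Fintype ι] {b : ι → ι → ℝ} (hsymm : ∀ j k, b j k = b k j)
    (hb : ∀ ξ : ι → ℝ, 0 ≤ ∑ j, ∑ k, b j k * ξ j * ξ k) {h : ℝ} (hh : 0 < h) (s p : ℝ)
    (c θ : ι → ℝ) (U z : ℂ) (a X D : ι → ℂ)
    (hX : ∀ j, X j = (∑ k, (-h ^ 2) • b j k • a k) + (h / 2) • c j • U) :
    ‖U‖ ^ 2 * (p - z.re - s * ∑ j, c j * θ j - s ^ 2 * ∑ j, ∑ k, b j k * θ j * θ k)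
      ≤ inner ℝ U ((∑ j, D j) + (h / 2) • (∑ j, c j • a j) + p • U - z * U)
        - ∑ j, (inner ℝ (a j) (X j) + inner ℝ U (D j)
          + 2 * s / h * θ j * inner ℝ U (X j)) := by
  have hpos := sum_inner_nonneg hb fun j => h • a j + (s * θ j) • U
  have hpos' : 0 ≤ h ^ 2 * (∑ j, ∑ k, b j k * inner ℝ (a j) (a k))
      + 2 * s * h * (∑ j, ∑ k, b j k * θ j * inner ℝ U (a k))
      + s ^ 2 * ‖U‖ ^ 2 * (∑ j, ∑ k, b j k * θ j * θ k) := by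
    have hsw : ∑ j, ∑ k, b j k * θ j * inner ℝ U (a k)
        = ∑ j, ∑ k, b j k * θ k * inner ℝ U (a j) := by
      rw [Finset.sum_comm]
      simp_rw [fun j k => hsymm k j]
    have : 2 * s * h * (∑ j, ∑ k, b j k * θ j * inner ℝ U (a k))
        = s * h * (∑ j, ∑ k, b j k * θ j * inner ℝ U (a k))
          + s * h * (∑ j, ∑ k, b j k * θ k * inner ℝ U (a j)) := by rw [← hsw]; ring
    rw [this]
    refine hpos.trans_eq ?_
    simp only [Finset.mul_sum, ← Finset.sum_add_distrib]
    refine Finset.sum_congr rfl fun j _ => Finset.sum_congr rfl fun k _ => ?_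
    simp only [inner_add_left, inner_add_right, real_inner_smul_left, real_inner_smul_right,
      real_inner_self_eq_norm_sq, real_inner_comm U]
    ring
  have e1 : ∑ j, inner ℝ (a j) (X j) = -h ^ 2 * (∑ j, ∑ k, b j k * inner ℝ (a j) (a k))
      + h / 2 * ∑ j, c j * inner ℝ U (a j) := by
    simp only [hX, inner_add_right, inner_sum, real_inner_smul_right, Finset.sum_add_distrib,
      Finset.mul_sum, real_inner_comm U]
  have e2 : ∑ j, 2 * s / h * θ j * inner ℝ U (X j)
      = -(2 * s * h * (∑ j, ∑ k, b j k * θ j * inner ℝ U (a k)))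
        + s * ‖U‖ ^ 2 * ∑ j, c j * θ j := by
    simp only [hX, inner_add_right, inner_sum, real_inner_smul_right, Finset.mul_sum,
      real_inner_self_eq_norm_sq, mul_add, Finset.sum_add_distrib, ← Finset.sum_neg_distrib]
    congr 1
    · refine Finset.sum_congr rfl fun j _ => Finset.sum_congr rfl fun k _ => ?_
      field_simp
    · refine Finset.sum_congr rfl fun j _ => ?_
      field_simp
  have e3 : inner ℝ U ((∑ j, D j) + (h / 2) • (∑ j, c j • a j) + p • U - z * U)
      = ∑ j, inner ℝ U (D j) + h / 2 * (∑ j, c j * inner ℝ U (a j)) + p * ‖U‖ ^ 2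
        - z.re * ‖U‖ ^ 2 := by
    simp only [inner_sub_right, inner_add_right, inner_sum, real_inner_smul_right,
      real_inner_self_eq_norm_sq, real_inner_mul_self]
  rw [Finset.sum_add_distrib, Finset.sum_add_distrib, e1, e2, e3]
  linarith

open scoped SchwartzMap LineDeriv in
/-- The flux `X_j = -h² Σ_k b_{jk} ∂_k u + (h/2) c_j u`. -/
def flux {n : ℕ} (h : ℝ) (b : Fin n → Fin n → (Fin n → ℝ) → ℝ) (c : Fin n → (Fin n → ℝ) → ℝ)
    (u : 𝓢(Fin n → ℝ, ℂ)) (j : Fin n) : 𝓢(Fin n → ℝ, ℂ) :=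
  (∑ k, (-h ^ 2) • SchwartzMap.smulLeftCLM ℂ (b j k) (∂_{(Pi.single k 1 : Fin n → ℝ)} u))
    + (h / 2) • SchwartzMap.smulLeftCLM ℂ (c j) u

open scoped SchwartzMap LineDeriv in
/-- `Pop` applied to a Schwartz function, as a Schwartz function. -/
def popSchwartz {n : ℕ} (h : ℝ) (b : Fin n → Fin n → (Fin n → ℝ) → ℝ)
    (c : Fin n → (Fin n → ℝ) → ℝ) (p0 : (Fin n → ℝ) → ℝ) (u : 𝓢(Fin n → ℝ, ℂ)) :
    𝓢(Fin n → ℝ, ℂ) :=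
  (∑ j, ∂_{(Pi.single j 1 : Fin n → ℝ)} (flux h b c u j))
    + (h / 2) • (∑ j, SchwartzMap.smulLeftCLM ℂ (c j) (∂_{(Pi.single j 1 : Fin n → ℝ)} u))
    + SchwartzMap.smulLeftCLM ℂ p0 u

open scoped SchwartzMap LineDeriv in
theorem lineDerivOp_single_apply {n : ℕ} (u : 𝓢(Fin n → ℝ, ℂ)) (j : Fin n) (x : Fin n → ℝ) :
    (∂_{(Pi.single j 1 : Fin n → ℝ)} u) x = pd j u x :=
  u.lineDerivOp_apply_eq_fderiv _ x

open scoped SchwartzMap in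
theorem flux_apply {n : ℕ} {b : Fin n → Fin n → (Fin n → ℝ) → ℝ} {c : Fin n → (Fin n → ℝ) → ℝ}
    (hb : ∀ j k, (b j k).HasTemperateGrowth) (hc : ∀ j, (c j).HasTemperateGrowth) (h : ℝ)
    (u : 𝓢(Fin n → ℝ, ℂ)) (j : Fin n) (x : Fin n → ℝ) :
    flux h b c u j x
      = (∑ k, (-h ^ 2) • b j k x • pd k u x) + (h / 2) • c j x • u x := by
  simp only [flux, add_apply, sum_apply, smul_apply,
    SchwartzMap.smulLeftCLM_apply_apply (hb _ _), SchwartzMap.smulLeftCLM_apply_apply (hc _),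
    lineDerivOp_single_apply]

open scoped SchwartzMap in
theorem popSchwartz_apply {n : ℕ} {b : Fin n → Fin n → (Fin n → ℝ) → ℝ}
    {c : Fin n → (Fin n → ℝ) → ℝ} {p0 : (Fin n → ℝ) → ℝ}
    (hc : ∀ j, (c j).HasTemperateGrowth) (hp : p0.HasTemperateGrowth) (h : ℝ)
    (u : 𝓢(Fin n → ℝ, ℂ)) (x : Fin n → ℝ) :
    popSchwartz h b c p0 u x
      = (∑ j, pd j (flux h b c u j) x) + (h / 2) • (∑ j, c j x • pd j u x) + p0 x • u x := by
  simp only [popSchwartz, add_apply, sum_apply, smul_apply,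
    SchwartzMap.smulLeftCLM_apply_apply hp, SchwartzMap.smulLeftCLM_apply_apply (hc _),
    lineDerivOp_single_apply]

open scoped SchwartzMap LineDeriv in
theorem Pop_eq_popSchwartz {n : ℕ} {b : Fin n → Fin n → (Fin n → ℝ) → ℝ}
    {c : Fin n → (Fin n → ℝ) → ℝ} {p0 : (Fin n → ℝ) → ℝ}
    (hb : ∀ j k, (b j k).HasTemperateGrowth) (hc : ∀ j, (c j).HasTemperateGrowth)
    (hp : p0.HasTemperateGrowth) (h : ℝ) (u : 𝓢(Fin n → ℝ, ℂ)) (x : Fin n → ℝ) :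
    Pop n h b c p0 u x = popSchwartz h b c p0 u x := by
  have hflux : ∀ j, pd j (flux h b c u j) x
      = (∑ k, (-h ^ 2) • pd j (SchwartzMap.smulLeftCLM ℂ (b j k)
          (∂_{(Pi.single k 1 : Fin n → ℝ)} u)) x)
        + (h / 2) • pd j (SchwartzMap.smulLeftCLM ℂ (c j) u) x := fun j => by
    simp only [← lineDerivOp_single_apply, flux, LineDeriv.lineDerivOp_add,
      LineDeriv.lineDerivOp_sum, LineDeriv.lineDerivOp_smul, add_apply, sum_apply, smul_apply]
  have hsecond : ∀ j k, hD h j (fun y => (b j k y : ℂ) * hD h k u y) x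
      = (-h ^ 2) • pd j (SchwartzMap.smulLeftCLM ℂ (b j k)
          (∂_{(Pi.single k 1 : Fin n → ℝ)} u)) x := fun j k => by
    have : (fun y => (b j k y : ℂ) * hD h k u y) = fun y => ((h : ℂ) / Complex.I)
        • SchwartzMap.smulLeftCLM ℂ (b j k) (∂_{(Pi.single k 1 : Fin n → ℝ)} u) y := by
      funext y
      rw [SchwartzMap.smulLeftCLM_apply_apply (hb j k), lineDerivOp_single_apply, hD]
      simp only [smul_eq_mul, Complex.real_smul]
      ring
    rw [hD, pd, this, fderiv_fun_const_smul (SchwartzMap.differentiableAt _), pd]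
    simp only [smul_apply, smul_eq_mul, Complex.real_smul, ← mul_assoc]
    congr 1
    rw [div_mul_div_comm, Complex.I_mul_I]
    push_cast
    ring
  have hfirst : ∀ j, pd j (fun y => (c j y : ℂ) * u y) x
      = pd j (SchwartzMap.smulLeftCLM ℂ (c j) u) x := fun j => by
    congr 1
    funext y
    rw [SchwartzMap.smulLeftCLM_apply_apply (hc j), Complex.real_smul]
  rw [popSchwartz_apply hc hp, Pop]
  simp only [hflux, hsecond, hfirst, Finset.sum_add_distrib]
  simp only [Complex.real_smul, ← Finset.mul_sum]
  have : ∑ j, (c j x : ℂ) * (h * pd j u x) = h * ∑ j, (c j x : ℂ) * pd j u x := by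
    rw [Finset.mul_sum]
    exact Finset.sum_congr rfl fun j _ => by ring
  rw [this]
  push_cast
  ring

theorem exists_lipschitzWith_exp_comp {E : Type*} [PseudoEMetricSpace E] {ψ : E → ℝ} {L : NNReal}
    (hψ : LipschitzWith L ψ) {R : ℝ} (hR : ∀ x, |ψ x| ≤ R) :
    ∃ C, LipschitzWith C fun x => Real.exp (ψ x) := by
  have hexp : LipschitzOnWith (Real.exp R).toNNReal Real.exp (Set.Iic R) := by
    refine LipschitzOnWith.of_le_add_mul' _ fun a ha y _ => ?_
    have h1 := Real.add_one_le_exp (y - a)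
    have h2 : Real.exp y = Real.exp a * Real.exp (y - a) := by rw [← Real.exp_add]; ring_nf
    have h3 : Real.exp a ≤ Real.exp R := Real.exp_le_exp.2 ha
    rw [Real.dist_eq]
    nlinarith [Real.exp_pos a, le_abs_self (a - y), abs_nonneg (a - y)]
  have h := hexp.comp (hψ.lipschitzOnWith (s := Set.univ))
    fun x _ => (le_abs_self _).trans (hR x)
  exact ⟨_, lipschitzOnWith_univ.1 h⟩

/-- The pointwise weighted estimate, once `Re ⟨u, g⟩` is absorbed by Young's inequality. -/
theorem mul_le_of_energy {p κ U g G T w M : ℝ} (hp : 0 < p) (hκ : 0 ≤ κ)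
    (hM : 0 < M) (hw : M⁻¹ ≤ w) (hwM : w ≤ M) (hG : G ≤ |U| * |g|)
    (hE : U ^ 2 * (p / 2 - κ) ≤ G - T) :
    M⁻¹ / 4 * (p * U ^ 2) ≤ M * (κ * U ^ 2) + M * (g ^ 2 / p) - w * T := by
  have hyoung : |U| * |g| ≤ p / 4 * U ^ 2 + g ^ 2 / p := by
    rw [← sub_nonneg]
    have : p / 4 * U ^ 2 + g ^ 2 / p - |U| * |g| = (p / 2 * |U| - |g|) ^ 2 / p := by
      rw [← sq_abs U, ← sq_abs g]
      field_simp
      ring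
    rw [this]
    positivity
  have hw0 : 0 < w := (inv_pos.2 hM).trans_le hw
  have h1 : w * (p / 4 * U ^ 2) ≤ w * (κ * U ^ 2) + w * (g ^ 2 / p) - w * T := by
    rw [← mul_add, ← mul_sub]
    refine mul_le_mul_of_nonneg_left ?_ hw0.le
    linarith
  have h2 : M⁻¹ * (p / 4 * U ^ 2) ≤ w * (p / 4 * U ^ 2) :=
    mul_le_mul_of_nonneg_right hw (by positivity)
  have h3 : w * (κ * U ^ 2) ≤ M * (κ * U ^ 2) := mul_le_mul_of_nonneg_right hwM (by positivity)
  have h4 : w * (g ^ 2 / p) ≤ M * (g ^ 2 / p) := mul_le_mul_of_nonneg_right hwM (by positivity)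
  linarith

open scoped SchwartzMap in
/-- The weighted energy estimate with weight `exp (2 s φ / h)`: it holds as soon as the modified
potential `p₀ - Re z - s ν φ - s² p₂(x, ∂φ)` is bounded below by `(p₀ + h) / 2` off `S`, and by
`(p₀ + h) / 2 - κ` on `S`. -/
theorem weighted_energy {n : ℕ} {b : Fin n → Fin n → (Fin n → ℝ) → ℝ}
    {c : Fin n → (Fin n → ℝ) → ℝ} {p0 : (Fin n → ℝ) → ℝ}
    (hb : ∀ j k, (b j k).HasTemperateGrowth) (hc : ∀ j, (c j).HasTemperateGrowth)
    (hp : p0.HasTemperateGrowth) (hsymm : ∀ j k x, b j k x = b k j x)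
    (hpos : ∀ (x ξ : Fin n → ℝ), 0 ≤ ∑ j, ∑ k, b j k x * ξ j * ξ k) (hp0 : ∀ x, 0 ≤ p0 x)
    {h : ℝ} (hh : 0 < h) {φ N : (Fin n → ℝ) → ℝ} {L : NNReal} (hφ : LipschitzWith L φ)
    (hN : ∀ x, DifferentiableAt ℝ φ x → fderiv ℝ φ x (fun j => c j x) = N x)
    {s R : ℝ} (hs : 0 ≤ s) (hR : ∀ x, |φ x| ≤ R) {z : ℂ} {κ : ℝ} (hκ : 0 ≤ κ)
    {S : Set (Fin n → ℝ)} (hS : MeasurableSet S)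
    (hlow : ∀ x (θ : Fin n → ℝ), (∀ j, |θ j| ≤ L) →
      (p0 x + h) / 2 - S.indicator (fun _ => κ) x
        ≤ p0 x - z.re - s * N x - s ^ 2 * ∑ j, ∑ k, b j k x * θ j * θ k)
    (u : 𝓢(Fin n → ℝ, ℂ)) :
    ∫ x, (p0 x + h) * ‖u x‖ ^ 2 ≤ 4 * Real.exp (2 * s / h * R) ^ 2 *
      (κ * (∫ x in S, ‖u x‖ ^ 2)
        + ∫ x, ‖Pop n h b c p0 u x - z * u x‖ ^ 2 / (p0 x + h)) := by
  set M := Real.exp (2 * s / h * R)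
  have hM : 0 < M := Real.exp_pos _
  let w : (Fin n → ℝ) → ℝ := fun x => Real.exp (2 * s / h * φ x)
  have hψ : ∀ x, |2 * s / h * φ x| ≤ 2 * s / h * R := fun x => by
    rw [abs_mul, abs_of_nonneg (by positivity)]
    exact mul_le_mul_of_nonneg_left (hR x) (by positivity)
  have hwM : ∀ x, w x ≤ M := fun x => Real.exp_le_exp.2 ((le_abs_self _).trans (hψ x))
  have hMw : ∀ x, M⁻¹ ≤ w x := fun x => by
    rw [← Real.exp_neg]
    exact Real.exp_le_exp.2 (neg_le_of_abs_le (hψ x))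
  obtain ⟨K, hK⟩ : ∃ K, LipschitzWith K w := by
    refine exists_lipschitzWith_exp_comp (L := (2 * s / h).toNNReal * L) ?_ hψ
    refine LipschitzWith.of_dist_le_mul fun x y => ?_
    rw [Real.dist_eq, ← mul_sub, abs_mul, abs_of_nonneg (by positivity), NNReal.coe_mul,
      Real.coe_toNNReal _ (by positivity), mul_assoc]
    exact mul_le_mul_of_nonneg_left (hφ.dist_le_mul x y) (by positivity)
  let B : ℂ →L[ℝ] ℂ →L[ℝ] ℝ := innerSL ℝ
  let V : Fin n → 𝓢(Fin n → ℝ, ℝ) := fun j => SchwartzMap.pairing B u (flux h b c u j)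
  let e : Fin n → Fin n → ℝ := fun j => Pi.single j 1
  have hV := fun j => integral_lipschitz_mul_schwartz (μ := volume) hK
    (fun x => (abs_of_pos (Real.exp_pos _)).trans_le (hwM x)) (V j) (e j)
  have hVd : ∀ j x, fderiv ℝ (V j) x (e j) = inner ℝ (pd j u x) (flux h b c u j x)
      + inner ℝ (u x) (pd j (flux h b c u j) x) := fun j x => by
    have := fderiv_inner_apply ℝ u.differentiableAt (flux h b c u j).differentiableAt (x := x) (e j)
    rw [add_comm]
    exact this
  let g : 𝓢(Fin n → ℝ, ℂ) := popSchwartz h b c p0 u - z • u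
  have hg : ∀ x, Pop n h b c p0 u x - z * u x = g x := fun x => by
    rw [Pop_eq_popSchwartz hb hc hp]; rfl
  have hpt : ∀ᵐ x, M⁻¹ / 4 * ((p0 x + h) * ‖u x‖ ^ 2)
      ≤ M * (S.indicator (fun x => κ * ‖u x‖ ^ 2) x) + M * (‖g x‖ ^ 2 / (p0 x + h))
        - ∑ j, (w x * fderiv ℝ (V j) x (e j) + lineDeriv ℝ w x (e j) * V j x) := by
    filter_upwards [hφ.ae_differentiableAt] with x hx
    let θ : Fin n → ℝ := fun j => fderiv ℝ φ x (e j)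
    have hθ : ∀ j, |θ j| ≤ L := fun j => by
      refine ((fderiv ℝ φ x).le_of_opNorm_le (norm_fderiv_le_of_lipschitz ℝ hφ) _).trans_eq ?_
      simp [e, Pi.norm_single]
    have hcθ : ∑ j, c j x * θ j = N x := by
      rw [← hN x hx]
      conv_rhs => rw [pi_eq_sum_univ' (fun j => c j x), map_sum]
      refine Finset.sum_congr rfl fun j _ => ?_
      rw [map_smul, smul_eq_mul]
    have hwd : ∀ j, lineDeriv ℝ w x (e j) = w x * (2 * s / h * θ j) := fun j => by
      have := ((hx.hasFDerivAt.const_mul (2 * s / h)).exp).hasLineDerivAt (e j)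
      exact this.lineDeriv
    have hE := energy_pointwise (b := fun j k => b j k x) (fun j k => hsymm j k x) (hpos x) hh s
      (p0 x) (fun j => c j x) θ (u x) z (fun j => pd j u x) (fun j => flux h b c u j x)
      (fun j => pd j (flux h b c u j) x) (fun j => flux_apply hb hc h u j x)
    have hT : ∑ j, (w x * fderiv ℝ (V j) x (e j) + lineDeriv ℝ w x (e j) * V j x)
        = w x * ∑ j, (inner ℝ (pd j u x) (flux h b c u j x)
          + inner ℝ (u x) (pd j (flux h b c u j) x)
          + 2 * s / h * θ j * inner ℝ (u x) (flux h b c u j x)) := by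
      rw [Finset.mul_sum]
      refine Finset.sum_congr rfl fun j _ => ?_
      rw [hVd, hwd, show V j x = inner ℝ (u x) (flux h b c u j x) from rfl]
      ring
    rw [← popSchwartz_apply hc hp, hcθ] at hE
    have hI : S.indicator (fun x => κ * ‖u x‖ ^ 2) x
        = S.indicator (fun _ => κ) x * ‖u x‖ ^ 2 := by
      by_cases hxS : x ∈ S <;> simp [hxS]
    rw [hT, hI]
    refine mul_le_of_energy (by linarith [hp0 x]) (Set.indicator_nonneg (fun _ _ => hκ) x) hM
      (hMw x) (hwM x) ?_ ((mul_le_mul_of_nonneg_left (hlow x θ hθ) (sq_nonneg _)).trans hE)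
    rw [abs_norm, abs_norm]
    exact real_inner_le_norm _ _
  have iu : Integrable (fun x => ‖u x‖ ^ 2) := (u.memLp 2).integrable_norm_pow two_ne_zero
  have ig : Integrable (fun x => ‖g x‖ ^ 2) := (g.memLp 2).integrable_norm_pow two_ne_zero
  have ip : Integrable (fun x => (p0 x + h) * ‖u x‖ ^ 2) := by
    have : Integrable (SchwartzMap.pairing B u (SchwartzMap.smulLeftCLM ℂ p0 u)) :=
      SchwartzMap.integrable _
    refine (this.add (iu.const_mul h)).congr (Filter.Eventually.of_forall fun x => ?_)
    rw [Pi.add_apply, SchwartzMap.pairing_apply_apply, SchwartzMap.smulLeftCLM_apply_apply hp]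
    change inner ℝ (u x) (p0 x • u x) + _ = _
    rw [real_inner_smul_right, real_inner_self_eq_norm_sq]
    ring
  have igp : Integrable (fun x => ‖g x‖ ^ 2 / (p0 x + h)) := by
    refine (ig.div_const h).mono' ?_ (Filter.Eventually.of_forall fun x => ?_)
    · exact ((g.continuous.norm.pow 2).div (hp.1.continuous.add continuous_const)
        fun x => (add_pos_of_nonneg_of_pos (hp0 x) hh).ne').aestronglyMeasurable
    · have := hp0 x
      rw [Real.norm_of_nonneg (by positivity)]
      gcongr
      linarith
  have iS : Integrable (S.indicator fun x => κ * ‖u x‖ ^ 2) := (iu.const_mul κ).indicator hS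
  have iV := integrable_finsetSum Finset.univ fun j _ => (hV j).1
  have key := integral_mono_ae (ip.const_mul (M⁻¹ / 4))
    (((iS.const_mul M).add (igp.const_mul M)).sub iV) hpt
  rw [integral_sub' ((iS.const_mul M).add (igp.const_mul M)) iV,
    integral_add' (iS.const_mul M) (igp.const_mul M), integral_const_mul, integral_const_mul,
    integral_const_mul, integral_indicator hS, integral_const_mul,
    integral_finsetSum _ fun j _ => (hV j).1, Finset.sum_eq_zero fun j _ => (hV j).2] at key
  simp only [hg]
  calc ∫ x, (p0 x + h) * ‖u x‖ ^ 2
      = 4 * M * (M⁻¹ / 4 * ∫ x, (p0 x + h) * ‖u x‖ ^ 2) := by field_simp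
    _ ≤ 4 * M * (M * (κ * ∫ x in S, ‖u x‖ ^ 2) + M * (∫ x, ‖g x‖ ^ 2 / (p0 x + h)) - 0) :=
        mul_le_mul_of_nonneg_left key (by positivity)
    _ = _ := by ring

theorem exists_lipschitzWith_pi {n : ℕ} {c : Fin n → (Fin n → ℝ) → ℝ}
    (hc : ∀ j, ContDiff ℝ 1 (c j))
    (hbdd : ∀ j, ∃ C : ℝ, ∀ x, ‖iteratedFDeriv ℝ 1 (c j) x‖ ≤ C) :
    ∃ K : NNReal, LipschitzWith K fun x j => c j x := by
  choose C hC using hbdd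
  refine ⟨∑ j, (C j).toNNReal, LipschitzWith.of_dist_le_mul fun x y => ?_⟩
  refine (dist_pi_le_iff (by positivity)).2 fun j => ?_
  have hj : LipschitzWith (C j).toNNReal (c j) := by
    refine lipschitzWith_of_nnnorm_fderiv_le ((hc j).differentiable one_ne_zero) fun x => ?_
    rw [← NNReal.coe_le_coe, coe_nnnorm, ← norm_iteratedFDeriv_one]
    exact (hC j x).trans (Real.le_coe_toNNReal _)
  refine (hj.dist_le_mul x y).trans (mul_le_mul_of_nonneg_right ?_ dist_nonneg)
  exact_mod_cast Finset.single_le_sum_of_canonicallyOrdered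
    (f := fun j => (C j).toNNReal) (Finset.mem_univ j)

/-- The truncation `f_ε ∘ p` is `O(√ε)`-Lipschitz, uniformly in `ε`. -/
theorem exists_lipschitz_truncation {E : Type*} [NormedAddCommGroup E] [NormedSpace ℝ E]
    {p : E → ℝ} (hp : ContDiff ℝ 2 p) (hp0 : ∀ x, 0 ≤ p x)
    (hbdd : ∃ M : ℝ, ∀ x, ‖iteratedFDeriv ℝ 2 p x‖ ≤ M) {f : ℝ → ℝ}
    (hf : ContDiffOn ℝ 1 f (Set.Ici 0)) {a : ℝ} (hconst : ∀ t, 2 ≤ t → f t = a) :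
    ∃ L, 0 ≤ L ∧ ∀ ε, 0 < ε → ∀ x y,
      |ε * f (p x / ε) - ε * f (p y / ε)| ≤ L * Real.sqrt ε * dist x y := by
  obtain ⟨M, hM⟩ := hbdd
  obtain ⟨L, hL0, hL⟩ := exists_lipschitz_comp_sq hf hconst
  refine ⟨L * Real.sqrt M, by positivity, fun ε hε x y => ?_⟩
  have h1 := hL (Real.sqrt (p x) / Real.sqrt ε) (Real.sqrt (p y) / Real.sqrt ε)
    (by positivity) (by positivity)
  rw [div_pow, div_pow, Real.sq_sqrt (hp0 x), Real.sq_sqrt (hp0 y), Real.sq_sqrt hε.le,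
    ← sub_div, abs_div, abs_of_nonneg (Real.sqrt_nonneg ε)] at h1
  have h2 := abs_sqrt_sub_sqrt_le hp hp0 hM x y
  rw [← dist_eq_norm] at h2
  have hs : 0 < Real.sqrt ε := Real.sqrt_pos.2 hε
  rw [← mul_sub, abs_mul, abs_of_pos hε]
  calc ε * |f (p x / ε) - f (p y / ε)|
      ≤ ε * (L * ((Real.sqrt M * dist x y) / Real.sqrt ε)) := by
        refine mul_le_mul_of_nonneg_left (h1.trans ?_) hε.le
        gcongr
    _ = Real.sqrt ε * Real.sqrt ε * (L * ((Real.sqrt M * dist x y) / Real.sqrt ε)) := by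
        rw [Real.mul_self_sqrt hε.le]
    _ = _ := by field_simp

/-- The sets `{⟨f_ε ∘ p₀⟩ ≤ ε}` increase with `ε`. -/
theorem favg_le_of_le {n : ℕ} {T0 : ℝ} (hT : 0 < T0) {f : ℝ → ℝ} (hf : MonotoneOn f (Set.Ici 0))
    {p0 : (Fin n → ℝ) → ℝ} (hp0 : ∀ x, 0 ≤ p0 x) {Φ : ℝ → (Fin n → ℝ) → (Fin n → ℝ)}
    {x : Fin n → ℝ}
    (hcont : ∀ ε, 0 < ε → Continuous fun t => ε * f (p0 (Φ t x) / ε)) {ε ε' : ℝ} (hε : 0 < ε)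
    (hle : ε ≤ ε') (h : favg n T0 f p0 Φ ε x ≤ ε) : favg n T0 f p0 Φ ε' x ≤ ε' := by
  have hε' := hε.trans_le hle
  have hmono : favg n T0 f p0 Φ ε' x ≤ ε' / ε * favg n T0 f p0 Φ ε x := by
    rw [favg, favg, mul_left_comm, ← intervalIntegral.integral_const_mul (ε' / ε)]
    refine mul_le_mul_of_nonneg_left ?_ (one_div_pos.2 hT).le
    refine intervalIntegral.integral_mono (by linarith) ((hcont ε' hε').intervalIntegrable _ _)
      (((hcont ε hε).const_mul _).intervalIntegrable _ _) fun t => ?_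
    rw [← mul_assoc, div_mul_cancel₀ _ hε.ne']
    refine mul_le_mul_of_nonneg_left (hf ?_ ?_ ?_) hε'.le
    · exact div_nonneg (hp0 _) hε'.le
    · exact div_nonneg (hp0 _) hε.le
    · exact div_le_div_of_nonneg_left (hp0 _) hε hle
  calc favg n T0 f p0 Φ ε' x ≤ ε' / ε * ε := hmono.trans (by gcongr)
    _ = ε' := div_mul_cancel₀ _ hε.ne'

/-- The lower bound for the modified potential, away from and near the small-average set. -/
theorem modified_potential_lower_bound {p r G A ε h C s B L Q κ : ℝ} (hG : G ≤ p) (hp : 0 ≤ p)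
    (hr : r ≤ C * h) (hs0 : 0 ≤ s) (hs : s ≤ 1 / 2) (hsB : s * (B * L ^ 2) ≤ 1 / 2)
    (hQ : Q ≤ B * (L * Real.sqrt ε) ^ 2) (hε : 0 ≤ ε) (hsε : s * ε = (2 * C + 1) * h)
    (hA : 0 ≤ A) (hκ : A ≤ ε → κ = (2 * C + 1) * h) (hκ0 : 0 ≤ κ) :
    (p + h) / 2 - κ ≤ p - r - s * (G - A) - s ^ 2 * Q := by
  rw [mul_pow, Real.sq_sqrt hε] at hQ
  have h1 : s ^ 2 * Q ≤ s * ε / 2 := by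
    calc s ^ 2 * Q ≤ s ^ 2 * (B * (L ^ 2 * ε)) := mul_le_mul_of_nonneg_left hQ (sq_nonneg s)
      _ = s * (B * L ^ 2) * (s * ε) := by ring
      _ ≤ 1 / 2 * (s * ε) := mul_le_mul_of_nonneg_right hsB (by positivity)
      _ = s * ε / 2 := by ring
  have h2 : s * G ≤ p / 2 := by
    calc s * G ≤ s * p := mul_le_mul_of_nonneg_left hG hs0
      _ ≤ 1 / 2 * p := mul_le_mul_of_nonneg_right hs hp
      _ = p / 2 := by ring
  have h3 := mul_nonneg hs0 hA
  rcases le_or_gt A ε with hAε | hAε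
  · have := hκ hAε
    linarith
  · have := mul_le_mul_of_nonneg_left hAε.le hs0
    linarith

/-- A quadratic form with bounded coefficients is bounded on a cube. -/
theorem sum_sum_mul_le {ι : Type*} [Fintype ι] {b B : ι → ι → ℝ} (hb : ∀ j k, |b j k| ≤ B j k)
    {θ : ι → ℝ} {L : ℝ} (hθ : ∀ j, |θ j| ≤ L) :
    ∑ j, ∑ k, b j k * θ j * θ k ≤ (∑ j, ∑ k, B j k) * L ^ 2 := by
  simp only [Finset.sum_mul]
  refine Finset.sum_le_sum fun j _ => Finset.sum_le_sum fun k _ => (le_abs_self _).trans ?_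
  rw [abs_mul, abs_mul, mul_assoc, sq]
  have := (abs_nonneg _).trans (hθ j)
  have := (abs_nonneg _).trans (hb j k)
  gcongr
  exacts [hb j k, hθ j, hθ k]

/-- Proposition 2.2: the exponentially weighted a priori estimate
`‖(p₀+h)^{1/2}u‖ ≤ C̃(‖(p₀+h)^{−1/2}(P−z)u‖ + h^{1/2}‖u‖_{Ω_h})` for `Re z ≤ Ch`, where
`Ω_h = {x : ⟨f_{C̃h} ∘ p₀⟩_{T₀}(x) ≤ C̃ h}`. -/
theorem statement5 (n : ℕ)
    (b : Fin n → Fin n → (Fin n → ℝ) → ℝ) (c : Fin n → (Fin n → ℝ) → ℝ)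
    (p0 : (Fin n → ℝ) → ℝ)
    (hb_smooth : ∀ j k, ContDiff ℝ (⊤ : ℕ∞) (b j k))
    (hc_smooth : ∀ j, ContDiff ℝ (⊤ : ℕ∞) (c j))
    (hp0_smooth : ContDiff ℝ (⊤ : ℕ∞) p0)
    (hb_symm : ∀ j k x, b j k x = b k j x)
    (hb_bdd : ∀ j k (m : ℕ), ∃ C : ℝ, ∀ x, ‖iteratedFDeriv ℝ m (b j k) x‖ ≤ C)
    (hc_bdd : ∀ j (m : ℕ), 1 ≤ m → ∃ C : ℝ, ∀ x, ‖iteratedFDeriv ℝ m (c j) x‖ ≤ C)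
    (hp0_bdd : ∀ m : ℕ, 2 ≤ m → ∃ C : ℝ, ∀ x, ‖iteratedFDeriv ℝ m p0 x‖ ≤ C)
    (hp2_pos : ∀ (x ξ : Fin n → ℝ), 0 ≤ ∑ j, ∑ k, b j k x * ξ j * ξ k)
    (hp0_pos : ∀ x, 0 ≤ p0 x)
    -- the flow `Φ_t` of the vector field `ν = Σ c_j ∂_{x_j}`
    (Φ : ℝ → (Fin n → ℝ) → (Fin n → ℝ))
    (hΦ0 : ∀ x, Φ 0 x = x)
    (hΦ : ∀ t x, HasDerivAt (fun s => Φ s x) (fun j => c j (Φ t x)) t)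
    -- the fixed cutoff function `f`
    (f : ℝ → ℝ)
    (hf_smooth : ContDiffOn ℝ (⊤ : ℕ∞) f (Set.Ici 0))
    (hf_mono : MonotoneOn f (Set.Ici 0))
    (hf_mem : ∀ t, 0 ≤ t → f t ∈ Set.Icc (0 : ℝ) (3 / 2))
    (hf_id : ∀ t ∈ Set.Icc (0 : ℝ) 1, f t = t)
    (hf_const : ∀ t, 2 ≤ t → f t = 3 / 2)
    (hf_le : ∀ t, 0 ≤ t → f t ≤ t)
    -- the fixed time `T₀`
    (T0 : ℝ) (hT0 : 0 < T0) :
    ∀ C : ℝ, 0 < C → ∃ Ctld : ℝ, 0 < Ctld ∧ ∃ h0 : ℝ, 0 < h0 ∧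
      ∀ h : ℝ, 0 < h → h ≤ h0 →
        ∀ (u : SchwartzMap (Fin n → ℝ) ℂ) (z : ℂ), z.re ≤ C * h →
          Real.sqrt (∫ x : Fin n → ℝ, (p0 x + h) * ‖u x‖ ^ 2)
            ≤ Ctld * (Real.sqrt (∫ x : Fin n → ℝ,
                  ‖Pop n h b c p0 (⇑u) x - z * u x‖ ^ 2 / (p0 x + h))
                + Real.sqrt h * Real.sqrt (∫ x in
                    {x : Fin n → ℝ | favg n T0 f p0 Φ (Ctld * h) x ≤ Ctld * h},
                    ‖u x‖ ^ 2)) := by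
  intro C hC
  have hbT : ∀ j k, (b j k).HasTemperateGrowth := fun j k =>
    hasTemperateGrowth_of_bounded_iteratedFDeriv (hb_smooth j k) (M := 0)
      fun m _ => hb_bdd j k m
  have hcT : ∀ j, (c j).HasTemperateGrowth := fun j =>
    hasTemperateGrowth_of_bounded_iteratedFDeriv (hc_smooth j) (hc_bdd j)
  have hpT : p0.HasTemperateGrowth :=
    hasTemperateGrowth_of_bounded_iteratedFDeriv hp0_smooth hp0_bdd
  choose B hB using fun j k => hb_bdd j k 0
  simp only [norm_iteratedFDeriv_zero, Real.norm_eq_abs] at hB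
  have hB0 : 0 ≤ ∑ j, ∑ k, B j k := Finset.sum_nonneg fun j _ => Finset.sum_nonneg fun k _ =>
    (abs_nonneg _).trans (hB j k 0)
  obtain ⟨K, hK⟩ := exists_lipschitzWith_pi (fun j => (hc_smooth j).of_le (by simp))
    fun j => hc_bdd j 1 le_rfl
  obtain ⟨L₀, hL₀, hG⟩ := exists_lipschitz_truncation (contDiff_infty.1 hp0_smooth 2)
    hp0_pos (hp0_bdd 2 le_rfl) (hf_smooth.of_le (by simp)) hf_const
  -- the weight is `exp (2 s φ / h)` with `φ` built from the truncation at height `ε = C₁ h`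
  let L₁ : ℝ := T0 * L₀ * Real.exp (K * T0)
  have hL₁ : 0 ≤ L₁ := by positivity
  let β : ℝ := (∑ j, ∑ k, B j k) * L₁ ^ 2
  have hβ : 0 ≤ β := by positivity
  let s : ℝ := 1 / (2 * (β + 1))
  have hs : 0 < s := by positivity
  have hs2 : s ≤ 1 / 2 := by
    refine one_div_le_one_div_of_le two_pos ?_
    linarith
  have hsβ : s * β ≤ 1 / 2 := by
    simp only [s]
    rw [one_div_mul_eq_div, div_le_iff₀ (by positivity)]
    linarith
  let C₁ : ℝ := (2 * C + 1) / s
  have hC₁ : 0 < C₁ := by positivity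
  let M : ℝ := Real.exp (3 * s * T0 * C₁)
  have hM : 0 < M := Real.exp_pos _
  let κ₀ : ℝ := 2 * C + 1
  have hκ₀ : 0 < κ₀ := by positivity
  let Ct : ℝ := C₁ + 2 * M * Real.sqrt κ₀ + 2 * M
  have hCt : 0 < Ct := by positivity
  refine ⟨Ct, hCt, 1, one_pos, fun h hh _ u z hz => ?_⟩
  have hGc : ∀ ε, 0 < ε → Continuous fun x => ε * f (p0 x / ε) := fun ε hε =>
    (LipschitzWith.of_dist_le_mul (K := (L₀ * Real.sqrt ε).toNNReal) fun x y => by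
      rw [Real.coe_toNNReal _ (by positivity), Real.dist_eq]
      exact hG ε hε x y).continuous
  have havg : ∀ ε, 0 < ε → Continuous (favg n T0 f p0 Φ ε) := fun ε hε =>
    continuous_flowAverage hK hΦ0 hΦ hT0 (hGc ε hε) (by positivity) (hG ε hε)
  have hε : 0 < C₁ * h := by positivity
  let G : (Fin n → ℝ) → ℝ := fun x => C₁ * h * f (p0 x / (C₁ * h))
  have hfp : ∀ x, 0 ≤ p0 x / (C₁ * h) := fun x => div_nonneg (hp0_pos x) hε.le
  have hG0 : ∀ x, 0 ≤ G x := fun x => mul_nonneg hε.le (hf_mem _ (hfp x)).1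
  have hGle : ∀ x, G x ≤ p0 x := fun x => by
    calc G x ≤ C₁ * h * (p0 x / (C₁ * h)) := mul_le_mul_of_nonneg_left (hf_le _ (hfp x)) hε.le
      _ = p0 x := mul_div_cancel₀ _ hε.ne'
  have hGb : ∀ x, |G x| ≤ C₁ * h * (3 / 2) := fun x => by
    rw [abs_of_nonneg (hG0 x)]
    exact mul_le_mul_of_nonneg_left (hf_mem _ (hfp x)).2 hε.le
  have havg0 : ∀ x, 0 ≤ favg n T0 f p0 Φ (C₁ * h) x := fun x =>
    mul_nonneg (by positivity) (intervalIntegral.integral_nonneg (by linarith) fun t _ => hG0 _)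
  have hφ : LipschitzWith (L₁ * Real.sqrt (C₁ * h)).toNNReal (flowWeight T0 Φ G) :=
    LipschitzWith.of_dist_le_mul fun x y => by
      rw [Real.coe_toNNReal _ (by positivity), Real.dist_eq]
      refine (abs_flowWeight_sub_le hK hΦ0 hΦ hT0 (hGc _ hε) (by positivity) (hG _ hε)
        x y).trans_eq ?_
      ring
  have hN : ∀ x, DifferentiableAt ℝ (flowWeight T0 Φ G) x →
      fderiv ℝ (flowWeight T0 Φ G) x (fun j => c j x) = G x - favg n T0 f p0 Φ (C₁ * h) x :=
    fun x hx => by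
      have h1 := hasDerivAt_flowWeight_comp_flow hK hΦ0 hΦ hT0 (hGc _ hε) x
      have h2 : HasFDerivAt (flowWeight T0 Φ G) (fderiv ℝ (flowWeight T0 Φ G) x) (Φ 0 x) := by
        rw [hΦ0]; exact hx.hasFDerivAt
      have h3 := h2.comp_hasDerivAt 0 (hΦ 0 x)
      rw [hΦ0] at h3
      exact h3.unique h1
  have hS : MeasurableSet {x | favg n T0 f p0 Φ (Ct * h) x ≤ Ct * h} :=
    (isClosed_le (havg _ (by positivity)) continuous_const).measurableSet
  have key := weighted_energy hbT hcT hpT hb_symm hp2_pos hp0_pos hh hφ hN hs.le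
    (abs_flowWeight_le hT0 Φ (by positivity) hGb) (z := z) (κ := κ₀ * h) (by positivity) hS
    (fun x θ hθ => by
      rw [Real.coe_toNNReal _ (by positivity)] at hθ
      refine modified_potential_lower_bound (hGle x) (hp0_pos x) hz hs.le hs2 hsβ
        (sum_sum_mul_le (fun j k => hB j k x) hθ) hε.le ?_ (havg0 x) (fun hx => ?_)
        (Set.indicator_nonneg (fun _ _ => by positivity) x)
      · rw [← mul_assoc, mul_div_cancel₀ _ hs.ne']
      · refine Set.indicator_of_mem (s := {x | favg n T0 f p0 Φ (Ct * h) x ≤ Ct * h}) ?_ _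
        refine favg_le_of_le hT0 hf_mono hp0_pos
          (fun ε hε => continuous_comp_flow (v := fun y j => c j y) hΦ (hGc ε hε) x) hε ?_ hx
        refine mul_le_mul_of_nonneg_right ?_ hh.le
        have : 0 ≤ 2 * M * Real.sqrt κ₀ + 2 * M := by positivity
        simp only [Ct]
        linarith) u
  rw [show 2 * s / h * (T0 * (C₁ * h * (3 / 2))) = 3 * s * T0 * C₁ by field_simp] at key
  set I₁ := ∫ x in {x | favg n T0 f p0 Φ (Ct * h) x ≤ Ct * h}, ‖u x‖ ^ 2
  set I₂ := ∫ x, ‖Pop n h b c p0 u x - z * u x‖ ^ 2 / (p0 x + h)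
  have hI₁ : 0 ≤ I₁ := integral_nonneg fun x => sq_nonneg _
  have hI₂ : 0 ≤ I₂ := integral_nonneg fun x =>
    div_nonneg (sq_nonneg _) (add_nonneg (hp0_pos x) hh.le)
  refine Real.sqrt_le_iff.2 ⟨by positivity, key.trans ?_⟩
  have hCM : 2 * M ≤ Ct := by
    have : 0 ≤ C₁ + 2 * M * Real.sqrt κ₀ := by positivity
    simp only [Ct]
    linarith
  have hCκ : 2 * M * Real.sqrt κ₀ ≤ Ct := by
    simp only [Ct]
    linarith
  calc 4 * M ^ 2 * (κ₀ * h * I₁ + I₂)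
      = (2 * M * Real.sqrt κ₀ * (Real.sqrt h * Real.sqrt I₁)) ^ 2
        + (2 * M * Real.sqrt I₂) ^ 2 := by
        simp only [mul_pow, Real.sq_sqrt hκ₀.le, Real.sq_sqrt hh.le, Real.sq_sqrt hI₁,
          Real.sq_sqrt hI₂]
        ring
    _ ≤ (Ct * (Real.sqrt h * Real.sqrt I₁)) ^ 2 + (Ct * Real.sqrt I₂) ^ 2 := by gcongr
    _ ≤ (Ct * (Real.sqrt I₂ + Real.sqrt h * Real.sqrt I₁)) ^ 2 := by
        have : 0 ≤ (Ct * (Real.sqrt h * Real.sqrt I₁)) * (Ct * Real.sqrt I₂) := by positivity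
        nlinarith
end
end
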